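/- Let F be a free group of finite rank and A a nonabelian subgroup of F. Let K be a finitely generated subgroup of F containing acl^∃(A). Then K is constructible from acl^∃(A) over cyclic subgroups. -/

import Mathlib

open FirstOrder Filter

/-! Common definitions: the first-order language of groups, algebraic/definable closures,
free products, amalgams, HNN extensions, etc. -/

/-- Function symbols of the language of groups: `1`, `⁻¹`, `·`. -/
inductive GrpFunc : ℕ → Type
  | one : GrpFunc 0
  | inv : GrpFunc 1
  | mul : GrpFunc 2

/-- The first-order language of groups `L = {·, ⁻¹, 1}` (no relation symbols). -/
def grpLang : FirstOrder.Language := ⟨GrpFunc, fun _ => Empty⟩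

/-- Every group is a `grpLang`-structure in the natural way. -/
instance grpStructure (G : Type*) [Group G] : grpLang.Structure G where
  funMap {_} f := match f with
    | .one => fun _ => (1 : G)
    | .inv => fun x => (x 0)⁻¹
    | .mul => fun x => x 0 * x 1
  RelMap {_} r := Empty.elim r

/-- A formula is existential if it is obtained from a quantifier-free formula by
prefixing existential quantifiers. -/
def IsExistential {L : FirstOrder.Language} {α : Type*} (φ : L.Formula α) : Prop :=
  ∃ (n : ℕ) (ψ : L.BoundedFormula α n), ψ.IsQF ∧ φ = ψ.exs

section ModelTheory

variable (L : FirstOrder.Language) {M : Type*} [L.Structure M]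

/-- The algebraic closure of a set of parameters `A` in an `L`-structure `M`:
elements satisfying, together with only finitely many other elements, some formula
with parameters from `A`. -/
def Lacl (A : Set M) : Set M :=
  {b | ∃ φ : L.Formula (↥A ⊕ Fin 1),
    {c : M | φ.Realize (Sum.elim Subtype.val fun _ => c)}.Finite ∧
    φ.Realize (Sum.elim Subtype.val fun _ => b)}

/-- The definable closure of a set of parameters `A` in an `L`-structure `M`. -/
def Ldcl (A : Set M) : Set M :=
  {b | ∃ φ : L.Formula (↥A ⊕ Fin 1),
    {c : M | φ.Realize (Sum.elim Subtype.val fun _ => c)} = {b}}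

/-- The existential algebraic closure of `A` in `M`. -/
def LaclE (A : Set M) : Set M :=
  {b | ∃ φ : L.Formula (↥A ⊕ Fin 1), IsExistential φ ∧
    {c : M | φ.Realize (Sum.elim Subtype.val fun _ => c)}.Finite ∧
    φ.Realize (Sum.elim Subtype.val fun _ => b)}

/-- The existential definable closure of `A` in `M`. -/
def LdclE (A : Set M) : Set M :=
  {b | ∃ φ : L.Formula (↥A ⊕ Fin 1), IsExistential φ ∧
    {c : M | φ.Realize (Sum.elim Subtype.val fun _ => c)} = {b}}

end ModelTheory

section GroupDefs

variable {G : Type*} [Group G]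

/-- Algebraic closure in a group, w.r.t. the language of groups. -/
def acl (A : Set G) : Set G := Lacl grpLang A

/-- Definable closure in a group, w.r.t. the language of groups. -/
def dcl (A : Set G) : Set G := Ldcl grpLang A

/-- Existential algebraic closure in a group. -/
def aclE (A : Set G) : Set G := LaclE grpLang A

/-- Existential definable closure in a group. -/
def dclE (A : Set G) : Set G := LdclE grpLang A

/-- Restricted algebraic closure: elements with finite orbit under automorphisms
of `G` fixing `A` pointwise. -/
def racl (A : Set G) : Set G :=
  {g | {x : G | ∃ f : G ≃* G, (∀ a ∈ A, f a = a) ∧ f g = x}.Finite}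

/-- Restricted definable closure: elements fixed by every automorphism of `G`
fixing `A` pointwise. -/
def rdcl (A : Set G) : Set G :=
  {g | ∀ f : G ≃* G, (∀ a ∈ A, f a = a) → f g = g}

/-- A set of group elements is nonabelian (contains two non-commuting elements). -/
def Nonabelian (A : Set G) : Prop := ∃ x ∈ A, ∃ y ∈ A, x * y ≠ y * x

/-- `F` is a free group of finite rank. -/
def IsFreeOfFiniteRank (F : Type*) [Group F] : Prop :=
  ∃ n : ℕ, Nonempty (F ≃* FreeGroup (Fin n))

/-- `G` is the internal free product of its subgroups `H` and `K`: the canonical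
homomorphism from the abstract free product `H ∗ K` to `G` is an isomorphism. -/
def InternalFreeProduct (H K : Subgroup G) : Prop :=
  Function.Bijective (Monoid.Coprod.lift H.subtype K.subtype)

/-- `G` is freely indecomposable relative to its subgroup `A`. -/
def FreelyIndecomposableRel (A : Subgroup G) : Prop :=
  ¬ ∃ G₁ G₂ : Subgroup G, G₁ ≠ ⊥ ∧ G₂ ≠ ⊥ ∧ A ≤ G₁ ∧ InternalFreeProduct G₁ G₂

/-- `B` is a free factor of the subgroup `K`: there is `L` such that the canonical
homomorphism from the abstract free product `B ∗ L` to the ambient group is injective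
with image exactly `K`. -/
def IsFreeFactorOf (B K : Subgroup G) : Prop :=
  ∃ L : Subgroup G,
    Function.Injective (Monoid.Coprod.lift B.subtype L.subtype) ∧
    (Monoid.Coprod.lift B.subtype L.subtype).range = K

/-- `K'` is the amalgamated free product `K ∗_C B` inside the ambient group `G`:
the canonical homomorphism from the abstract amalgamated product (pushout) of `K` and
`B` over `C` to `G` is injective with image exactly `K'`. -/
def IsAmalgamOf (K B C : Subgroup G) (hCK : C ≤ K) (hCB : C ≤ B) (K' : Subgroup G) : Prop :=
  ∃ ℓ : Monoid.PushoutI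
      (fun i : Bool =>
        (Subgroup.inclusion (show C ≤ cond i K B by cases i <;> assumption) :
          ↥C →* ↥(cond i K B))) →* G,
    (∀ i : Bool, ℓ.comp (Monoid.PushoutI.of i) = (cond i K B).subtype) ∧
    Function.Injective ℓ ∧ ℓ.range = K'

/-- `K'` is the HNN extension of `K` along `φ : C ≃* D` inside the ambient group `G`:
the canonical homomorphism from the abstract HNN extension of `K` along `φ` to `G` is
injective with image exactly `K'` (and is the inclusion on `K`). -/
def IsHNNOf (K : Subgroup G) {C D : Subgroup ↥K} (φ : ↥C ≃* ↥D) (K' : Subgroup G) : Prop :=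
  ∃ ℓ : HNNExtension ↥K C D φ →* G,
    ℓ.comp HNNExtension.of = K.subtype ∧ Function.Injective ℓ ∧ ℓ.range = K'

/-- One constructibility step: `K'` is an amalgamated free product of `K` with some
subgroup over a cyclic subgroup, or an HNN extension of `K` along an isomorphism of two
cyclic subgroups of `K`. -/
def ConstructStep (K K' : Subgroup G) : Prop :=
  (∃ (B C : Subgroup G) (hCK : C ≤ K) (hCB : C ≤ B),
      (∃ c : G, C = Subgroup.zpowers c) ∧ B ≤ K' ∧ K ≤ K' ∧ IsAmalgamOf K B C hCK hCB K')
  ∨ (∃ (C D : Subgroup ↥K) (φ : ↥C ≃* ↥D),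
      (∃ c : ↥K, C = Subgroup.zpowers c) ∧ (∃ d : ↥K, D = Subgroup.zpowers d) ∧ IsHNNOf K φ K')

/-- `B` is constructible from `A` by a finite sequence of amalgamated free products and
HNN-extensions along cyclic subgroups. -/
def ConstructibleFrom (A B : Subgroup G) : Prop := Relation.ReflTransGen ConstructStep A B

/-- The rank of a subgroup: the least cardinality of a generating set. For (subgroups of)
free groups this is the cardinality of a basis. -/
noncomputable def srank (H : Subgroup G) : Cardinal :=
  sInf {c : Cardinal | ∃ S : Set G, Subgroup.closure S = H ∧ c = Cardinal.mk ↥S}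

/-- `M` is a maximal abelian subgroup. -/
def IsMaxAbelian (M : Subgroup G) : Prop :=
  (∀ x ∈ M, ∀ y ∈ M, x * y = y * x) ∧
  ∀ N : Subgroup G, (∀ x ∈ N, ∀ y ∈ N, x * y = y * x) → M ≤ N → M = N

/-- `M` is a maximal abelian subgroup of the subgroup `H`. -/
def IsMaxAbelianIn (M H : Subgroup G) : Prop :=
  M ≤ H ∧ (∀ x ∈ M, ∀ y ∈ M, x * y = y * x) ∧
  ∀ N : Subgroup G, N ≤ H → (∀ x ∈ N, ∀ y ∈ N, x * y = y * x) → M ≤ N → M = N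

/-- `M` is a malnormal subgroup: `gMg⁻¹ ∩ M = 1` for every `g ∉ M`. -/
def Malnormal (M : Subgroup G) : Prop :=
  ∀ g : G, g ∉ M → ∀ x ∈ M, g * x * g⁻¹ ∈ M → x = 1

/-- A group is CSA if every maximal abelian subgroup is malnormal. -/
def IsCSA (G : Type*) [Group G] : Prop := ∀ M : Subgroup G, IsMaxAbelian M → Malnormal M

/-- Every abelian subgroup of `G` is cyclic. -/
def AbelianSubgroupsCyclic (G : Type*) [Group G] : Prop :=
  ∀ H : Subgroup G, (∀ x ∈ H, ∀ y ∈ H, x * y = y * x) → ∃ g : G, H = Subgroup.zpowers g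

/-- `G` is equationally noetherian: every system of equations over `G` in finitely many
variables is equivalent to a finite subsystem. -/
def EqNoetherian (G : Type*) [Group G] : Prop :=
  ∀ n : ℕ, 0 < n → ∀ S : Set (Monoid.Coprod G (FreeGroup (Fin n))),
    ∃ S₀ : Set (Monoid.Coprod G (FreeGroup (Fin n))), S₀ ⊆ S ∧ S₀.Finite ∧
      ∀ f : Monoid.Coprod G (FreeGroup (Fin n)) →* G,
        f.comp Monoid.Coprod.inl = MonoidHom.id G →
        ((∀ s ∈ S₀, f s = 1) ↔ ∀ s ∈ S, f s = 1)

/-- A group homomorphism is elementary w.r.t. the language of groups: it preserves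
and reflects all first-order formulas. -/
def ElementaryEmb {H K : Type*} [Group H] [Group K] (e : H →* K) : Prop :=
  ∀ (n : ℕ) (φ : grpLang.Formula (Fin n)) (v : Fin n → H),
    (φ.Realize fun i => e (v i)) ↔ φ.Realize v

/-- The inclusion of the subgroup `H` is an elementary embedding; i.e. the ambient group
is an elementary extension of `H`. -/
def ElementarySub (H : Subgroup G) : Prop := ElementaryEmb H.subtype

/-- A sequence of homomorphisms is stable. -/
def StableSeq {K H : Type*} [Group K] [Group H] (h : ℕ → (K →* H)) : Prop :=
  ∀ k : K, (∀ᶠ n in Filter.atTop, h n k = 1) ∨ (∀ᶠ n in Filter.atTop, h n k ≠ 1)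

/-- A sequence of homomorphisms has trivial stable kernel. -/
def TrivialStableKernel {K H : Type*} [Group K] [Group H] (h : ℕ → (K →* H)) : Prop :=
  ∀ k : K, (∀ᶠ n in Filter.atTop, h n k = 1) → k = 1

/-- A stable sequence of homomorphisms `g n : D → H` with trivial stable kernel strongly
converges to `D`, where `D` is a subgroup of an extension of the base group `H`, the base
group being embedded via `e`. -/
def StronglyConverges {H Gs : Type*} [Group H] [Group Gs] (e : H →* Gs)
    (D : Subgroup Gs) (g : ℕ → (↥D →* H)) : Prop :=
  StableSeq g ∧ TrivialStableKernel g ∧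
  (∀ (d : ↥D) (b : H), (d : Gs) = e b → ∀ᶠ n in Filter.atTop, g n d = b) ∧
  (∀ (d : ↥D) (b : H), (∃ᶠ n in Filter.atTop, g n d = b) → (d : Gs) = e b)

/-- The ball of radius `r` about the identity in the word metric w.r.t. `S`. -/
def wordBall (S : Set G) (r : ℕ) : Set G :=
  {g | ∃ l : List G, l.length ≤ r ∧ (∀ x ∈ l, x ∈ S ∨ x⁻¹ ∈ S) ∧ l.prod = g}

end GroupDefs

/-- A map `F → Ω → Ω` which restricts to an action of the subgroup `M`. -/
structure PartialAction {F : Type*} [Group F] (M : Subgroup F) (Ω : Type*) where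
  act : F → Ω → Ω
  one : ∀ ω, act 1 ω = ω
  mul : ∀ g ∈ M, ∀ h ∈ M, ∀ ω, act (g * h) ω = act g (act h ω)

namespace PartialAction

variable {F : Type*} [Group F] {M : Subgroup F} {Ω : Type*} (α : PartialAction M Ω)

lemma inv_act {g : F} (hg : g ∈ M) (ω : Ω) : α.act g⁻¹ (α.act g ω) = ω := by
  rw [← α.mul _ (M.inv_mem hg) _ hg, inv_mul_cancel, α.one]

lemma act_inv {g : F} (hg : g ∈ M) (ω : Ω) : α.act g (α.act g⁻¹ ω) = ω := by
  rw [← α.mul _ hg _ (M.inv_mem hg), mul_inv_cancel, α.one]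

lemma act_eq_iff {g : F} (hg : g ∈ M) {ω ω' : Ω} : α.act g ω = ω' ↔ ω = α.act g⁻¹ ω' := by
  constructor
  · rintro rfl; rw [α.inv_act hg]
  · rintro rfl; rw [α.act_inv hg]

/-- The stabilizer of a point. -/
def stab (ω : Ω) : Subgroup F where
  carrier := {g | g ∈ M ∧ α.act g ω = ω}
  one_mem' := ⟨M.one_mem, α.one ω⟩
  mul_mem' := by
    rintro a b ⟨ha, ha'⟩ ⟨hb, hb'⟩
    exact ⟨M.mul_mem ha hb, by rw [α.mul _ ha _ hb, hb', ha']⟩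
  inv_mem' := by
    rintro a ⟨ha, ha'⟩
    exact ⟨M.inv_mem ha, by rw [eq_comm, ← α.act_eq_iff ha]; exact ha'⟩

lemma mem_stab {ω : Ω} {g : F} : g ∈ α.stab ω ↔ g ∈ M ∧ α.act g ω = ω := Iff.rfl

/-- A wall of `Ω`, with sides `Xᶜ ∋ u` and `X ∋ v`, whose translates are crossed only by the
translates of `(u, v)`; any two points are joined by a chain of such translates. -/
structure IsWall (u v : Ω) (X : Set Ω) : Prop where
  hu : u ∉ X
  hv : v ∈ X
  cross : ∀ g ∈ M, ¬ (α.act g u = u ∧ α.act g v = v) → (α.act g u ∈ X ↔ α.act g v ∈ X)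
  conn : ∀ ω, Relation.EqvGen (fun a b => ∃ g ∈ M, a = α.act g u ∧ b = α.act g v) u ω

variable {α} {u v : Ω} {X : Set Ω}

lemma IsWall.symm (h : α.IsWall u v X) : α.IsWall v u Xᶜ where
  hu := fun h' => h' h.hv
  hv := h.hu
  cross := by
    intro g hg hne
    have := h.cross g hg (fun h' => hne h'.symm)
    simp only [Set.mem_compl_iff, this]
  conn := by
    intro ω
    have key : ∀ a b, Relation.EqvGen (fun a b => ∃ g ∈ M, a = α.act g u ∧ b = α.act g v) a b →
        Relation.EqvGen (fun a b => ∃ g ∈ M, a = α.act g v ∧ b = α.act g u) a b := by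
      intro a b hab
      induction hab with
      | rel a b hab =>
        obtain ⟨g, hg, h1, h2⟩ := hab
        exact .symm _ _ (.rel _ _ ⟨g, hg, h2, h1⟩)
      | refl => exact .refl _
      | symm _ _ _ ih => exact .symm _ _ ih
      | trans _ _ _ _ _ ih1 ih2 => exact .trans _ _ _ ih1 ih2
    exact .trans _ _ _ (.rel _ _ ⟨1, M.one_mem, (α.one _).symm, (α.one _).symm⟩)
      (key _ _ (h.conn ω))

lemma IsWall.ne (h : α.IsWall u v X) : u ≠ v := by
  rintro rfl; exact h.hu h.hv

lemma IsWall.translate (h : α.IsWall u v X) {k : F} (hk : k ∈ M) :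
    α.IsWall (α.act k u) (α.act k v) {ω | α.act k⁻¹ ω ∈ X} where
  hu := by simpa [α.inv_act hk] using h.hu
  hv := by simpa [α.inv_act hk] using h.hv
  cross := by
    intro g hg hne
    have e : ∀ ω, α.act k⁻¹ (α.act g (α.act k ω)) = α.act (k⁻¹ * (g * k)) ω := by
      intro ω
      rw [α.mul _ (M.inv_mem hk) _ (M.mul_mem hg hk), α.mul _ hg _ hk]
    simp only [Set.mem_ofPred_eq, e]
    apply h.cross _ (M.mul_mem (M.inv_mem hk) (M.mul_mem hg hk))
    rintro ⟨h1, h2⟩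
    apply hne
    rw [← e] at h1 h2
    have h1' := (α.act_eq_iff (M.inv_mem hk)).1 h1
    have h2' := (α.act_eq_iff (M.inv_mem hk)).1 h2
    rw [inv_inv] at h1' h2'
    exact ⟨h1', h2'⟩
  conn := by
    intro ω
    have key : ∀ a b, Relation.EqvGen (fun a b => ∃ g ∈ M, a = α.act g u ∧ b = α.act g v) a b →
        Relation.EqvGen (fun a b => ∃ g ∈ M, a = α.act g (α.act k u) ∧ b = α.act g (α.act k v))
          (α.act k a) (α.act k b) := by
      intro a b hab
      induction hab with
      | rel a b hab =>
        obtain ⟨g, hg, rfl, rfl⟩ := hab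
        refine .rel _ _ ⟨k * g * k⁻¹, M.mul_mem (M.mul_mem hk hg) (M.inv_mem hk), ?_, ?_⟩ <;>
        rw [α.mul _ (M.mul_mem hk hg) _ (M.inv_mem hk), α.inv_act hk, α.mul _ hk _ hg]
      | refl => exact .refl _
      | symm _ _ _ ih => exact .symm _ _ ih
      | trans _ _ _ _ _ ih1 ih2 => exact .trans _ _ _ ih1 ih2
    have := key _ _ (h.conn (α.act k⁻¹ ω))
    rwa [α.act_inv hk] at this

/-- Half-spaces are nested. -/
lemma IsWall.nest (h : α.IsWall u v X) {k : F} (hk : k ∈ M)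
    (hkC : ¬ (α.act k u = u ∧ α.act k v = v)) (hku : α.act k u ∉ X) :
    (α.act k⁻¹ u ∈ X → ∀ ω ∈ X, α.act k⁻¹ ω ∈ X) ∧
    (α.act k⁻¹ u ∉ X → ∀ ω ∈ X, α.act k⁻¹ ω ∉ X) := by
  have hki := M.inv_mem hk
  have hkv : α.act k v ∉ X := fun hh => hku ((h.cross k hk hkC).2 hh)
  have hedge : ∀ a b, (∃ g ∈ M, a = α.act g u ∧ b = α.act g v) →
      ((α.act k⁻¹ a ∈ X ↔ α.act k⁻¹ b ∈ X) ∨ (a ∉ X ∧ b ∉ X)) := by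
    rintro a b ⟨g, hg, rfl, rfl⟩
    by_cases hc : α.act (k⁻¹ * g) u = u ∧ α.act (k⁻¹ * g) v = v
    · right
      rw [α.mul _ hki _ hg, α.mul _ hki _ hg, α.act_eq_iff hki, α.act_eq_iff hki, inv_inv] at hc
      rw [hc.1, hc.2]; exact ⟨hku, hkv⟩
    · left
      have := h.cross _ (M.mul_mem hki hg) hc
      rwa [α.mul _ hki _ hg, α.mul _ hki _ hg] at this
  have hside : ∀ a b, (∃ g ∈ M, a = α.act g u ∧ b = α.act g v) →
      (a ∈ X ↔ b ∈ X) ∨ (a = u ∧ b = v) := by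
    rintro a b ⟨g, hg, rfl, rfl⟩
    by_cases hc : α.act g u = u ∧ α.act g v = v
    · right; exact hc
    · left; exact h.cross _ hg hc
  -- the side of the translated wall is constant on `X` and contains `u`, `v` on the same side
  have huv : α.act k⁻¹ u ∈ X ↔ α.act k⁻¹ v ∈ X := by
    apply h.cross _ hki
    rintro ⟨h1, h2⟩
    apply hkC
    rw [α.act_eq_iff hki, inv_inv] at h1 h2
    exact ⟨h1.symm, h2.symm⟩
  have key : ∀ a b, Relation.EqvGen (fun a b => ∃ g ∈ M, a = α.act g u ∧ b = α.act g v) a b →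
      ((a ∈ X → (α.act k⁻¹ a ∈ X ↔ α.act k⁻¹ u ∈ X)) ↔
       (b ∈ X → (α.act k⁻¹ b ∈ X ↔ α.act k⁻¹ u ∈ X))) := by
    intro a b hab
    induction hab with
    | rel a b hab =>
      rcases hside a b hab with h1 | ⟨rfl, rfl⟩
      · rcases hedge a b hab with h2 | ⟨h2, h3⟩
        · rw [h1, h2]
        · simp [h2, h3]
      · simp [h.hu, h.hv, huv]
    | refl => rfl
    | symm _ _ _ ih => exact ih.symm
    | trans _ _ _ _ _ ih1 ih2 => exact ih1.trans ih2
  have all : ∀ ω ∈ X, (α.act k⁻¹ ω ∈ X ↔ α.act k⁻¹ u ∈ X) := fun ω =>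
    (key u ω (h.conn ω)).1 (fun hh => absurd hh h.hu)
  exact ⟨fun h1 ω hω => (all ω hω).2 h1, fun h1 ω hω h2 => h1 ((all ω hω).1 h2)⟩

/-- The subgroup fixing both sides. -/
lemma IsWall.generate (h : α.IsWall u v X) {H : Subgroup F} (hH : H ≤ M)
    (h1 : α.stab u ≤ H) (h2 : α.stab v ≤ H) (h3 : ∀ g ∈ M, α.act g u = v → g ∈ H) : H = M := by
  apply le_antisymm hH
  have key : ∀ a b, Relation.EqvGen (fun a b => ∃ g ∈ M, a = α.act g u ∧ b = α.act g v) a b →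
      ((∃ g ∈ H, a = α.act g u ∨ a = α.act g v) ↔ (∃ g ∈ H, b = α.act g u ∨ b = α.act g v)) := by
    -- an element moving `u` or `v` like an element of `H` lies in `H`
    have memu : ∀ g ∈ M, ∀ k ∈ H, (α.act g u = α.act k u ∨ α.act g u = α.act k v) → g ∈ H := by
      intro g hg k hk hh
      have hkM := hH hk
      rw [eq_comm, eq_comm (b := α.act k v), α.act_eq_iff hkM, α.act_eq_iff hkM,
        ← α.mul _ (M.inv_mem hkM) _ hg] at hh
      have : k⁻¹ * g ∈ H := by
        rcases hh with hh | hh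
        · exact h1 ⟨M.mul_mem (M.inv_mem hkM) hg, hh.symm⟩
        · exact h3 _ (M.mul_mem (M.inv_mem hkM) hg) hh.symm
      simpa using H.mul_mem hk this
    have memv : ∀ g ∈ M, ∀ k ∈ H, (α.act g v = α.act k u ∨ α.act g v = α.act k v) → g ∈ H := by
      intro g hg k hk hh
      have hkM := hH hk
      rw [eq_comm, eq_comm (b := α.act k v), α.act_eq_iff hkM, α.act_eq_iff hkM,
        ← α.mul _ (M.inv_mem hkM) _ hg] at hh
      have hM := M.mul_mem (M.inv_mem hkM) hg
      have : k⁻¹ * g ∈ H := by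
        rcases hh with hh | hh
        · rw [eq_comm, α.act_eq_iff hM] at hh
          have := H.inv_mem (h3 _ (M.inv_mem hM) hh.symm)
          rwa [inv_inv] at this
        · exact h2 ⟨hM, hh.symm⟩
      simpa using H.mul_mem hk this
    intro a b hab
    induction hab with
    | rel a b hab =>
      obtain ⟨g, hg, rfl, rfl⟩ := hab
      constructor
      · rintro ⟨k, hk, hh⟩; exact ⟨g, memu g hg k hk hh, Or.inr rfl⟩
      · rintro ⟨k, hk, hh⟩; exact ⟨g, memv g hg k hk hh, Or.inl rfl⟩
    | refl => rfl
    | symm _ _ _ ih => exact ih.symm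
    | trans _ _ _ _ _ ih1 ih2 => exact ih1.trans ih2
  intro g hg
  obtain ⟨k, hk, hh⟩ := (key _ _ (h.conn (α.act g u))).1 ⟨1, H.one_mem, Or.inl (α.one u).symm⟩
  have hkM := hH hk
  rw [eq_comm, eq_comm (b := α.act k v), α.act_eq_iff hkM, α.act_eq_iff hkM,
    ← α.mul _ (M.inv_mem hkM) _ hg] at hh
  have hM := M.mul_mem (M.inv_mem hkM) hg
  have : k⁻¹ * g ∈ H := by
    rcases hh with hh | hh
    · exact h1 ⟨hM, hh.symm⟩
    · exact h3 _ hM hh.symm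
  simpa using H.mul_mem hk this

end PartialAction

section Amalgam
open Monoid

variable {F : Type*} [Group F]

/-- A criterion for an internal amalgamated product: alternating words are nontrivial. -/
lemma isAmalgamOf_of_alternating {P B C : Subgroup F} (hCP : C ≤ P) (hCB : C ≤ B)
    (h : ∀ l : List (Σ i : Bool, ↥(cond i P B)), l ≠ [] → (∀ x ∈ l, (x.2 : F) ∉ C) →
      l.IsChain (fun a b => a.1 ≠ b.1) → (l.map fun x => (x.2 : F)).prod ∉ C) :
    IsAmalgamOf P B C hCP hCB (P ⊔ B) := by
  set φ : ∀ i : Bool, ↥C →* ↥(cond i P B) := fun i =>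
    (Subgroup.inclusion (show C ≤ cond i P B by cases i <;> assumption)) with hφ
  have hinj : ∀ i, Function.Injective (φ i) := fun i => Subgroup.inclusion_injective _
  let ℓ : PushoutI φ →* F := PushoutI.lift (fun i => (cond i P B).subtype) C.subtype
    (fun i => by ext x; rfl)
  have hof : ∀ i (x : ↥(cond i P B)), ℓ (PushoutI.of i x) = x := fun i x => PushoutI.lift_of _ _ _ _
  have hbase : ∀ x : C, ℓ (PushoutI.base φ x) = x := fun x => PushoutI.lift_base _ _ _ _
  refine ⟨ℓ, fun i => by ext x; exact hof i x, ?_, ?_⟩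
  · rw [injective_iff_map_eq_one]
    intro x hx
    obtain ⟨d⟩ := PushoutI.NormalWord.transversal_nonempty φ hinj
    classical
    obtain ⟨w, rfl⟩ : ∃ w : PushoutI.NormalWord d, w.prod = x :=
      ⟨PushoutI.NormalWord.equiv x, PushoutI.NormalWord.equiv.symm_apply_apply x⟩
    have hprod : ∀ v : CoprodI.Word (fun i : Bool => ↥(cond i P B)),
        ℓ (PushoutI.ofCoprodI v.prod) = (v.toList.map fun x => (x.2 : F)).prod := by
      intro v
      rw [CoprodI.Word.prod, map_list_prod, map_list_prod, List.map_map, List.map_map]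
      congr 1
    have hx' : (w.head : F) * (w.toList.map fun x => (x.2 : F)).prod = 1 := by
      rw [← hx, PushoutI.NormalWord.prod, map_mul, hbase, hprod]
    by_cases hl : w.toList = []
    · rw [hl] at hx'
      simp only [List.map_nil, List.prod_nil, mul_one, OneMemClass.coe_eq_one] at hx'
      have : w = PushoutI.NormalWord.empty := by
        exact PushoutI.NormalWord.ext hx' hl
      rw [this]; simp
    · exfalso
      refine h w.toList hl ?_ w.chain_ne ?_
      · rintro ⟨i, g⟩ hg hgC
        have h1 : g ∈ d.set i := w.normalized i g hg
        have h2 := w.ne_one _ hg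
        apply h2
        have h3 : g ∈ (φ i).range := ⟨⟨g, hgC⟩, rfl⟩
        obtain ⟨y, hy, huniq⟩ := (d.compl i).existsUnique g
        have e1 := huniq (⟨g, h3⟩, ⟨1, d.one_mem i⟩) (by simp)
        have e2 := huniq (⟨1, one_mem _⟩, ⟨g, h1⟩) (by simp)
        have := e1.trans e2.symm
        simp only [Prod.mk.injEq, Subtype.mk.injEq] at this
        exact this.1
      · rw [← inv_inv (List.prod _), ← eq_inv_of_mul_eq_one_left hx']
        exact C.inv_mem w.head.2
  · apply le_antisymm
    · rintro _ ⟨x, rfl⟩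
      induction x using PushoutI.induction_on with
      | of i g =>
        rw [hof]
        cases i
        · exact (le_sup_right : B ≤ P ⊔ B) g.2
        · exact (le_sup_left : P ≤ P ⊔ B) g.2
      | base c => rw [hbase]; exact (le_sup_right : B ≤ P ⊔ B) (hCB c.2)
      | mul x y hx hy => rw [map_mul]; exact mul_mem hx hy
    · apply sup_le
      · intro g hg; exact ⟨PushoutI.of (φ := φ) true ⟨g, hg⟩, hof true ⟨g, hg⟩⟩
      · intro g hg; exact ⟨PushoutI.of (φ := φ) false ⟨g, hg⟩, hof false ⟨g, hg⟩⟩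

end Amalgam

section HNN

variable {F : Type*} [Group F]

/-- A criterion for an internal HNN extension. -/
lemma isHNNOf_of_reduced {P : Subgroup F} {C D : Subgroup P} (φ : C ≃* D) (t : F)
    (ht : ∀ a : C, t * ((a : P) : F) = ((φ a : P) : F) * t) {M : Subgroup F}
    (hM : P ⊔ Subgroup.zpowers t = M)
    (h : ∀ l : List (ℤˣ × P), l ≠ [] →
      l.IsChain (fun a b => a.2 ∈ HNNExtension.toSubgroup C D a.1 → a.1 = b.1) →
      (l.map fun x => t ^ (x.1 : ℤ) * (x.2 : F)).prod ∉ P) :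
    IsHNNOf P φ M := by
  let ℓ : HNNExtension P C D φ →* F := HNNExtension.lift P.subtype t ht
  have hof : ∀ x : P, ℓ (HNNExtension.of x) = x := fun x => HNNExtension.lift_of _ _ _ _
  have htt : ℓ HNNExtension.t = t := HNNExtension.lift_t _ _ _
  refine ⟨ℓ, by ext x; exact hof x, ?_, ?_⟩
  · rw [injective_iff_map_eq_one]
    intro x hx
    obtain ⟨d⟩ := HNNExtension.NormalWord.TransversalPair.nonempty P C D
    classical
    obtain ⟨w, rfl⟩ : ∃ w : HNNExtension.NormalWord d, w.prod φ = x :=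
      ⟨HNNExtension.NormalWord.equiv φ d x, (HNNExtension.NormalWord.equiv φ d).symm_apply_apply x⟩
    have hx' : (w.head : F) * (w.toList.map fun x => t ^ (x.1 : ℤ) * (x.2 : F)).prod = 1 := by
      rw [← hx, HNNExtension.NormalWord.ReducedWord.prod, map_mul, hof, map_list_prod,
        List.map_map]
      congr 3
      funext y
      simp [hof, htt]
    by_cases hl : w.toList = []
    · rw [hl] at hx'
      simp only [List.map_nil, List.prod_nil, mul_one, OneMemClass.coe_eq_one] at hx'
      simp [HNNExtension.NormalWord.ReducedWord.prod, hl, hx']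
    · exfalso
      refine h w.toList hl w.chain ?_
      rw [← inv_inv (List.prod _), ← eq_inv_of_mul_eq_one_left hx']
      exact P.inv_mem w.head.2
  · rw [← hM]
    apply le_antisymm
    · rintro _ ⟨x, rfl⟩
      induction x using HNNExtension.induction_on with
      | of g => rw [hof]; exact (le_sup_left : P ≤ _) g.2
      | t => rw [htt]; exact (le_sup_right : _ ≤ P ⊔ Subgroup.zpowers t) (Subgroup.mem_zpowers t)
      | mul x y hx hy => rw [map_mul]; exact mul_mem hx hy
      | inv x hx => rw [map_inv]; exact inv_mem hx
    · apply sup_le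
      · intro g hg; exact ⟨HNNExtension.of ⟨g, hg⟩, hof ⟨g, hg⟩⟩
      · rw [Subgroup.zpowers_le]; exact ⟨HNNExtension.t, htt⟩

end HNN

/-- `Q` is an amalgamated product of `P` or an HNN extension of `P` over the cyclic subgroup
generated by `c`. -/
def SplitsOver {F : Type*} [Group F] (c : F) (P Q : Subgroup F) : Prop :=
  (∃ (B : Subgroup F) (hP : Subgroup.zpowers c ≤ P) (hB : Subgroup.zpowers c ≤ B),
    B ≤ Q ∧ P ≤ Q ∧ IsAmalgamOf P B (Subgroup.zpowers c) hP hB Q) ∨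
  ∃ (hc : c ∈ P) (d : P) (φ : Subgroup.zpowers (⟨c, hc⟩ : P) ≃* Subgroup.zpowers d),
    IsHNNOf P φ Q

lemma constructStep_iff {F : Type*} [Group F] {P Q : Subgroup F} :
    ConstructStep P Q ↔ ∃ c, SplitsOver c P Q := by
  constructor
  · rintro (⟨B, C, hP, hB, ⟨c, rfl⟩, h⟩ | ⟨C, D, φ, ⟨⟨c, hc⟩, rfl⟩, ⟨d, rfl⟩, h⟩)
    · exact ⟨c, Or.inl ⟨B, hP, hB, h⟩⟩
    · exact ⟨c, Or.inr ⟨hc, d, φ, h⟩⟩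
  · rintro ⟨c, ⟨B, hP, hB, h⟩ | ⟨hc, d, φ, h⟩⟩
    · exact Or.inl ⟨B, _, hP, hB, ⟨c, rfl⟩, h⟩
    · exact Or.inr ⟨_, _, φ, ⟨_, rfl⟩, ⟨d, rfl⟩, h⟩

namespace PartialAction

variable {F : Type*} [Group F] {M : Subgroup F} {Ω : Type*} {α : PartialAction M Ω}
  {u v : Ω} {X : Set Ω}

lemma IsWall.mapsTo_left (h : α.IsWall u v X) {a : F} (ha : a ∈ α.stab u) (hv : α.act a v ≠ v)
    {ω : Ω} (hω : ω ∈ X) : α.act a ω ∉ X ∧ α.act a ω ≠ u := by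
  have hai := M.inv_mem ha.1
  have e : α.act a⁻¹ u = u := ((α.act_eq_iff ha.1).1 ha.2).symm
  constructor
  · have := (h.nest hai (fun hh => hv (by rw [α.act_eq_iff ha.1]; exact hh.2.symm))
      (by rw [e]; exact h.hu)).2 (by rw [inv_inv, ha.2]; exact h.hu) ω hω
    rwa [inv_inv] at this
  · rw [Ne, α.act_eq_iff ha.1, e]
    rintro rfl; exact h.hu hω

/-- The amalgamated product decomposition when the two sides lie in different orbits. -/
lemma IsWall.amalgam (h : α.IsWall u v X) (huv : ∀ g ∈ M, α.act g u ≠ v) :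
    IsAmalgamOf (α.stab u) (α.stab v) (α.stab u ⊓ α.stab v) inf_le_left inf_le_right M := by
  have hgen : α.stab u ⊔ α.stab v = M :=
    h.generate (sup_le (fun g hg => hg.1) (fun g hg => hg.1)) le_sup_left le_sup_right
      (fun g hg hh => absurd hh (huv g hg))
  have key : ∀ l : List (Σ i : Bool, ↥(cond i (α.stab u) (α.stab v))),
      (∀ x ∈ l, (x.2 : F) ∉ α.stab u ⊓ α.stab v) → l.IsChain (fun a b => a.1 ≠ b.1) →
      ∀ x ∈ l.head?, ∃ p, (p = u ∨ p = v) ∧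
        (l.map fun x => (x.2 : F)).prod ∈ M ∧
        (x.1 = true → α.act (l.map fun x => (x.2 : F)).prod p ∉ X ∧
          α.act (l.map fun x => (x.2 : F)).prod p ≠ u) ∧
        (x.1 = false → α.act (l.map fun x => (x.2 : F)).prod p ∈ X ∧
          α.act (l.map fun x => (x.2 : F)).prod p ≠ v) := by
    intro l
    induction l with
    | nil => simp
    | cons a l ih =>
      intro hC hch x hx
      simp only [List.head?_cons, Option.mem_def, Option.some.injEq] at hx
      subst hx
      have haC := hC a (by simp)
      have haM : (a.2 : F) ∈ M := by
        rcases a with ⟨i, a⟩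
        cases i
        · exact a.2.1
        · exact a.2.1
      -- the action of the first letter
      have hstep : ∀ ω, (a.1 = true → ω ∈ X → α.act a.2 ω ∉ X ∧ α.act a.2 ω ≠ u) ∧
          (a.1 = false → ω ∉ X → α.act a.2 ω ∈ X ∧ α.act a.2 ω ≠ v) := by
        rcases a with ⟨i, a⟩
        intro ω
        cases i
        · refine ⟨by simp, fun _ hω => ?_⟩
          have ha : (a : F) ∈ α.stab v := a.2
          have := h.symm.mapsTo_left (u := v) (v := u) ha
            (fun hh => haC ⟨⟨ha.1, hh⟩, ha⟩) (ω := ω) hω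
          simpa using this
        · refine ⟨fun _ hω => ?_, by simp⟩
          have ha : (a : F) ∈ α.stab u := a.2
          exact h.mapsTo_left ha (fun hh => haC ⟨ha, ⟨ha.1, hh⟩⟩) hω
      rcases l with _ | ⟨b, l⟩
      · refine ⟨if a.1 then v else u, by split_ifs <;> simp, by simpa using haM, ?_, ?_⟩
        · intro e
          simpa [e] using (hstep v).1 e h.hv
        · intro e
          simpa [e] using (hstep u).2 e h.hu
      · obtain ⟨p, hp, hM, h1, h2⟩ :=
          ih (fun x hx => hC x (by simp only [List.mem_cons] at hx ⊢; tauto))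
          hch.tail b (by simp)
        have hne : a.1 ≠ b.1 := (List.isChain_cons_cons.1 hch).1
        refine ⟨p, hp, ?_, ?_, ?_⟩
        · rw [List.map_cons, List.prod_cons]; exact M.mul_mem haM hM
        · intro e
          have hb : b.1 = false := by
            rw [e] at hne; cases hb : b.1 <;> simp_all
          rw [List.map_cons, List.prod_cons, α.mul _ haM _ hM]
          exact (hstep _).1 e (h2 hb).1
        · intro e
          have hb : b.1 = true := by
            rw [e] at hne; cases hb : b.1 <;> simp_all
          rw [List.map_cons, List.prod_cons, α.mul _ haM _ hM]
          exact (hstep _).2 e (h1 hb).1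
  have := isAmalgamOf_of_alternating (P := α.stab u) (B := α.stab v)
    (C := α.stab u ⊓ α.stab v) inf_le_left inf_le_right ?_
  · rwa [hgen] at this
  · intro l hl hC hch hmem
    obtain ⟨x, hx⟩ : ∃ x, x ∈ l.head? := by
      cases l with
      | nil => exact absurd rfl hl
      | cons a l => exact ⟨a, rfl⟩
    obtain ⟨p, hp, -, h1, h2⟩ := key l hC hch x hx
    have hu : α.act (l.map fun x => (x.2 : F)).prod u = u := hmem.1.2
    have hv : α.act (l.map fun x => (x.2 : F)).prod v = v := hmem.2.2
    cases hb : x.1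
    · rcases hp with rfl | rfl
      · rw [hu] at h2; exact h.hu (h2 hb).1
      · rw [hv] at h2; exact (h2 hb).2 rfl
    · rcases hp with rfl | rfl
      · rw [hu] at h1; exact (h1 hb).2 rfl
      · rw [hv] at h1; exact (h1 hb).1 h.hv

/-- Ping-pong for a stable letter `t` carrying `v` to `u`. -/
lemma IsWall.hnn_word (h : α.IsWall u v X) {t : F} (ht : t ∈ M) (htv : α.act t v = u)
    (l : List (ℤˣ × F)) (hl : ∀ x ∈ l, x.2 ∈ α.stab u)
    (hch : l.IsChain (fun a b => (a.1 = 1 → b.1 = -1 → α.act a.2 v ≠ v) ∧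
      (a.1 = -1 → b.1 = 1 → α.act (t⁻¹ * a.2 * t) u ≠ u))) :
    (l.map fun x => t ^ (x.1 : ℤ) * x.2).prod ∈ M ∧ ∀ x ∈ l.head?,
      (x.1 = 1 → α.act (t⁻¹ * (l.map fun x => t ^ (x.1 : ℤ) * x.2).prod) u ∉ X) ∧
      (x.1 = -1 → α.act (l.map fun x => t ^ (x.1 : ℤ) * x.2).prod u ∈ X) := by
  have hti := M.inv_mem ht
  have htu : α.act t⁻¹ u = v := by rw [α.act_eq_iff hti, inv_inv, htv]
  induction l with
  | nil => simp
  | cons a l ih =>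
    obtain ⟨ε, g⟩ := a
    have hg : g ∈ α.stab u := hl (ε, g) (by simp)
    have hgi := (α.stab u).inv_mem hg
    obtain ⟨ihM, ih⟩ := ih (fun x hx => hl x (by simp [hx])) hch.tail
    set w := (l.map fun x => t ^ (x.1 : ℤ) * x.2).prod with hw
    have hprod : (((ε, g) :: l).map fun x => t ^ (x.1 : ℤ) * x.2).prod = t ^ (ε : ℤ) * g * w := by
      simp [hw]
    rw [hprod]
    refine ⟨M.mul_mem (M.mul_mem (M.zpow_mem ht _) hg.1) ihM, ?_⟩
    intro x hx
    simp only [List.head?_cons, Option.mem_def, Option.some.injEq] at hx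
    subst hx
    have hgw := M.mul_mem hg.1 ihM
    refine ⟨fun hε => ?_, fun hε => ?_⟩
    · -- need `g w u ∉ X`
      simp only at hε
      subst hε
      rw [show t⁻¹ * (t ^ ((1 : ℤˣ) : ℤ) * g * w) = g * w by simp [mul_assoc] ]
      rcases l with _ | ⟨⟨ε', g'⟩, l⟩
      · simp only [hw, List.map_nil, List.prod_nil, mul_one, hg.2]; exact h.hu
      · obtain ⟨i1, i2⟩ := ih (ε', g') (by simp)
        rcases Int.units_eq_one_or ε' with rfl | rfl
        · -- `X ⊆ gtX`
          specialize i1 rfl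
          intro hX
          apply i1
          have hk : g * t ∈ M := M.mul_mem hg.1 ht
          have hkv : α.act (g * t) v = u := by rw [α.mul _ hg.1 _ ht, htv, hg.2]
          have hne : ¬ (α.act (g * t) u = u ∧ α.act (g * t) v = v) := by
            rw [hkv]; exact fun hh => h.ne hh.2
          have := (h.nest hk hne (fun hh => h.hu (by
            rw [← hkv]; exact (h.cross _ hk hne).1 hh))).1 (by
              rw [← (α.act_eq_iff hk).1 hkv]; exact h.hv) _ hX
          rw [← α.mul _ (M.inv_mem hk) _ hgw] at this
          convert this using 2
          group
        · specialize i2 rfl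
          rw [α.mul _ hg.1 _ ihM]
          have hne := (List.isChain_cons_cons.1 hch).1.1 rfl rfl
          exact (h.mapsTo_left hg hne i2).1
    · -- need `t⁻¹ g w u ∈ X`
      simp only at hε
      subst hε
      rw [show (t ^ ((-1 : ℤˣ) : ℤ) * g * w) = t⁻¹ * (g * w) by simp [mul_assoc] ]
      rcases l with _ | ⟨⟨ε', g'⟩, l⟩
      · simp only [hw, List.map_nil, List.prod_nil, mul_one]
        rw [α.mul _ hti _ hg.1, hg.2, htu]; exact h.hv
      · obtain ⟨i1, i2⟩ := ih (ε', g') (by simp)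
        rcases Int.units_eq_one_or ε' with rfl | rfl
        · specialize i1 rfl
          have hne := (List.isChain_cons_cons.1 hch).1.2 rfl rfl
          have hs : t⁻¹ * g * t ∈ α.stab v := by
            have hM1 := M.mul_mem hti hg.1
            refine ⟨M.mul_mem hM1 ht, ?_⟩
            rw [α.mul _ hM1 _ ht, htv, α.mul _ hti _ hg.1, hg.2, htu]
          have := (h.symm.mapsTo_left hs hne i1).1
          rw [← α.mul _ hs.1 _ (M.mul_mem hti ihM)] at this
          simp only [Set.mem_compl_iff, not_not] at this
          convert this using 2
          group
        · specialize i2 rfl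
          by_contra hX
          have hk : g⁻¹ * t ∈ M := M.mul_mem hgi.1 ht
          have hki : (g⁻¹ * t)⁻¹ = t⁻¹ * g := by group
          have hkv : α.act (g⁻¹ * t) v = u := by rw [α.mul _ hgi.1 _ ht, htv, hgi.2]
          have hne : ¬ (α.act (g⁻¹ * t) u = u ∧ α.act (g⁻¹ * t) v = v) := by
            rw [hkv]; exact fun hh => h.ne hh.2
          have := (h.nest hk hne (fun hh => h.hu (by
            rw [← hkv]; exact (h.cross _ hk hne).1 hh))).1 (by
              rw [← (α.act_eq_iff hk).1 hkv]; exact h.hv) _ i2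
          rw [← α.mul _ (M.inv_mem hk) _ ihM, hki, mul_assoc] at this
          exact hX this

/-- The HNN decomposition when the two sides lie in the same orbit. -/
lemma IsWall.hnn (h : α.IsWall u v X) {t : F} (ht : t ∈ M) (htv : α.act t v = u) {c : F}
    (hc : α.stab u ⊓ α.stab v = Subgroup.zpowers c) : SplitsOver c (α.stab u) M := by
  right
  have hti := M.inv_mem ht
  have htu : α.act t⁻¹ u = v := by rw [α.act_eq_iff hti, inv_inv, htv]
  have hcu : c ∈ α.stab u ⊓ α.stab v := hc ▸ Subgroup.mem_zpowers c
  have hconj : ∀ a, a ∈ α.stab v → t * a * t⁻¹ ∈ α.stab u := by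
    intro a ha
    have h1 := M.mul_mem ht ha.1
    refine ⟨M.mul_mem h1 hti, ?_⟩
    rw [α.mul _ h1 _ hti, htu, α.mul _ ht _ ha.1, ha.2, htv]
  set cc : α.stab u := ⟨c, hcu.1⟩
  set dd : α.stab u := ⟨t * c * t⁻¹, hconj c hcu.2⟩
  have hcd : ∀ n : ℤ, ((dd ^ n : α.stab u) : F) = t * ((cc ^ n : α.stab u) : F) * t⁻¹ := by
    intro n
    simp [cc, dd, conj_zpow]
  let f : Subgroup.zpowers cc →* Subgroup.zpowers dd :=
    { toFun := fun x => ⟨⟨t * ((x : α.stab u) : F) * t⁻¹, by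
          obtain ⟨n, hn⟩ := x.2
          rw [← hn]
          simp only
          rw [← hcd]; exact SetLike.coe_mem _⟩, by
        obtain ⟨n, hn⟩ := x.2
        refine ⟨n, ?_⟩
        apply Subtype.ext
        simp only
        rw [hcd, ← hn]⟩
      map_one' := by ext; simp
      map_mul' := by intro x y; ext; simp }
  have hf : ∀ x, ((f x : α.stab u) : F) = t * ((x : α.stab u) : F) * t⁻¹ := fun x => rfl
  have hbij : Function.Bijective f := by
    constructor
    · intro x y hxy
      have := congrArg (fun z : Subgroup.zpowers dd => ((z : α.stab u) : F)) hxy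
      simp only [hf] at this
      ext
      simpa using this
    · rintro ⟨_, n, rfl⟩
      refine ⟨⟨cc ^ n, n, rfl⟩, ?_⟩
      ext
      rw [hf]
      exact (hcd n).symm
  refine ⟨hcu.1, dd, MulEquiv.ofBijective f hbij, ?_⟩
  have hstab : α.stab u ≤ M := fun g hg => hg.1
  have htM : Subgroup.zpowers t ≤ M := by rwa [Subgroup.zpowers_le]
  have hmemC : ∀ g : α.stab u, α.act g v = v → g ∈ Subgroup.zpowers cc := by
    intro g hg
    have : (g : F) ∈ α.stab u ⊓ α.stab v := ⟨g.2, g.2.1, hg⟩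
    rw [hc] at this
    obtain ⟨n, hn⟩ := this
    exact ⟨n, by ext; simpa [cc] using hn⟩
  have hmemD : ∀ g : α.stab u, α.act (t⁻¹ * (g : F) * t) u = u → g ∈ Subgroup.zpowers dd := by
    intro g hg
    have hM1 := M.mul_mem hti g.2.1
    have hv : α.act (t⁻¹ * (g : F) * t) v = v := by
      rw [α.mul _ hM1 _ ht, htv, α.mul _ hti _ g.2.1, g.2.2, htu]
    have : t⁻¹ * (g : F) * t ∈ α.stab u ⊓ α.stab v :=
      ⟨⟨M.mul_mem hM1 ht, hg⟩, M.mul_mem hM1 ht, hv⟩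
    rw [hc] at this
    obtain ⟨n, hn⟩ := this
    refine ⟨n, ?_⟩
    ext
    simp only at hn ⊢
    rw [hcd]
    simp only [cc, SubgroupClass.coe_zpow, hn]
    group
  refine isHNNOf_of_reduced _ t ?_ ?_ ?_
  · intro a
    rw [MulEquiv.ofBijective_apply, hf]
    group
  · apply h.generate (sup_le hstab htM) le_sup_left
    · intro g hg
      have h1 : t ∈ α.stab u ⊔ Subgroup.zpowers t :=
        (le_sup_right : _ ≤ α.stab u ⊔ Subgroup.zpowers t) (Subgroup.mem_zpowers t)
      have h2 := (le_sup_left : _ ≤ α.stab u ⊔ Subgroup.zpowers t) (hconj g hg)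
      have := mul_mem (mul_mem (inv_mem h1) h2) h1
      convert this using 1
      group
    · intro g hg hgu
      have h1 : t ∈ α.stab u ⊔ Subgroup.zpowers t :=
        (le_sup_right : _ ≤ α.stab u ⊔ Subgroup.zpowers t) (Subgroup.mem_zpowers t)
      have h2 : t * g ∈ α.stab u := ⟨M.mul_mem ht hg, by rw [α.mul _ ht _ hg, hgu, htv]⟩
      have := mul_mem (inv_mem h1) ((le_sup_left : _ ≤ α.stab u ⊔ Subgroup.zpowers t) h2)
      simpa using this
  · intro l hl hch hmem
    have := h.hnn_word ht htv (l.map fun x => (x.1, (x.2 : F)))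
      (by intro x hx; obtain ⟨y, -, rfl⟩ := List.mem_map.1 hx; exact y.2.2) (by
      rw [List.isChain_map]
      refine hch.imp ?_
      rintro ⟨a, ga⟩ ⟨b, gb⟩ hab
      simp only at hab ⊢
      refine ⟨?_, ?_⟩
      · rintro rfl rfl hh
        exact absurd (hab (hmemC _ hh)) (by decide)
      · rintro rfl rfl hh
        exact absurd (hab (hmemD _ hh)) (by decide))
    simp only [List.map_map, Function.comp_def] at this
    obtain ⟨hM, this⟩ := this
    obtain ⟨⟨ε, g⟩, hx⟩ : ∃ x, x ∈ (l.map fun x => (x.1, (x.2 : F))).head? := by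
      cases l with
      | nil => exact absurd rfl hl
      | cons a l => exact ⟨_, rfl⟩
    obtain ⟨h1, h2⟩ := this _ hx
    have hu := hmem.2
    rcases Int.units_eq_one_or ε with rfl | rfl
    · apply h1 rfl
      rw [α.mul _ hti _ hM, hu, htu]
      exact h.hv
    · have := h2 rfl
      rw [hu] at this
      exact h.hu this

/-- The vertex groups of a wall decomposition over a cyclic group. -/
lemma IsWall.splitsOver (h : α.IsWall u v X) {c : F}
    (hc : α.stab u ⊓ α.stab v = Subgroup.zpowers c) : SplitsOver c (α.stab u) M := by
  by_cases huv : ∀ g ∈ M, α.act g u ≠ v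
  · have := h.amalgam huv
    simp only [hc] at this
    exact Or.inl ⟨α.stab v, hc ▸ inf_le_left, hc ▸ inf_le_right,
      fun g hg => hg.1, fun g hg => hg.1, this⟩
  · push Not at huv
    obtain ⟨g, hg, hgu⟩ := huv
    exact h.hnn (M.inv_mem hg) (((α.act_eq_iff hg).1 hgu).symm) hc

lemma stab_act {k : F} (hk : k ∈ M) (ω : Ω) :
    ∀ g, g ∈ α.stab (α.act k ω) ↔ k⁻¹ * g * k ∈ α.stab ω := by
  intro g
  have hki := M.inv_mem hk
  constructor
  · rintro ⟨hg, h⟩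
    refine ⟨M.mul_mem (M.mul_mem hki hg) hk, ?_⟩
    rw [α.mul _ (M.mul_mem hki hg) _ hk, α.mul _ hki _ hg, h, α.inv_act hk]
  · rintro ⟨hg, h⟩
    have hgM : g ∈ M := by
      have := M.mul_mem (M.mul_mem hk hg) hki
      convert this using 1; group
    refine ⟨hgM, ?_⟩
    rw [α.mul _ (M.mul_mem hki hgM) _ hk, α.mul _ hki _ hgM, α.act_eq_iff hki, inv_inv] at h
    exact h

/-- The stabilizer of any point in the orbit of a wall over a cyclic group. -/
lemma IsWall.splitsOver_of_base (h : α.IsWall u v X) {c : F}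
    (hc : α.stab u ⊓ α.stab v = Subgroup.zpowers c) {k : F} (hk : k ∈ M) {o : Ω}
    (ho : o = α.act k u ∨ o = α.act k v) : SplitsOver (k * c * k⁻¹) (α.stab o) M := by
  have hc' : α.stab (α.act k u) ⊓ α.stab (α.act k v) = Subgroup.zpowers (k * c * k⁻¹) := by
    ext g
    rw [Subgroup.mem_inf, stab_act hk, stab_act hk, ← Subgroup.mem_inf, hc]
    simp only [Subgroup.mem_zpowers_iff, conj_zpow]
    refine exists_congr fun n => ?_
    constructor
    · intro h; rw [h]; group
    · intro h; rw [← h]; group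
  rcases ho with rfl | rfl
  · exact (h.translate hk).splitsOver hc'
  · exact (h.translate hk).symm.splitsOver (by rw [inf_comm]; exact hc')

end PartialAction

section Cayley
variable {ι K : Type*} [Group K] (b : FreeGroupBasis ι K)

/-- Induction along the edges of the Cayley graph. -/
lemma FreeGroupBasis.cayley_induction {P : K → Prop} (h1 : P 1) (h : ∀ g i, P g ↔ P (g * b i)) :
    ∀ g, P g := by
  intro g
  have : g ∈ Subgroup.closure (Set.range b) := by
    have : Subgroup.closure (Set.range b) = ⊤ := by
      have h1 : Set.range b = b.repr.symm '' Set.range FreeGroup.of := by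
        rw [← Set.range_comp]; rfl
      have h2 := congrArg (Subgroup.map b.repr.symm.toMonoidHom) (FreeGroup.closure_range_of ι)
      rw [MonoidHom.map_closure] at h2
      rw [h1]
      refine Eq.trans h2 ?_
      rw [← MonoidHom.range_eq_map]
      exact MonoidHom.range_eq_top.2 b.repr.symm.surjective
    rw [this]; trivial
  induction this using Subgroup.closure_induction_right with
  | one => exact h1
  | mul_right x _ y hy ih =>
    obtain ⟨i, rfl⟩ := hy
    exact (h x i).1 ih
  | mul_inv_cancel x _ y hy ih =>
    obtain ⟨i, rfl⟩ := hy
    exact (h _ i).2 (by simpa using ih)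

/-- A function on a free group with prescribed increments along the edges of the Cayley tree. -/
lemma FreeGroupBasis.exists_cocycle (β : ι → K → ZMod 2) :
    ∃ c : K → ZMod 2, c 1 = 0 ∧ ∀ g i, c (g * b i) = c g + β i g := by
  let ρ₀ : ι → Equiv.Perm (K × ZMod 2) := fun i =>
    { toFun := fun p => (p.1 * (b i)⁻¹, p.2 - β i (p.1 * (b i)⁻¹))
      invFun := fun p => (p.1 * b i, p.2 + β i p.1)
      left_inv := fun p => by simp
      right_inv := fun p => by simp }
  let ρ : K →* Equiv.Perm (K × ZMod 2) := b.lift ρ₀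
  have hρ : ∀ i, ρ (b i) = ρ₀ i := fun i => congrFun (b.lift.symm_apply_apply ρ₀) i
  have hstep : ∀ g i, ρ (g * b i)⁻¹ (1, 0) = (ρ₀ i).symm (ρ g⁻¹ (1, 0)) := by
    intro g i
    rw [mul_inv_rev, map_mul, Equiv.Perm.mul_apply, map_inv ρ (b i), hρ]
    rfl
  have hfst : ∀ g, (ρ g⁻¹ (1, 0)).1 = g := by
    refine b.cayley_induction ?_ ?_
    · simp
    · intro g i
      rw [hstep]
      change _ ↔ (ρ g⁻¹ (1, 0)).1 * b i = g * b i
      simp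
  refine ⟨fun g => (ρ g⁻¹ (1, 0)).2, by simp, fun g i => ?_⟩
  change (ρ (g * b i)⁻¹ (1, 0)).2 = _
  rw [hstep]
  change (ρ g⁻¹ (1, 0)).2 + β i (ρ g⁻¹ (1, 0)).1 = _
  rw [hfst]

/-- A finite set of vertices of the Cayley tree spans at most as many edges. -/
lemma FreeGroupBasis.card_edges_le [Fintype ι] [DecidableEq K] (A : Finset K) :
    ((Finset.univ ×ˢ A).filter fun p : ι × K => b p.1 * p.2 ∈ A).card ≤ A.card := by
  classical
  set E := (Finset.univ ×ˢ A).filter fun p : ι × K => b p.1 * p.2 ∈ A with hE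
  have key : ∀ β : E → ZMod 2, ∃ c : A → ZMod 2, ∀ e : E, ∀ h1 h2,
      c ⟨b e.1.1 * e.1.2, h1⟩ = c ⟨e.1.2, h2⟩ - β e := by
    intro β
    obtain ⟨c, -, hc⟩ := b.exists_cocycle
      (fun i g => if h : (i, (g * b i)⁻¹) ∈ E then β ⟨_, h⟩ else 0)
    refine ⟨fun a => c (a : K)⁻¹, ?_⟩
    rintro ⟨⟨i, g⟩, he⟩ h1 h2
    have := hc (b i * g)⁻¹ i
    have e1 : (b i * g)⁻¹ * b i = g⁻¹ := by group
    rw [e1] at this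
    simp only [inv_inv] at this
    rw [dif_pos he] at this
    simp only
    rw [this]; ring
  choose c hc using key
  have hinj : Function.Injective c := by
    intro β β' h
    funext e
    have h2 := (Finset.mem_filter.1 e.2)
    have h3 := (Finset.mem_product.1 h2.1).2
    have e1 := hc β e h2.2 h3
    have e2 := hc β' e h2.2 h3
    rw [h, e2] at e1
    exact (sub_right_injective e1).symm
  have := Fintype.card_le_of_injective c hinj
  simp only [Fintype.card_fun, ZMod.card, Fintype.card_coe] at this
  exact (Nat.pow_le_pow_iff_right (by norm_num)).1 this

end Cayley

/-- The half-trees of a Cayley tree, abstractly. -/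
structure IsHalfTreeSystem {F : Type*} [Group F] (𝓗 : Set (Set F)) : Prop where
  compl : ∀ p ∈ 𝓗, pᶜ ∈ 𝓗
  smul : ∀ p ∈ 𝓗, ∀ f : F, {x | f⁻¹ * x ∈ p} ∈ 𝓗
  nested : ∀ p ∈ 𝓗, ∀ q ∈ 𝓗, p ⊆ q ∨ p ⊆ qᶜ ∨ pᶜ ⊆ q ∨ pᶜ ⊆ qᶜ
  finite_sep : ∀ f : F, {p | p ∈ 𝓗 ∧ 1 ∉ p ∧ f ∈ p}.Finite
  free : ∀ p ∈ 𝓗, ∀ f : F, {x | f⁻¹ * x ∈ p} = p → f = 1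
  proper : ∀ k : ℕ, {f : F | {p | p ∈ 𝓗 ∧ 1 ∉ p ∧ f ∈ p}.ncard ≤ k}.Finite

section HalfTrees
variable {ι F : Type*} [Group F] (b : FreeGroupBasis ι F)

/-- For each edge of the Cayley tree the half-tree it points to. -/
lemma FreeGroupBasis.exists_halfTrees : ∃ P : F → ι → Set F,
    (∀ f₀ a, f₀ ∉ P f₀ a ∧ f₀ * b a ∈ P f₀ a) ∧
    (∀ f₀ a f i, ¬ (f = f₀ ∧ i = a) → (f ∈ P f₀ a ↔ f * b i ∈ P f₀ a)) ∧
    (∀ k f₀ a, {x | k⁻¹ * x ∈ P f₀ a} = P (k * f₀) a) := by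
  classical
  choose κ h1 hκ using fun a : ι => b.exists_cocycle (fun i f => if f = 1 ∧ i = a then 1 else 0)
  refine ⟨fun f₀ a => {f | κ a (f₀⁻¹ * f) = 1}, ?_, ?_, ?_⟩
  · intro f₀ a
    refine ⟨by simp [h1], ?_⟩
    have := hκ a 1 a
    simp only [one_mul, h1, and_self, if_true, zero_add] at this
    simpa using this
  · intro f₀ a f i hne
    simp only [Set.mem_ofPred_eq, ← mul_assoc, hκ]
    rw [if_neg, add_zero]
    rintro ⟨h, rfl⟩
    exact hne ⟨(inv_mul_eq_one.1 h).symm, rfl⟩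
  · intro k f₀ a
    ext x
    simp [mul_assoc]

lemma FreeGroupBasis.exists_isHalfTreeSystem {ι F : Type*} [Group F] (b : FreeGroupBasis ι F)
    [Finite ι] : ∃ 𝓗 : Set (Set F), IsHalfTreeSystem 𝓗 := by
  obtain ⟨P, hP, hedge, hsm⟩ := b.exists_halfTrees
  have hinj : ∀ f a g i, P f a = P g i → f = g ∧ a = i := by
    intro f a g i h
    by_contra hne
    have := hedge g i f a hne
    rw [← h] at this
    exact (hP f a).1 (this.2 (hP f a).2)
  set 𝓗 : Set (Set F) := {p | ∃ f a, p = P f a ∨ p = (P f a)ᶜ} with h𝓗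
  have hcompl : ∀ p ∈ 𝓗, pᶜ ∈ 𝓗 := by
    rintro _ ⟨f, a, rfl | rfl⟩
    · exact ⟨f, a, Or.inr rfl⟩
    · exact ⟨f, a, Or.inl (compl_compl _)⟩
  have hside : ∀ p ∈ 𝓗, ∀ f i, p ≠ P f i → p ≠ (P f i)ᶜ → (f ∈ p ↔ f * b i ∈ p) := by
    rintro _ ⟨g, a, rfl | rfl⟩ f i h1 h2
    · exact hedge _ _ _ _ (by rintro ⟨rfl, rfl⟩; exact h1 rfl)
    · have := hedge g a f i (by rintro ⟨rfl, rfl⟩; exact h2 rfl)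
      simp only [Set.mem_compl_iff, this]
  have hfin : ∀ f : F, {p | p ∈ 𝓗 ∧ 1 ∉ p ∧ f ∈ p}.Finite := by
    refine b.cayley_induction ?_ ?_
    · refine Set.finite_empty.subset ?_
      rintro p ⟨-, h1, h2⟩; exact h1 h2
    · intro g i
      constructor
      · intro h
        refine (h.union (Set.toFinite {P g i, (P g i)ᶜ})).subset ?_
        rintro p ⟨hp, h1, h2⟩
        by_cases e1 : p = P g i
        · right; simp [e1]
        by_cases e2 : p = (P g i)ᶜ
        · right; simp [e2]
        exact Or.inl ⟨hp, h1, (hside p hp g i e1 e2).2 h2⟩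
      · intro h
        refine (h.union (Set.toFinite {P g i, (P g i)ᶜ})).subset ?_
        rintro p ⟨hp, h1, h2⟩
        by_cases e1 : p = P g i
        · right; simp [e1]
        by_cases e2 : p = (P g i)ᶜ
        · right; simp [e2]
        exact Or.inl ⟨hp, h1, (hside p hp g i e1 e2).1 h2⟩
  refine ⟨𝓗, hcompl, ?_, ?_, hfin, ?_, ?_⟩
  · rintro _ ⟨g, a, rfl | rfl⟩ f
    · exact ⟨f * g, a, Or.inl (hsm _ _ _)⟩
    · exact ⟨f * g, a, Or.inr (by rw [← hsm]; rfl)⟩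
  · have main : ∀ f₀ a q, q ∈ 𝓗 → (P f₀ a ⊆ q ∨ P f₀ a ⊆ qᶜ) ∨
        ((P f₀ a)ᶜ ⊆ q ∨ (P f₀ a)ᶜ ⊆ qᶜ) := by
      intro f₀ a q hq
      by_cases e1 : q = P f₀ a
      · left; left; rw [e1]
      by_cases e2 : q = (P f₀ a)ᶜ
      · left; right; rw [e2, compl_compl]
      have h0 := hside q hq f₀ a e1 e2
      obtain ⟨g, i, hqg⟩ := hq
      have hne : ¬ (g = f₀ ∧ i = a) := by
        rintro ⟨rfl, rfl⟩
        rcases hqg with h | h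
        · exact e1 h
        · exact e2 h
      have hqe : ∀ f j, ¬ (f = g ∧ j = i) → (f ∈ q ↔ f * b j ∈ q) := by
        intro f j hh
        have := hedge g i f j hh
        rcases hqg with rfl | rfl
        · exact this
        · simp only [Set.mem_compl_iff, this]
      have hpe := hedge f₀ a g i hne
      have gen : ∀ p' : Set F, (g ∉ p') → (g * b i ∉ p') →
          (∀ f j, ¬ (f = f₀ ∧ j = a) → (f ∈ p' ↔ f * b j ∈ p')) → (p' ⊆ q ∨ p' ⊆ qᶜ) := by
        intro p' hg1 hg2 hp'
        have all : ∀ ω, (ω ∈ p' → (ω ∈ q ↔ f₀ ∈ q)) := by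
          have step : ∀ ω j, (ω ∈ p' → (ω ∈ q ↔ f₀ ∈ q)) ↔
              (ω * b j ∈ p' → (ω * b j ∈ q ↔ f₀ ∈ q)) := by
            intro ω j
            by_cases c1 : ω = f₀ ∧ j = a
            · obtain ⟨rfl, rfl⟩ := c1
              simp [h0]
            by_cases c2 : ω = g ∧ j = i
            · obtain ⟨rfl, rfl⟩ := c2
              simp [hg1, hg2]
            · rw [hp' ω j c1, hqe ω j c2]
          have tr : ∀ x, ((f₀ * x ∈ p' → (f₀ * x ∈ q ↔ f₀ ∈ q))) := by
            refine b.cayley_induction ?_ ?_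
            · simp
            · intro x j
              rw [← mul_assoc]; exact step _ _
          intro ω
          simpa using tr (f₀⁻¹ * ω)
        by_cases c : f₀ ∈ q
        · left; intro ω hω; exact (all ω hω).2 c
        · right; intro ω hω hh; exact c ((all ω hω).1 hh)
      by_cases c : g ∈ P f₀ a
      · right
        refine gen _ (fun h => h c) (fun h => h (hpe.1 c)) ?_
        intro f j hh
        simp only [Set.mem_compl_iff, hedge f₀ a f j hh]
      · left
        exact gen _ c (fun h => c (hpe.2 h)) (fun f j hh => hedge f₀ a f j hh)
    rintro _ ⟨f, a, rfl | rfl⟩ q hq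
    · have := main f a q hq; tauto
    · have := main f a q hq; rw [compl_compl]; tauto
  · rintro _ ⟨g, a, rfl | rfl⟩ f hf
    · rw [hsm] at hf
      simpa using (hinj _ _ _ _ hf).1
    · have : {x | f⁻¹ * x ∈ P g a} = P g a := by
        rw [← compl_inj_iff]; exact hf
      rw [hsm] at this
      simpa using (hinj _ _ _ _ this).1
  · -- every nontrivial vertex has a neighbour nearer to the origin
    have hnear : ∀ f : F, f ≠ 1 → ∃ (f' : F) (i : ι), (f' = f * b i ∨ f = f' * b i) ∧
        {p | p ∈ 𝓗 ∧ 1 ∉ p ∧ f' ∈ p}.ncard < {p | p ∈ 𝓗 ∧ 1 ∉ p ∧ f ∈ p}.ncard := by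
      intro f hf
      by_cases h : (∃ i, 1 ∈ P f i) ∨ (∃ i, 1 ∉ P (f * (b i)⁻¹) i)
      · rcases h with ⟨i, hi⟩ | ⟨i, hi⟩
        · refine ⟨f * b i, i, Or.inl rfl, Set.ncard_lt_ncard ?_ (hfin f)⟩
          rw [Set.ssubset_iff_of_subset]
          · exact ⟨(P f i)ᶜ, ⟨⟨f, i, Or.inr rfl⟩, fun h => h hi, (hP f i).1⟩,
              fun h => h.2.2 (hP f i).2⟩
          · rintro p ⟨hp, h1, h2⟩
            refine ⟨hp, h1, (hside p hp f i ?_ ?_).2 h2⟩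
            · rintro rfl; exact h1 hi
            · rintro rfl; exact h2 (hP f i).2
        · have e : f * (b i)⁻¹ * b i = f := by group
          have h3 := hP (f * (b i)⁻¹) i
          rw [e] at h3
          refine ⟨f * (b i)⁻¹, i, Or.inr e.symm, Set.ncard_lt_ncard ?_ (hfin f)⟩
          rw [Set.ssubset_iff_of_subset]
          · exact ⟨P (f * (b i)⁻¹) i, ⟨⟨_, i, Or.inl rfl⟩, hi, h3.2⟩, fun h => h3.1 h.2.2⟩
          · rintro p ⟨hp, h1, h2⟩
            refine ⟨hp, h1, ?_⟩
            have := hside p hp (f * (b i)⁻¹) i ?_ ?_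
            · rw [e] at this; exact this.1 h2
            · rintro rfl; exact h3.1 h2
            · rintro rfl; exact h1 hi
      · push Not at h
        exfalso
        have all : ∀ x, f * x = f ∨ (∃ i, f * x ∈ P f i) ∨ (∃ i, f * x ∉ P (f * (b i)⁻¹) i) := by
          refine b.cayley_induction ?_ ?_
          · simp
          · intro x j
            rw [← mul_assoc]
            set g := f * x
            constructor
            · rintro (h1 | ⟨i, h1⟩ | ⟨i, h1⟩)
              · right; left; exact ⟨j, by rw [h1]; exact (hP f j).2⟩
              · right; left
                refine ⟨i, (hedge f i g j ?_).1 h1⟩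
                rintro ⟨h3, -⟩; rw [h3] at h1; exact (hP f i).1 h1
              · by_cases c : g = f * (b i)⁻¹ ∧ j = i
                · left; rw [c.1, c.2]; group
                · right; right; exact ⟨i, fun h3 => h1 ((hedge _ i g j c).2 h3)⟩
            · rintro (h1 | ⟨i, h1⟩ | ⟨i, h1⟩)
              · right; right; refine ⟨j, ?_⟩
                have : g = f * (b j)⁻¹ := by rw [← h1]; group
                rw [this]; exact (hP _ j).1
              · by_cases c : g = f ∧ j = i
                · left; exact c.1
                · right; left; exact ⟨i, (hedge _ i g j c).2 h1⟩
              · right; right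
                refine ⟨i, fun h3 => h1 ((hedge _ i g j ?_).1 h3)⟩
                rintro ⟨h4, rfl⟩; rw [h4] at h3; exact (hP _ j).1 h3
        have := all f⁻¹
        simp only [mul_inv_cancel] at this
        rcases this with h1 | ⟨i, h1⟩ | ⟨i, h1⟩
        · exact hf h1.symm
        · exact h.1 i h1
        · exact h1 (h.2 i)
    intro k
    induction k with
    | zero =>
      refine (Set.finite_singleton (1 : F)).subset ?_
      intro f hf
      by_contra hne
      obtain ⟨f', i, -, hlt⟩ := hnear f hne
      simp only [Set.mem_ofPred_eq] at hf
      omega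
    | succ k ih =>
      refine ((Set.finite_singleton (1 : F)).union ((Set.finite_iUnion fun i : ι =>
        (ih.image (· * (b i)⁻¹)).union (ih.image (· * b i))))).subset ?_
      intro f hf
      by_cases hne : f = 1
      · left; exact hne
      right
      obtain ⟨f', i, hff, hlt⟩ := hnear f hne
      simp only [Set.mem_ofPred_eq] at hf
      refine Set.mem_iUnion.2 ⟨i, ?_⟩
      have : {p | p ∈ 𝓗 ∧ 1 ∉ p ∧ f' ∈ p}.ncard ≤ k := by omega
      rcases hff with h | h
      · left; exact ⟨f', this, by rw [h]; group⟩
      · right; exact ⟨f', this, h.symm⟩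

end HalfTrees

section Growth

variable {ι K O S : Type*}

/-- In a finite graph with more than `(c + 1) / c` edges per vertex there is a nonempty set of
vertices all of whose subsets touch many edges. -/
lemma exists_dense_subset [DecidableEq O] (c : ℕ) (src tgt : ι × O → O) (V : Finset O)
    (E : Finset (ι × O)) (hE : ∀ e ∈ E, src e ∈ V ∧ tgt e ∈ V)
    (h : (c + 1) * V.card < c * E.card) :
    ∃ W ⊆ V, ∃ E' ⊆ E, W.Nonempty ∧ (∀ e ∈ E', src e ∈ W ∧ tgt e ∈ W) ∧ ∀ U ⊆ W,
      (c + 1) * U.card ≤ c * (E'.filter fun e => src e ∈ U ∨ tgt e ∈ U).card := by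
  classical
  let EE : Finset O → Finset (ι × O) := fun W => E.filter fun e => src e ∈ W ∧ tgt e ∈ W
  have hex : ∃ W, W ⊆ V ∧ W.Nonempty ∧ (c + 1) * W.card ≤ c * (EE W).card := by
    refine ⟨V, subset_rfl, ?_, ?_⟩
    · rw [Finset.nonempty_iff_ne_empty]
      rintro rfl
      have : E = ∅ := by
        apply Finset.eq_empty_of_forall_notMem
        intro e he; simpa using (hE e he).1
      rw [this] at h
      simp at h
    · have : EE V = E := Finset.filter_true_of_mem hE
      rw [this]; exact h.le
  obtain ⟨W, ⟨hWV, hne, hW⟩, hmin⟩ := WellFounded.has_min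
    (measure (fun W : Finset O => W.card)).wf _ hex
  refine ⟨W, hWV, EE W, Finset.filter_subset _ _, hne, fun e he => (Finset.mem_filter.1 he).2, ?_⟩
  intro U hU
  have hsplit : (EE W).card = ((EE W).filter fun e => src e ∈ U ∨ tgt e ∈ U).card
      + (EE (W \ U)).card := by
    rw [← Finset.card_filter_add_card_filter_not (s := EE W) (fun e => src e ∈ U ∨ tgt e ∈ U)]
    congr 2
    ext e
    simp only [EE, Finset.mem_filter, Finset.mem_sdiff]
    tauto
  rcases U.eq_empty_or_nonempty with rfl | hUne
  · simp
  have hcard : (W \ U).card + U.card = W.card := Finset.card_sdiff_add_card_eq_card hU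
  have hUpos := hUne.card_pos
  rcases (W \ U).eq_empty_or_nonempty with h0 | hne'
  · rw [h0] at hsplit hcard
    have : EE ∅ = ∅ := by
      apply Finset.eq_empty_of_forall_notMem; simp [EE]
    rw [this] at hsplit
    simp at hsplit hcard
    rw [← hsplit, hcard]; exact hW
  · have hlt : ¬ ((c + 1) * (W \ U).card ≤ c * (EE (W \ U)).card) := fun hh =>
      hmin _ ⟨Finset.sdiff_subset.trans hWV, hne', hh⟩ (by
        change (W \ U).card < W.card
        omega)
    rw [← hcard, hsplit, mul_add, mul_add] at hW
    omega

variable [Group K] [Fintype ι]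

lemma exists_expanding_sets [DecidableEq K] (x : FreeGroupBasis ι K) (c : ℕ) (act : K → O → O)
    (one : ∀ p, act 1 p = p) (mul : ∀ g h p, act (g * h) p = act g (act h p)) (V : Finset O)
    (E : Finset (ι × O)) (hE : ∀ e ∈ E, e.2 ∈ V ∧ act (x e.1) e.2 ∈ V)
    (h : (c + 1) * V.card < c * E.card) :
    ∃ p₀ ∈ V, ∃ A : ℕ → Finset K, A 0 = {1} ∧
      (∀ j, ∀ g ∈ A (j + 1), g ∈ A j ∨ ∃ g' ∈ A j, ∃ i, (g = x i * g' ∧ (i, act g' p₀) ∈ E) ∨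
        (g' = x i * g ∧ (i, act g p₀) ∈ E)) ∧
      (∀ j, Set.InjOn (fun g => act g p₀) (A (j + 1) : Set K) →
        (c + 1) * (A j).card ≤ c * (A (j + 1)).card) := by
  classical
  obtain ⟨W, hWV, E', hE'E, ⟨p₀, hp₀⟩, hE'W, hdense⟩ := exists_dense_subset c (fun e => e.2)
    (fun e => act (x e.1) e.2) V E hE h
  let nxt : Finset K → Finset K := fun A => A ∪
    (((Finset.univ ×ˢ A).filter fun e : ι × K => (e.1, act e.2 p₀) ∈ E').image
      fun e => x e.1 * e.2) ∪
    (((Finset.univ ×ˢ A).filter fun e : ι × K => (e.1, act ((x e.1)⁻¹ * e.2) p₀) ∈ E').image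
      fun e => (x e.1)⁻¹ * e.2)
  have hnxt : ∀ A g, g ∈ nxt A ↔ g ∈ A ∨ ∃ g' ∈ A, ∃ i, (g = x i * g' ∧ (i, act g' p₀) ∈ E') ∨
        (g' = x i * g ∧ (i, act g p₀) ∈ E') := by
    intro A g
    simp only [nxt, Finset.mem_union, Finset.mem_image, Finset.mem_filter, Finset.mem_product,
      Finset.mem_univ, true_and, Prod.exists]
    constructor
    · rintro ((h | ⟨i, g', ⟨h1, h2⟩, rfl⟩) | ⟨i, g', ⟨h1, h2⟩, rfl⟩)
      · exact Or.inl h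
      · exact Or.inr ⟨g', h1, i, Or.inl ⟨rfl, h2⟩⟩
      · exact Or.inr ⟨g', h1, i, Or.inr ⟨by group, h2⟩⟩
    · rintro (h | ⟨g', h1, i, ⟨rfl, h2⟩ | ⟨rfl, h2⟩⟩)
      · exact Or.inl (Or.inl h)
      · exact Or.inl (Or.inr ⟨i, g', ⟨h1, h2⟩, rfl⟩)
      · exact Or.inr ⟨i, _, ⟨h1, by simpa using h2⟩, by group⟩
  let A : ℕ → Finset K := fun j => nxt^[j] {1}
  have hA : ∀ j, A (j + 1) = nxt (A j) := fun j => Function.iterate_succ_apply' _ _ _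
  have hAW : ∀ j, ∀ g ∈ A j, act g p₀ ∈ W := by
    intro j
    induction j with
    | zero =>
      intro g hg
      have : g = 1 := by simpa [A] using hg
      rw [this, one]; exact hp₀
    | succ j ih =>
      intro g hg
      rw [hA, hnxt] at hg
      rcases hg with hg | ⟨g', hg', i, ⟨rfl, h2⟩ | ⟨rfl, h2⟩⟩
      · exact ih g hg
      · rw [mul]; exact (hE'W _ h2).2
      · exact (hE'W _ h2).1
  refine ⟨p₀, hWV hp₀, A, rfl, ?_, ?_⟩
  · intro j g hg
    rw [hA, hnxt] at hg
    rcases hg with hg | ⟨g', hg', i, ⟨h1, h2⟩ | ⟨h1, h2⟩⟩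
    · exact Or.inl hg
    · exact Or.inr ⟨g', hg', i, Or.inl ⟨h1, hE'E h2⟩⟩
    · exact Or.inr ⟨g', hg', i, Or.inr ⟨h1, hE'E h2⟩⟩
  · intro j hinj
    have hsub : A j ⊆ A (j + 1) := fun g hg => by rw [hA, hnxt]; exact Or.inl hg
    have h1 := hdense ((A j).image fun g => act g p₀) (by
      intro p hp
      obtain ⟨g, hg, rfl⟩ := Finset.mem_image.1 hp
      exact hAW j g hg)
    rw [Finset.card_image_of_injOn (hinj.mono (by exact_mod_cast hsub))] at h1
    refine h1.trans (Nat.mul_le_mul_left _ (le_trans ?_ (x.card_edges_le (A (j + 1)))))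
    -- every touched edge lifts to an edge between elements of `A (j + 1)`
    have : (E'.filter fun e => e.2 ∈ (A j).image (fun g => act g p₀) ∨
        act (x e.1) e.2 ∈ (A j).image (fun g => act g p₀)) ⊆
        ((Finset.univ ×ˢ A (j + 1)).filter fun e : ι × K => x e.1 * e.2 ∈ A (j + 1)).image
          (fun e => (e.1, act e.2 p₀)) := by
      rintro ⟨i, p⟩ he
      simp only [Finset.mem_filter, Finset.mem_image] at he
      simp only [Finset.mem_image, Finset.mem_filter, Finset.mem_product, Finset.mem_univ, true_and,
        Prod.exists, Prod.mk.injEq]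
      obtain ⟨he, ⟨g, hg, rfl⟩ | ⟨g, hg, hgp⟩⟩ := he
      · refine ⟨i, g, ⟨hsub hg, ?_⟩, rfl, rfl⟩
        rw [hA, hnxt]; exact Or.inr ⟨g, hg, i, Or.inl ⟨rfl, he⟩⟩
      · have hp : p = act ((x i)⁻¹ * g) p₀ := by
          rw [mul, hgp, ← mul, inv_mul_cancel, one]
        refine ⟨i, (x i)⁻¹ * g, ⟨?_, ?_⟩, rfl, hp.symm⟩
        · rw [hA, hnxt]
          exact Or.inr ⟨g, hg, i, Or.inr ⟨by group, by rw [← hp]; exact he⟩⟩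
        · rw [mul_inv_cancel_left]; exact hsub hg
    exact (Finset.card_le_card this).trans Finset.card_image_le

/-- Exponential growth beats polynomial growth. -/
lemma exists_pow_gt (c a q : ℕ) (hc : 0 < c) :
    ∃ J : ℕ, c ^ J * (a * (2 * J + 1) ^ q) < (c + 1) ^ J := by
  have hr : (1 : ℝ) < (c + 1) / c := by
    rw [one_lt_div (by exact_mod_cast hc)]; linarith
  have h := tendsto_pow_const_div_const_pow_of_one_lt q hr
  have h2 : ∀ᶠ n : ℕ in atTop, (n : ℝ) ^ q / ((c + 1) / c) ^ n < 1 / (a * 3 ^ q + 1) :=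
    h.eventually (gt_mem_nhds (by positivity))
  obtain ⟨J, hJ1, hJ2⟩ := (h2.and (eventually_ge_atTop 1)).exists
  refine ⟨J, ?_⟩
  have hcr : (0 : ℝ) < c := by exact_mod_cast hc
  have hpos : (0 : ℝ) < ((c + 1) / c : ℝ) ^ J := by positivity
  rw [div_lt_div_iff₀ hpos (by positivity), one_mul, div_pow, lt_div_iff₀ (by positivity)] at hJ1
  have h3 : ((2 * J + 1 : ℕ) : ℝ) ^ q ≤ 3 ^ q * (J : ℝ) ^ q := by
    rw [← mul_pow]
    apply pow_le_pow_left₀ (by positivity)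
    have : (1 : ℝ) ≤ J := by exact_mod_cast hJ2
    push_cast; linarith
  have : (c : ℝ) ^ J * (a * ((2 * J + 1 : ℕ) : ℝ) ^ q) < (c + 1) ^ J := by
    refine lt_of_le_of_lt ?_ hJ1
    have h4 : (a : ℝ) * ((2 * J + 1 : ℕ) : ℝ) ^ q ≤ a * (3 ^ q * (J : ℝ) ^ q) :=
      mul_le_mul_of_nonneg_left h3 (by positivity)
    have h5 : (0 : ℝ) ≤ (J : ℝ) ^ q := by positivity
    calc (c : ℝ) ^ J * (a * ((2 * J + 1 : ℕ) : ℝ) ^ q) ≤ c ^ J * (a * (3 ^ q * (J : ℝ) ^ q)) :=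
          mul_le_mul_of_nonneg_left h4 (by positivity)
      _ ≤ (J : ℝ) ^ q * (a * 3 ^ q + 1) * c ^ J := by
          nlinarith [mul_nonneg h5 (pow_nonneg hcr.le J)]
  exact_mod_cast this

/-- Graphs of partial translations, with boundedly many kinds of edges each shifting positions by
a constant, are nearly forests if the group acts nearly freely. -/
lemma exists_finset_card_edges_le [Fintype S] [DecidableEq K] (x : FreeGroupBasis ι K) (c : ℕ)
    (hc : 0 < c) : ∃ Z : Finset K, 1 ∉ Z ∧ ∀ (act : K → O → O)
    (_ : ∀ p, act 1 p = p) (_ : ∀ g h p, act (g * h) p = act g (act h p)) (V : Finset O)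
    (E : Finset (ι × O)) (_ : ∀ e ∈ E, e.2 ∈ V ∧ act (x e.1) e.2 ∈ V)
    (tr : O → S) (pos : O → ℤ) (κ : ι × S × S → ℤ)
    (_ : ∀ e ∈ E, pos (act (x e.1) e.2) = pos e.2 + κ (e.1, tr e.2, tr (act (x e.1) e.2)))
    (_ : ∀ p ∈ V, ∀ q ∈ V, tr p = tr q → pos p = pos q → p = q)
    (_ : ∀ p ∈ V, ∀ z ∈ Z, act z p ≠ p), c * E.card ≤ (c + 1) * V.card := by
  classical
  obtain ⟨J, hJ⟩ := exists_pow_gt c (Fintype.card S) (Fintype.card (ι × S × S)) hc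
  let nxt : Finset K → Finset K := fun A => A ∪
    ((Finset.univ ×ˢ A).image fun e : ι × K => x e.1 * e.2) ∪
    ((Finset.univ ×ˢ A).image fun e : ι × K => (x e.1)⁻¹ * e.2)
  let ball : ℕ → Finset K := fun j => nxt^[j] {1}
  have hball : ∀ j, ball (j + 1) = nxt (ball j) := fun j => Function.iterate_succ_apply' _ _ _
  have hmono : ∀ j, ball j ⊆ ball (j + 1) := fun j g hg => by
    rw [hball]; simp only [nxt, Finset.mem_union]; exact Or.inl (Or.inl hg)
  have hmono' : Monotone ball := monotone_nat_of_le_succ hmono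
  refine ⟨((ball J ×ˢ ball J).image fun e => e.1⁻¹ * e.2).erase 1, by simp, ?_⟩
  intro act one mul V E hE tr pos κ hpos hinj hfree
  by_contra hlt
  push Not at hlt
  obtain ⟨p₀, hp₀, A, hA0, hA, hgrow⟩ := exists_expanding_sets x c act one mul V E hE hlt
  have hAball : ∀ j, A j ⊆ ball j := by
    intro j
    induction j with
    | zero => rw [hA0]; exact subset_rfl
    | succ j ih =>
      intro g hg
      rcases hA j g hg with h | ⟨g', hg', i, ⟨rfl, -⟩ | ⟨h, -⟩⟩
      · exact hmono j (ih h)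
      · rw [hball]; simp only [nxt, Finset.mem_union, Finset.mem_image]
        exact Or.inl (Or.inr ⟨(i, g'), by simpa using ih hg', rfl⟩)
      · rw [hball]; simp only [nxt, Finset.mem_union, Finset.mem_image]
        exact Or.inr ⟨(i, g'), by simpa using ih hg', by rw [h]; group⟩
  have hAV : ∀ j, ∀ g ∈ A j, act g p₀ ∈ V := by
    intro j
    induction j with
    | zero => intro g hg; rw [hA0, Finset.mem_singleton] at hg; rw [hg, one]; exact hp₀
    | succ j ih =>
      intro g hg
      rcases hA j g hg with h | ⟨g', hg', i, ⟨rfl, h⟩ | ⟨-, h⟩⟩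
      · exact ih g h
      · rw [mul]; exact (hE _ h).2
      · exact (hE _ h).1
  have hinjA : ∀ j ≤ J, Set.InjOn (fun g => act g p₀) (A j : Set K) := by
    intro j hj g hg g' hg' hgg
    by_contra hne
    have h1 : g⁻¹ * g' ∈ ((ball J ×ˢ ball J).image fun e => e.1⁻¹ * e.2).erase 1 := by
      refine Finset.mem_erase.2 ⟨fun h => hne (inv_mul_eq_one.1 h), Finset.mem_image.2
        ⟨(g, g'), Finset.mem_product.2 ⟨hmono' hj (hAball j hg), hmono' hj (hAball j hg')⟩, rfl⟩⟩
    apply hfree p₀ hp₀ _ h1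
    simp only at hgg
    rw [mul, ← hgg, ← mul, inv_mul_cancel, one]
  have hgrow' : ∀ j ≤ J, (c + 1) ^ j ≤ c ^ j * (A j).card := by
    intro j
    induction j with
    | zero => intro _; simp [hA0]
    | succ j ih =>
      intro hj
      have h1 := ih (by omega)
      have h2 := hgrow j (hinjA _ hj)
      calc (c + 1) ^ (j + 1) = (c + 1) * (c + 1) ^ j := by ring
        _ ≤ (c + 1) * (c ^ j * (A j).card) := Nat.mul_le_mul_left _ h1
        _ = c ^ j * ((c + 1) * (A j).card) := by ring
        _ ≤ c ^ j * (c * (A (j + 1)).card) := Nat.mul_le_mul_left _ h2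
        _ = _ := by ring
  -- positions are determined by counting the kinds of edges traversed
  have hcount : ∀ j, ∀ g ∈ A j, ∃ n : ι × S × S → ℤ, (∀ s, |n s| ≤ j) ∧
      pos (act g p₀) = pos p₀ + ∑ s, n s * κ s := by
    intro j
    induction j with
    | zero =>
      intro g hg
      rw [hA0, Finset.mem_singleton] at hg
      exact ⟨0, by simp, by simp [hg, one]⟩
    | succ j ih =>
      intro g hg
      have upd : ∀ (n : ι × S × S → ℤ) (s₀ : ι × S × S) (d : ℤ), |d| ≤ 1 → (∀ s, |n s| ≤ j) →
          (∀ s, |(n + (Pi.single s₀ d : ι × S × S → ℤ)) s| ≤ ((j + 1 : ℕ) : ℤ)) ∧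
          ∑ s, (n + (Pi.single s₀ d : ι × S × S → ℤ)) s * κ s = ∑ s, n s * κ s + d * κ s₀ := by
        intro n s₀ d hd hn
        constructor
        · intro s
          rw [Pi.add_apply]
          refine (abs_add_le _ _).trans ?_
          have : |(Pi.single s₀ d : ι × S × S → ℤ) s| ≤ 1 := by
            by_cases hs : s = s₀
            · subst hs; simpa using hd
            · simp [hs]
          have := hn s
          push_cast; linarith
        · simp only [Pi.add_apply, add_mul, Finset.sum_add_distrib]
          congr 1
          rw [Finset.sum_eq_single s₀]
          · simp
          · intro b _ hb; simp [hb]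
          · simp
      rcases hA j g hg with h | ⟨g', hg', i, ⟨rfl, h⟩ | ⟨h', h⟩⟩
      · obtain ⟨n, hn, hn'⟩ := ih g h
        exact ⟨n, fun s => (hn s).trans (by push_cast; linarith), hn'⟩
      · obtain ⟨n, hn, hn'⟩ := ih g' hg'
        obtain ⟨u1, u2⟩ := upd n (i, tr (act g' p₀), tr (act (x i) (act g' p₀))) 1 (by simp) hn
        refine ⟨_, u1, ?_⟩
        have := hpos _ h
        simp only at this
        rw [u2, mul, this, hn']; ring
      · obtain ⟨n, hn, hn'⟩ := ih g' hg'
        obtain ⟨u1, u2⟩ := upd n (i, tr (act g p₀), tr (act (x i) (act g p₀))) (-1) (by simp) hn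
        refine ⟨_, u1, ?_⟩
        have := hpos _ h
        simp only at this
        rw [h', mul, this] at hn'
        rw [u2]; linarith
  have hcard : (A J).card ≤ Fintype.card S * (2 * J + 1) ^ Fintype.card (ι × S × S) := by
    choose! n hn hn' using hcount J
    let f : A J → S × (ι × S × S → Finset.Icc (-(J : ℤ)) J) := fun g =>
      (tr (act g p₀), fun s => ⟨n g s, Finset.mem_Icc.2 (abs_le.1 (hn g g.2 s))⟩)
    have hf : Function.Injective f := by
      intro g g' hgg
      simp only [f, Prod.mk.injEq] at hgg
      have hnn : ∀ s, n g s = n g' s := fun s => congrArg Subtype.val (congrFun hgg.2 s)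
      apply Subtype.ext
      apply hinjA J le_rfl g.2 g'.2
      apply hinj _ (hAV J g g.2) _ (hAV J g' g'.2) hgg.1
      rw [hn' g g.2, hn' g' g'.2]
      simp only [hnn]
    have := Fintype.card_le_of_injective f hf
    simp only [Fintype.card_coe, Fintype.card_prod, Fintype.card_fun, Int.card_Icc] at this ⊢
    convert this using 4
    omega
  have := hgrow' J le_rfl
  have h2 := Nat.mul_le_mul_left (c ^ J) hcard
  omega

end Growth

section Window

variable {ι β K : Type*} [Group K] (x : ι → K) (e : β → K)

/-- The pairs of points of the window `e` matched by translation by `x i`. -/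
def windowPairs (i : ι) : Set (β × β) := {d | e d.2 = x i * e d.1}

/-- The restriction of `H` to the sources of the `i`-th matching. -/
def windowSrc (i : ι) (H : Set β) : Set (β × β) := {d | d ∈ windowPairs x e i ∧ d.1 ∈ H}

/-- The restriction of `H` to the targets of the `i`-th matching. -/
def windowTgt (i : ι) (H : Set β) : Set (β × β) := {d | d ∈ windowPairs x e i ∧ d.2 ∈ H}

/-- `τ` is a nonempty proper part of the `i`-th matching. -/
def WindowCuts (i : ι) (τ : Set (β × β)) : Prop := τ.Nonempty ∧ τ ≠ windowPairs x e i

open Classical in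
/-- Weights on the cuts of a window that are compatible with the partial translations. -/
structure IsWindowWeight [Fintype β] (w : Set β → ℕ) : Prop where
  empty : w ∅ = 0
  compl : ∀ H, w Hᶜ = w H
  balance : ∀ i τ, WindowCuts x e i τ →
    ∑ H with windowSrc x e i H = τ, w H = ∑ H with windowTgt x e i H = τ, w H

open Classical in
/-- The total weight of the cuts. -/
noncomputable def windowVerts [Fintype β] (w : Set β → ℕ) : ℕ := ∑ H, w H

open Classical in
/-- The total weight of the pairs of a generator and a cut moved by it. -/
noncomputable def windowEdges [Fintype β] [Fintype ι] (w : Set β → ℕ) : ℕ :=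
  ∑ i, ∑ H with WindowCuts x e i (windowSrc x e i H), w H

/-- One of the four nestedness relations. -/
def SetNested {α : Type*} (p q : Set α) : Prop := p ⊆ q ∨ p ⊆ qᶜ ∨ pᶜ ⊆ q ∨ pᶜ ⊆ qᶜ

end Window

section Trace

variable {ι β K F : Type*} [Group K] [Group F]

/-- The trace on the window `e` of a subset of `F`, seen through `h`. -/
def winTrace (e : β → K) (h : K →* F) (p : Set F) : Set β := {b | h (e b) ∈ p}

/-- The number of half-trees with a given trace. -/
noncomputable def traceWeight (e : β → K) (𝓗 : Set (Set F)) (h : K →* F) (H : Set β) : ℕ :=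
  {p | p ∈ 𝓗 ∧ H.Nonempty ∧ Hᶜ.Nonempty ∧ winTrace e h p = H}.ncard

/-- Translation of subsets of `F` through `h`. -/
def transl (h : K →* F) (g : K) (p : Set F) : Set F := {f | (h g)⁻¹ * f ∈ p}

lemma transl_one (h : K →* F) (p : Set F) : transl h 1 p = p := by simp [transl]

lemma transl_mul (h : K →* F) (g g' : K) (p : Set F) :
    transl h (g * g') p = transl h g (transl h g' p) := by
  ext f; simp [transl, mul_assoc]

lemma transl_subset_iff (h : K →* F) (g : K) (p q : Set F) :
    transl h g p ⊆ transl h g q ↔ p ⊆ q := by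
  constructor
  · intro hh f hf
    have := @hh (h g * f) (by simpa [transl] using hf)
    simpa [transl] using this
  · intro hh f hf
    exact hh hf

lemma transl_injective (h : K →* F) (g : K) : Function.Injective (transl h g) := by
  intro p q hpq
  exact Set.Subset.antisymm ((transl_subset_iff h g p q).1 hpq.le)
    ((transl_subset_iff h g q p).1 hpq.ge)

lemma transl_ssubset_iff (h : K →* F) (g : K) (p q : Set F) :
    transl h g p ⊂ transl h g q ↔ p ⊂ q := by
  rw [ssubset_iff_subset_not_subset, ssubset_iff_subset_not_subset, transl_subset_iff,
    transl_subset_iff]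

variable {e : β → K} {𝓗 : Set (Set F)} {h : K →* F}

lemma IsHalfTreeSystem.finite_sep' (h𝓗 : IsHalfTreeSystem 𝓗) (f g : F) :
    {p | p ∈ 𝓗 ∧ f ∉ p ∧ g ∈ p}.Finite := by
  have h1 := h𝓗.finite_sep (f⁻¹ * g)
  refine Set.Finite.of_finite_image (f := fun p : Set F => {y | f * y ∈ p}) (h1.subset ?_) ?_
  · rintro _ ⟨p, ⟨hp, hf, hg⟩, rfl⟩
    refine ⟨?_, by simpa using hf, by simpa using hg⟩
    have := h𝓗.smul p hp f⁻¹
    simpa using this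
  · intro p _ q _ hpq
    ext y
    have := Set.ext_iff.1 hpq (f⁻¹ * y)
    simpa using this

lemma transl_mem (h𝓗 : IsHalfTreeSystem 𝓗) (g : K) {p : Set F} :
    transl h g p ∈ 𝓗 ↔ p ∈ 𝓗 := by
  constructor
  · intro hp
    have := h𝓗.smul _ hp (h g⁻¹)
    simpa [transl] using this
  · intro hp; exact h𝓗.smul p hp (h g)

lemma finite_winTrace [Finite β] (h𝓗 : IsHalfTreeSystem 𝓗) :
    {p | p ∈ 𝓗 ∧ (winTrace e h p).Nonempty ∧ (winTrace e h p)ᶜ.Nonempty}.Finite := by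
  refine (Set.finite_iUnion fun b : β => Set.finite_iUnion fun b' : β =>
    h𝓗.finite_sep' (h (e b)) (h (e b'))).subset ?_
  rintro p ⟨hp, ⟨b', hb'⟩, ⟨b, hb⟩⟩
  simp only [Set.mem_iUnion]
  exact ⟨b, b', hp, hb, hb'⟩

lemma winTrace_mono {p q : Set F} (hpq : p ⊆ q) : winTrace e h p ⊆ winTrace e h q :=
  fun _ hb => hpq hb

lemma winTrace_compl (p : Set F) : winTrace e h pᶜ = (winTrace e h p)ᶜ := rfl

lemma SetNested.winTrace {p q : Set F} (hpq : SetNested p q) :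
    SetNested (winTrace e h p) (winTrace e h q) := by
  rcases hpq with hh | hh | hh | hh
  · exact Or.inl (winTrace_mono hh)
  · exact Or.inr (Or.inl (winTrace_mono hh))
  · exact Or.inr (Or.inr (Or.inl (winTrace_mono hh)))
  · exact Or.inr (Or.inr (Or.inr (winTrace_mono hh)))

lemma windowTgt_transl (x : ι → K) (i : ι) (p : Set F) :
    windowTgt x e i (winTrace e h (transl h (x i) p)) = windowSrc x e i (winTrace e h p) := by
  ext d
  simp only [windowTgt, windowSrc, winTrace, transl, windowPairs, Set.mem_ofPred_eq]
  refine and_congr_right fun hd => ?_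
  rw [hd]; simp

/-- Nested sets that agree somewhere inside and somewhere outside are comparable. -/
lemma SetNested.comparable {α : Type*} {p q : Set α} (hpq : SetNested p q) {a b : α}
    (ha : a ∈ p) (ha' : a ∈ q) (hb : b ∉ p) (hb' : b ∉ q) : p ⊆ q ∨ q ⊆ p := by
  rcases hpq with hh | hh | hh | hh
  · exact Or.inl hh
  · exact absurd ha' (hh ha)
  · exact absurd (hh hb) hb'
  · exact Or.inr (Set.compl_subset_compl.1 hh)

lemma WindowCuts.exists_src {x : ι → K} {i : ι} {H : Set β}
    (hc : WindowCuts x e i (windowSrc x e i H)) :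
    ∃ d ∈ windowPairs x e i, ∃ d' ∈ windowPairs x e i, d.1 ∈ H ∧ d'.1 ∉ H := by
  obtain ⟨⟨d, hd⟩, hne⟩ := hc
  have : ∃ d', d' ∈ windowPairs x e i ∧ d'.1 ∉ H := by
    by_contra hcon
    push Not at hcon
    exact hne (Set.Subset.antisymm (fun d hd => hd.1) fun d hd => ⟨hd, hcon d hd⟩)
  obtain ⟨d', h1, h2⟩ := this
  exact ⟨d, hd.1, d', h1, hd.2, h2⟩

lemma WindowCuts.exists_tgt {x : ι → K} {i : ι} {H : Set β}
    (hc : WindowCuts x e i (windowTgt x e i H)) :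
    ∃ d ∈ windowPairs x e i, ∃ d' ∈ windowPairs x e i, d.2 ∈ H ∧ d'.2 ∉ H := by
  obtain ⟨⟨d, hd⟩, hne⟩ := hc
  have : ∃ d', d' ∈ windowPairs x e i ∧ d'.2 ∉ H := by
    by_contra hcon
    push Not at hcon
    exact hne (Set.Subset.antisymm (fun d hd => hd.1) fun d hd => ⟨hd, hcon d hd⟩)
  obtain ⟨d', h1, h2⟩ := this
  exact ⟨d, hd.1, d', h1, hd.2, h2⟩

lemma exists_finset_cutting [Finite β] (h𝓗 : IsHalfTreeSystem 𝓗) (e : β → K) (h : K →* F) :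
    ∃ V : Finset (Set F), ∀ p, p ∈ V ↔
      p ∈ 𝓗 ∧ (winTrace e h p).Nonempty ∧ (winTrace e h p)ᶜ.Nonempty := by
  exact ⟨(finite_winTrace (e := e) (h := h) h𝓗).toFinset, fun p => Set.Finite.mem_toFinset _⟩

open Classical in
lemma traceWeight_eq_card {V : Finset (Set F)} (hV : ∀ p, p ∈ V ↔
      p ∈ 𝓗 ∧ (winTrace e h p).Nonempty ∧ (winTrace e h p)ᶜ.Nonempty) (H : Set β) :
    traceWeight e 𝓗 h H = (V.filter fun p => winTrace e h p = H).card := by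
  rw [traceWeight, ← Set.ncard_coe_finset]
  congr 1
  ext p
  simp only [Finset.coe_filter, hV, Set.mem_ofPred_eq]
  constructor
  · rintro ⟨h1, h2, h3, rfl⟩; exact ⟨⟨h1, h2, h3⟩, rfl⟩
  · rintro ⟨⟨h1, h2, h3⟩, rfl⟩; exact ⟨h1, h2, h3, rfl⟩

open Classical in
lemma sum_traceWeight [Fintype β] {V : Finset (Set F)} (hV : ∀ p, p ∈ V ↔
      p ∈ 𝓗 ∧ (winTrace e h p).Nonempty ∧ (winTrace e h p)ᶜ.Nonempty)
    (P : Set β → Prop) [DecidablePred P] :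
    ∑ H with P H, traceWeight e 𝓗 h H = (V.filter fun p => P (winTrace e h p)).card := by
  rw [Finset.card_eq_sum_card_fiberwise (f := winTrace e h) (t := Finset.univ.filter P)
    (fun p hp => by simpa using (Finset.mem_filter.1 hp).2)]
  refine Finset.sum_congr rfl fun H hH => ?_
  rw [traceWeight_eq_card hV, Finset.filter_filter]
  congr 1
  ext p
  simp only [Finset.mem_filter, Finset.mem_univ, true_and] at hH ⊢
  constructor
  · rintro ⟨h1, rfl⟩; exact ⟨h1, hH, rfl⟩
  · rintro ⟨h1, -, h2⟩; exact ⟨h1, h2⟩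

lemma WindowCuts.src_nonempty {x : ι → K} {i : ι} {H : Set β}
    (hc : WindowCuts x e i (windowSrc x e i H)) : H.Nonempty ∧ Hᶜ.Nonempty := by
  obtain ⟨d, -, d', -, h1, h2⟩ := hc.exists_src
  exact ⟨⟨_, h1⟩, ⟨_, h2⟩⟩

lemma WindowCuts.tgt_nonempty {x : ι → K} {i : ι} {H : Set β}
    (hc : WindowCuts x e i (windowTgt x e i H)) : H.Nonempty ∧ Hᶜ.Nonempty := by
  obtain ⟨d, -, d', -, h1, h2⟩ := hc.exists_tgt
  exact ⟨⟨_, h1⟩, ⟨_, h2⟩⟩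

lemma isWindowWeight_traceWeight [Fintype β] (x : ι → K) (e : β → K) (h𝓗 : IsHalfTreeSystem 𝓗)
    (h : K →* F) : IsWindowWeight x e (traceWeight e 𝓗 h) := by
  classical
  obtain ⟨V, hV⟩ := exists_finset_cutting h𝓗 e h
  refine ⟨by simp [traceWeight], ?_, ?_⟩
  · intro H
    rw [traceWeight_eq_card hV, traceWeight_eq_card hV]
    refine Finset.card_bij' (fun p _ => pᶜ) (fun p _ => pᶜ) ?_ ?_ (fun _ _ => compl_compl _)
      (fun _ _ => compl_compl _)
    · intro p hp
      simp only [Finset.mem_filter, hV, winTrace_compl] at hp ⊢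
      obtain ⟨⟨h1, h2, h3⟩, h4⟩ := hp
      exact ⟨⟨h𝓗.compl p h1, h3, by rwa [compl_compl]⟩, by rw [h4, compl_compl]⟩
    · intro p hp
      simp only [Finset.mem_filter, hV, winTrace_compl] at hp ⊢
      obtain ⟨⟨h1, h2, h3⟩, h4⟩ := hp
      exact ⟨⟨h𝓗.compl p h1, h3, by rwa [compl_compl]⟩, by rw [h4]⟩
  · intro i τ hτ
    rw [sum_traceWeight hV, sum_traceWeight hV]
    refine Finset.card_bij' (fun p _ => transl h (x i) p) (fun p _ => transl h (x i)⁻¹ p) ?_ ?_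
      (fun p _ => by rw [← transl_mul, inv_mul_cancel, transl_one])
      (fun p _ => by rw [← transl_mul, mul_inv_cancel, transl_one])
    · intro p hp
      simp only [Finset.mem_filter, hV] at hp ⊢
      obtain ⟨⟨h1, h2, h3⟩, h4⟩ := hp
      have h5 : windowTgt x e i (winTrace e h (transl h (x i) p)) = τ := by
        rw [windowTgt_transl, h4]
      exact ⟨⟨(transl_mem h𝓗 _).2 h1, WindowCuts.tgt_nonempty (by rwa [h5])⟩, h5⟩
    · intro p hp
      simp only [Finset.mem_filter, hV] at hp ⊢
      obtain ⟨⟨h1, h2, h3⟩, h4⟩ := hp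
      have h5 : windowSrc x e i (winTrace e h (transl h (x i)⁻¹ p)) = τ := by
        rw [← windowTgt_transl, ← transl_mul, mul_inv_cancel, transl_one, h4]
      exact ⟨⟨(transl_mem h𝓗 _).2 h1, WindowCuts.src_nonempty (by rwa [h5])⟩, h5⟩

lemma traceWeight_nested (e : β → K) (h𝓗 : IsHalfTreeSystem 𝓗) (h : K →* F) {H H' : Set β}
    (hH : traceWeight e 𝓗 h H ≠ 0) (hH' : traceWeight e 𝓗 h H' ≠ 0) : SetNested H H' := by
  obtain ⟨p, hp, -, -, rfl⟩ := Set.nonempty_of_ncard_ne_zero hH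
  obtain ⟨q, hq, -, -, rfl⟩ := Set.nonempty_of_ncard_ne_zero hH'
  exact SetNested.winTrace (h𝓗.nested p hp q hq)

open Classical in
lemma windowVerts_traceWeight [Fintype β] {V : Finset (Set F)} (hV : ∀ p, p ∈ V ↔
      p ∈ 𝓗 ∧ (winTrace e h p).Nonempty ∧ (winTrace e h p)ᶜ.Nonempty) :
    windowVerts (traceWeight e 𝓗 h) = V.card := by
  have := sum_traceWeight hV (fun _ => True)
  simpa [windowVerts] using this

open Classical in
lemma windowEdges_traceWeight [Fintype ι] [Fintype β] {V : Finset (Set F)} (x : ι → K)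
    (hV : ∀ p, p ∈ V ↔
      p ∈ 𝓗 ∧ (winTrace e h p).Nonempty ∧ (winTrace e h p)ᶜ.Nonempty) :
    windowEdges x e (traceWeight e 𝓗 h) = ((Finset.univ ×ˢ V).filter fun d : ι × Set F =>
      WindowCuts x e d.1 (windowSrc x e d.1 (winTrace e h d.2))).card := by
  rw [windowEdges, Finset.card_filter, Finset.sum_product]
  refine Finset.sum_congr rfl fun i _ => ?_
  rw [sum_traceWeight hV, Finset.card_filter]

open Classical in
/-- In a chain, the elements below `p` are those with the same trace below `p` and those with
strictly smaller trace. -/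
lemma card_below [Fintype β] {V : Finset (Set F)} (hV : ∀ p, p ∈ V ↔
      p ∈ 𝓗 ∧ (winTrace e h p).Nonempty ∧ (winTrace e h p)ᶜ.Nonempty) (T : Finset (Set F))
    (P : Set β → Prop) [DecidablePred P] (hT : ∀ p, p ∈ T ↔ p ∈ V ∧ P (winTrace e h p))
    (hchain : ∀ p ∈ T, ∀ q ∈ T, p ⊆ q ∨ q ⊆ p) {p : Set F} (hp : p ∈ T) :
    (T.filter fun q => q ⊂ p).card =
      (V.filter fun q => winTrace e h q = winTrace e h p ∧ q ⊂ p).card +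
        ∑ H with P H ∧ H ⊂ winTrace e h p, traceWeight e 𝓗 h H := by
  rw [sum_traceWeight hV, ← Finset.card_union_of_disjoint]
  · congr 1
    ext q
    simp only [Finset.mem_filter, Finset.mem_union, hT]
    constructor
    · rintro ⟨⟨h1, h2⟩, h3⟩
      by_cases h4 : winTrace e h q = winTrace e h p
      · exact Or.inl ⟨h1, h4, h3⟩
      · exact Or.inr ⟨h1, h2, (winTrace_mono h3.1).ssubset_of_ne h4⟩
    · rintro (⟨h1, h2, h3⟩ | ⟨h1, h2, h3⟩)
      · exact ⟨⟨h1, by rw [h2]; exact ((hT p).1 hp).2⟩, h3⟩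
      · refine ⟨⟨h1, h2⟩, ?_⟩
        rcases hchain q ((hT q).2 ⟨h1, h2⟩) p hp with h4 | h4
        · refine h4.ssubset_of_ne ?_
          rintro rfl
          exact h3.ne rfl
        · exact absurd (winTrace_mono h4) h3.not_subset
  · rw [Finset.disjoint_left]
    intro q hq hq'
    simp only [Finset.mem_filter] at hq hq'
    exact hq'.2.2.ne hq.2.1

/-- Homomorphisms that are injective on a large finite set have few window edges. -/
theorem exists_finset_windowEdges_le [Fintype ι] [Fintype β]
    (x : FreeGroupBasis ι K) (e : β → K) (h𝓗 : IsHalfTreeSystem 𝓗) (c : ℕ) (hc : 0 < c) :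
    ∃ Z : Finset K, 1 ∉ Z ∧ ∀ h : K →* F, (∀ z ∈ Z, h z ≠ 1) →
      c * windowEdges x e (traceWeight e 𝓗 h) ≤ (c + 1) * windowVerts (traceWeight e 𝓗 h) := by
  classical
  obtain ⟨Z, hZ1, hZ⟩ := exists_finset_card_edges_le (O := Set F) (S := Set β) x c hc
  refine ⟨Z, hZ1, fun h hh => ?_⟩
  obtain ⟨V, hV⟩ := exists_finset_cutting h𝓗 e h
  rw [windowVerts_traceWeight hV, windowEdges_traceWeight (⇑x) hV]
  have hcomp : ∀ p ∈ V, ∀ q ∈ V, winTrace e h p = winTrace e h q → p ⊆ q ∨ q ⊆ p := by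
    intro p hp q hq hpq
    rw [hV] at hp hq
    obtain ⟨hp, ⟨b, hb⟩, ⟨b', hb'⟩⟩ := hp
    exact SetNested.comparable (h𝓗.nested p hp q hq.1) hb (by rw [hpq] at hb; exact hb) hb'
      (by rw [hpq] at hb'; exact hb')
  refine hZ (transl h) (transl_one h) (transl_mul h) V _ ?_ (winTrace e h)
    (fun p => ((V.filter fun q => winTrace e h q = winTrace e h p ∧ q ⊂ p).card : ℤ))
    (fun s => (∑ H with windowSrc x e s.1 H = windowSrc x e s.1 s.2.1 ∧ H ⊂ s.2.1,
        traceWeight e 𝓗 h H : ℕ) -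
      (∑ H with windowTgt x e s.1 H = windowTgt x e s.1 s.2.2 ∧ H ⊂ s.2.2,
        traceWeight e 𝓗 h H : ℕ)) ?_ ?_ ?_
  · rintro ⟨i, p⟩ hd
    simp only [Finset.mem_filter, Finset.mem_product, Finset.mem_univ, true_and] at hd ⊢
    obtain ⟨h1, h2⟩ := hd
    rw [← windowTgt_transl] at h2
    exact ⟨h1, (hV _).2 ⟨(transl_mem h𝓗 _).2 ((hV _).1 h1).1, h2.tgt_nonempty⟩⟩
  · rintro ⟨i, p⟩ hd
    simp only [Finset.mem_filter, Finset.mem_product, Finset.mem_univ, true_and] at hd ⊢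
    obtain ⟨hpV, hcut⟩ := hd
    have hcut' : WindowCuts x e i (windowTgt x e i (winTrace e h (transl h (x i) p))) := by
      rwa [windowTgt_transl]
    have hqV : transl h (x i) p ∈ V :=
      (hV _).2 ⟨(transl_mem h𝓗 _).2 ((hV _).1 hpV).1, hcut'.tgt_nonempty⟩
    have chS : ∀ q ∈ V, ∀ q' ∈ V, windowSrc x e i (winTrace e h q) =
        windowSrc x e i (winTrace e h p) → windowSrc x e i (winTrace e h q') =
        windowSrc x e i (winTrace e h p) → q ⊆ q' ∨ q' ⊆ q := by
      intro q hq q' hq' h1 h2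
      obtain ⟨d, hd, d', hd', h3, h4⟩ := WindowCuts.exists_src hcut
      have e1 := Set.ext_iff.1 h1 d
      have e2 := Set.ext_iff.1 h2 d
      have e3 := Set.ext_iff.1 h1 d'
      have e4 := Set.ext_iff.1 h2 d'
      simp only [windowSrc, Set.mem_ofPred_eq, hd, hd', true_and, h3, h4, iff_true, iff_false]
        at e1 e2 e3 e4
      exact SetNested.comparable (h𝓗.nested q ((hV _).1 hq).1 q' ((hV _).1 hq').1) e1 e2 e3 e4
    have key1 := card_below hV (V.filter fun q => windowSrc x e i (winTrace e h q) =
        windowSrc x e i (winTrace e h p)) (fun H => windowSrc x e i H =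
        windowSrc x e i (winTrace e h p)) (by simp) (by
        intro q hq q' hq'
        rw [Finset.mem_filter] at hq hq'
        exact chS q hq.1 q' hq'.1 hq.2 hq'.2) (p := p) (by simp [hpV])
    have mem_tr : ∀ q, (q ∈ V ∧ windowSrc x e i (winTrace e h q) =
        windowSrc x e i (winTrace e h p)) ↔ (transl h (x i) q ∈ V ∧
        windowTgt x e i (winTrace e h (transl h (x i) q)) =
        windowTgt x e i (winTrace e h (transl h (x i) p))) := by
      intro q
      rw [windowTgt_transl, windowTgt_transl]
      constructor
      · rintro ⟨h1, h2⟩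
        refine ⟨(hV _).2 ⟨(transl_mem h𝓗 _).2 ((hV _).1 h1).1,
          WindowCuts.tgt_nonempty (x := x) (e := e) (i := i) ?_⟩, h2⟩
        rw [windowTgt_transl, h2]; exact hcut
      · rintro ⟨h1, h2⟩
        refine ⟨(hV _).2 ⟨(transl_mem h𝓗 _).1 ((hV _).1 h1).1,
          WindowCuts.src_nonempty (x := x) (e := e) (i := i) ?_⟩, h2⟩
        rw [h2]; exact hcut
    have hsurj : ∀ q, transl h (x i) (transl h (x i)⁻¹ q) = q := fun q => by
      rw [← transl_mul, mul_inv_cancel, transl_one]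
    have key2 := card_below hV (V.filter fun q => windowTgt x e i (winTrace e h q) =
        windowTgt x e i (winTrace e h (transl h (x i) p))) (fun H => windowTgt x e i H =
        windowTgt x e i (winTrace e h (transl h (x i) p))) (by simp) (by
        intro q hq q' hq'
        rw [Finset.mem_filter] at hq hq'
        rw [← hsurj q] at hq
        rw [← hsurj q'] at hq'
        have h1 := (mem_tr _).2 hq
        have h2 := (mem_tr _).2 hq'
        have h3 := chS _ h1.1 _ h2.1 h1.2 h2.2
        simpa only [← transl_subset_iff h (x i) (transl h (x i)⁻¹ _), hsurj] using h3)
        (p := transl h (x i) p) (by simp [hqV])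
    have key3 : ((V.filter fun q => windowSrc x e i (winTrace e h q) =
        windowSrc x e i (winTrace e h p)).filter fun q => q ⊂ p).card =
        ((V.filter fun q => windowTgt x e i (winTrace e h q) =
        windowTgt x e i (winTrace e h (transl h (x i) p))).filter
          fun q => q ⊂ transl h (x i) p).card := by
      refine Finset.card_bij (fun q _ => transl h (x i) q) ?_
        (fun q _ q' _ hqq => transl_injective h _ hqq) ?_
      · intro q hq
        rw [Finset.mem_filter, Finset.mem_filter] at hq ⊢
        exact ⟨(mem_tr q).1 hq.1, (transl_ssubset_iff _ _ _ _).2 hq.2⟩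
      · intro q hq
        refine ⟨transl h (x i)⁻¹ q, ?_, hsurj q⟩
        rw [← hsurj q, Finset.mem_filter, Finset.mem_filter, transl_ssubset_iff, ← mem_tr] at hq
        rw [Finset.mem_filter, Finset.mem_filter]
        exact hq
    rw [key3] at key1
    have := key1.symm.trans key2
    zify at this
    push_cast at this ⊢
    linarith
  · intro p hp q hq htr hpos
    have hpos : (V.filter fun q => winTrace e h q = winTrace e h p ∧ q ⊂ p).card =
        (V.filter fun q' => winTrace e h q' = winTrace e h q ∧ q' ⊂ q).card := by
      exact_mod_cast hpos
    have aux : ∀ p ∈ V, ∀ q ∈ V, winTrace e h p = winTrace e h q → p ⊆ q → p ≠ q →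
        (V.filter fun q => winTrace e h q = winTrace e h p ∧ q ⊂ p).card <
        (V.filter fun q' => winTrace e h q' = winTrace e h q ∧ q' ⊂ q).card := by
      intro p hp q hq htr hsub hne
      apply Finset.card_lt_card
      rw [Finset.ssubset_iff_of_subset]
      · exact ⟨p, by simp [hp, htr, hsub.ssubset_of_ne hne], by simp⟩
      · intro r hr
        rw [Finset.mem_filter] at hr ⊢
        exact ⟨hr.1, hr.2.1.trans htr, hr.2.2.trans_subset hsub⟩
    by_contra hne
    rcases hcomp p hp q hq htr with h1 | h1
    · exact (aux p hp q hq htr h1 hne).ne hpos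
    · exact (aux q hq p hp htr.symm h1 (Ne.symm hne)).ne hpos.symm
  · intro p hp z hz hpz
    exact hh z hz (h𝓗.free p ((hV p).1 hp).1 (h z) hpz)

end Trace

section Delta

variable {ι β K : Type*} [Group K] [Fintype β] {x : ι → K} {e : β → K}

lemma windowVerts_add (w w' : Set β → ℕ) :
    windowVerts (w + w') = windowVerts w + windowVerts w' := by
  simp [windowVerts, Finset.sum_add_distrib]

lemma windowEdges_add [Fintype ι] (w w' : Set β → ℕ) :
    windowEdges x e (w + w') = windowEdges x e w + windowEdges x e w' := by
  simp [windowEdges, Finset.sum_add_distrib]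

lemma IsWindowWeight.of_add {w w' : Set β → ℕ} (h : IsWindowWeight x e w)
    (h' : IsWindowWeight x e (w + w')) : IsWindowWeight x e w' := by
  refine ⟨?_, ?_, ?_⟩
  · have := h'.empty
    simp only [Pi.add_apply] at this
    omega
  · intro H
    have h1 := h'.compl H
    have h2 := h.compl H
    simp only [Pi.add_apply] at h1
    omega
  · intro i τ hτ
    have h1 := h'.balance i τ hτ
    have h2 := h.balance i τ hτ
    simp only [Pi.add_apply, Finset.sum_add_distrib] at h1
    omega

lemma windowVerts_eq_zero {w : Set β → ℕ} (h : windowVerts w = 0) : w = 0 := by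
  classical
  funext H
  simpa using (Finset.sum_eq_zero_iff.1 h) H (Finset.mem_univ _)

/-- If all small window weights have more edges than vertices, then so have, uniformly, all the
large ones. -/
lemma exists_uniform_edges_gt [Fintype ι] :
    ∃ c : ℕ, 0 < c ∧ ∀ Δ : Set β → ℕ, IsWindowWeight x e Δ →
      (∀ δ ≤ Δ, IsWindowWeight x e δ → δ ≠ 0 → windowVerts δ < windowEdges x e δ) →
      (c + 1) * windowVerts Δ ≤ c * windowEdges x e Δ := by
  let T : Set (Set β → ℕ) := {δ | Minimal (fun δ => IsWindowWeight x e δ ∧ δ ≠ 0) δ}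
  have hfin : T.Finite := by
    have : IsAntichain (· ≤ ·) T := setOfPred_minimal_antichain _
    exact this.finite_of_wellQuasiOrdered wellQuasiOrdered_le
  obtain ⟨c, hc⟩ : ∃ c : ℕ, ∀ δ ∈ T, windowVerts δ ≤ c := by
    obtain ⟨c, hc⟩ := (hfin.image windowVerts).bddAbove
    exact ⟨c, fun δ hδ => hc ⟨δ, hδ, rfl⟩⟩
  refine ⟨c + 1, Nat.succ_pos _, ?_⟩
  intro Δ
  induction hn : windowVerts Δ using Nat.strong_induction_on generalizing Δ with
  | _ n ih =>
    intro hΔ hsmall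
    by_cases h0 : Δ = 0
    · subst h0; rw [← hn]; simp [windowVerts]
    obtain ⟨μ, hμΔ, hμ⟩ := exists_minimal_le_of_wellFoundedLT
      (fun δ => IsWindowWeight x e δ ∧ δ ≠ 0) Δ ⟨hΔ, h0⟩
    obtain ⟨δ, rfl⟩ := exists_add_of_le hμΔ
    have hδ : IsWindowWeight x e δ := hμ.prop.1.of_add hΔ
    have hvμ : windowVerts μ ≠ 0 := fun h => hμ.prop.2 (windowVerts_eq_zero h)
    have h1 := hsmall μ hμΔ hμ.prop.1 hμ.prop.2
    have h2 := hc μ hμ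
    have h3 := ih (windowVerts δ) (by rw [← hn, windowVerts_add]; omega) δ rfl hδ
      (fun δ' hδ' => hsmall δ' (hδ'.trans le_add_self))
    rw [← hn, windowVerts_add, windowEdges_add]
    nlinarith

open Classical in
/-- From a sequence of window weights of unbounded size and with few edges one extracts a weight
with at most as many edges as vertices. -/
theorem exists_windowWeight [Fintype ι] (ℓ : ℕ → Set β → ℕ) (hℓ : ∀ n, IsWindowWeight x e (ℓ n))
    (hnest : ∀ n H H', ℓ n H ≠ 0 → ℓ n H' ≠ 0 → SetNested H H')
    (hunb : ∀ k, ∃ᶠ n in atTop, k ≤ windowVerts (ℓ n))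
    (hgrow : ∀ c, 0 < c → ∀ᶠ n in atTop,
      c * windowEdges x e (ℓ n) ≤ (c + 1) * windowVerts (ℓ n))
    (b₀ : β) (T : Set β) (hT : ∀ s ∈ T, ∀ n, ∑ H with b₀ ∉ H ∧ s ∈ H, ℓ n H =
      ∑ H with b₀ ∉ H ∧ s ∈ H, ℓ 0 H) :
    ∃ δ, IsWindowWeight x e δ ∧ δ ≠ 0 ∧ (∀ H H', δ H ≠ 0 → δ H' ≠ 0 → SetNested H H') ∧
      (∀ s ∈ T, ∀ H, δ H ≠ 0 → (b₀ ∈ H ↔ s ∈ H)) ∧ windowEdges x e δ ≤ windowVerts δ := by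
  obtain ⟨c, hc0, hc⟩ := exists_uniform_edges_gt (ι := ι) (x := x) (e := e)
  obtain ⟨N, hN⟩ := eventually_atTop.1 (hgrow (2 * c) (by omega))
  have hsel : ∀ k, ∃ n ≥ N, k ≤ windowVerts (ℓ n) := fun k => (frequently_atTop.1 (hunb k)) N
  choose n hnN hnk using hsel
  obtain ⟨g, hg⟩ := (wellQuasiOrdered_le (α := Set β → ℕ)).exists_monotone_subseq
    (fun k => ℓ (n k))
  have hmono : ∀ k, ℓ (n (g 0)) ≤ ℓ (n (g k)) := fun k => hg 0 k (Nat.zero_le k)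
  set V₀ := windowVerts (ℓ (n (g 0))) with hV₀
  obtain ⟨k, hk⟩ : ∃ k, (2 * c + 2) * V₀ < g k :=
    ⟨(2 * c + 2) * V₀ + 1, lt_of_lt_of_le (Nat.lt_succ_self _) (g.strictMono.id_le _)⟩
  obtain ⟨Δ, hΔ⟩ := exists_add_of_le (hmono k)
  have hwΔ : IsWindowWeight x e Δ := (hℓ (n (g 0))).of_add (hΔ ▸ hℓ (n (g k)))
  have hex : ∃ δ ≤ Δ, IsWindowWeight x e δ ∧ δ ≠ 0 ∧ windowEdges x e δ ≤ windowVerts δ := by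
    by_contra hcon
    push Not at hcon
    have h1 := hc Δ hwΔ hcon
    have h2 := hN (n (g k)) (hnN _)
    have h3 := hnk (g k)
    rw [hΔ, windowEdges_add, windowVerts_add, ← hV₀] at h2
    rw [hΔ, windowVerts_add, ← hV₀] at h3
    nlinarith
  obtain ⟨δ, hδΔ, hδ, hδ0, hδf⟩ := hex
  have hle : ∀ H, δ H ≠ 0 → ℓ (n (g k)) H ≠ 0 := by
    intro H hH
    have h1 : δ H ≤ Δ H := hδΔ H
    rw [hΔ, Pi.add_apply]
    omega
  have hsep : ∀ s ∈ T, ∀ H, δ H ≠ 0 → b₀ ∉ H → s ∉ H := by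
    intro s hs H hH hb hsH
    have h1 := (hT s hs (n (g k))).trans (hT s hs (n (g 0))).symm
    rw [hΔ] at h1
    simp only [Pi.add_apply, Finset.sum_add_distrib] at h1
    have h2 : ∑ H with b₀ ∉ H ∧ s ∈ H, Δ H = 0 := by omega
    have h3 := Finset.sum_eq_zero_iff.1 h2 H (by simp [hb, hsH])
    have h4 : δ H ≤ Δ H := hδΔ H
    omega
  refine ⟨δ, hδ, hδ0, fun H H' h h' => hnest _ H H' (hle H h) (hle H' h'), ?_, hδf⟩
  intro s hs H hH
  constructor
  · intro hb
    by_contra hsH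
    exact hsep s hs Hᶜ (by rwa [hδ.compl]) (by simpa using hb) hsH
  · intro hsH
    by_contra hb
    exact hsep s hs H hH hb hsH

end Delta

section TraceSep

variable {β K F : Type*} [Group K] [Group F] [Fintype β]
  {e : β → K} {𝓗 : Set (Set F)} {h : K →* F}

open Classical in
lemma sum_traceWeight_sep (h𝓗 : IsHalfTreeSystem 𝓗) {b₀ s : β} (hb : e b₀ = 1) :
    ∑ H with b₀ ∉ H ∧ s ∈ H, traceWeight e 𝓗 h H =
      {p | p ∈ 𝓗 ∧ 1 ∉ p ∧ h (e s) ∈ p}.ncard := by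
  obtain ⟨V, hV⟩ := exists_finset_cutting h𝓗 e h
  rw [sum_traceWeight hV, ← Set.ncard_coe_finset]
  congr 1
  ext p
  simp only [Finset.coe_filter, Set.mem_ofPred_eq, hV]
  have h1 : b₀ ∈ winTrace e h p ↔ 1 ∈ p := by simp [winTrace, hb]
  rw [h1]
  constructor
  · rintro ⟨⟨h2, -, -⟩, h3, h4⟩; exact ⟨h2, h3, h4⟩
  · rintro ⟨h2, h3, h4⟩
    exact ⟨⟨h2, ⟨s, h4⟩, ⟨b₀, fun h => h3 (h1.1 h)⟩⟩, h3, h4⟩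

lemma ncard_sep_le_windowVerts (h𝓗 : IsHalfTreeSystem 𝓗) {b₀ : β} (hb : e b₀ = 1) (s : β) :
    {p | p ∈ 𝓗 ∧ 1 ∉ p ∧ h (e s) ∈ p}.ncard ≤ windowVerts (traceWeight e 𝓗 h) := by
  classical
  rw [← sum_traceWeight_sep h𝓗 hb]
  exact Finset.sum_le_sum_of_subset (Finset.filter_subset _ _)

end TraceSep

/-- A finite nested system of walls on the window `e`, partially translated by the `x i`. -/
structure TrackSystem {ι β K : Type*} [Group K] (x : ι → K) (e : β → K) (O : Type*)
    [PartialOrder O] where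
  star : O → O
  star_star : ∀ p, star (star p) = p
  star_le : ∀ p q, p ≤ q → star q ≤ star p
  nested : ∀ p q, p ≤ q ∨ p ≤ star q ∨ star p ≤ q ∨ star p ≤ star q
  not_le_star : ∀ p, ¬ p ≤ star p
  side : O → Set β
  side_mono : ∀ p q, p ≤ q → side p ⊆ side q
  side_star : ∀ p, side (star p) = (side p)ᶜ
  side_nonempty : ∀ p, (side p).Nonempty
  rel : ι → O → O → Prop
  rel_src : ∀ i p q, rel i p q → ∃ d ∈ windowPairs x e i, ∃ d' ∈ windowPairs x e i,
    d.1 ∈ side p ∧ d'.1 ∉ side p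
  rel_pairs : ∀ i p q, rel i p q → ∀ d ∈ windowPairs x e i, (d.1 ∈ side p ↔ d.2 ∈ side q)
  rel_le : ∀ i p q p' q', rel i p q → rel i p' q' → (p ≤ p' ↔ q ≤ q')
  rel_star : ∀ i p q, rel i p q → rel i (star p) (star q)
  exists_rel_src : ∀ i p, ∀ d ∈ windowPairs x e i, ∀ d' ∈ windowPairs x e i,
    d.1 ∈ side p → d'.1 ∉ side p → ∃ q, rel i p q
  exists_rel_tgt : ∀ i q, ∀ d ∈ windowPairs x e i, ∀ d' ∈ windowPairs x e i,
    d.2 ∈ side q → d'.2 ∉ side q → ∃ p, rel i p q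
  sign : O → ZMod 2
  sign_star : ∀ p, sign (star p) = sign p + 1
  sign_rel : ∀ i p q, rel i p q → sign p = sign q
  card_le : Nat.card {d : ι × O // ∃ q, rel d.1 d.2 q} ≤ Nat.card O

section CopyLE

variable {β : Type*}

/-- The lexicographic order on copies. -/
def CopyLE (p q : Set β × ℕ) : Prop := p.1 ⊂ q.1 ∨ p.1 = q.1 ∧ p.2 ≤ q.2

lemma CopyLE.antisymm {p q : Set β × ℕ} (h : CopyLE p q) (h' : CopyLE q p) : p = q := by
  rcases h with h | ⟨h1, h2⟩
  · rcases h' with h' | ⟨h3, h4⟩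
    · exact absurd h'.1 h.not_subset
    · exact absurd h3.symm h.ne
  · rcases h' with h' | ⟨h3, h4⟩
    · exact absurd h1.symm h'.ne
    · exact Prod.ext h1 (le_antisymm h2 h4)

lemma CopyLE.trans {p q r : Set β × ℕ} (h : CopyLE p q) (h' : CopyLE q r) : CopyLE p r := by
  rcases h with h | ⟨h1, h2⟩
  · rcases h' with h' | ⟨h3, h4⟩
    · exact Or.inl (h.trans h')
    · exact Or.inl (h3 ▸ h)
  · rcases h' with h' | ⟨h3, h4⟩
    · exact Or.inl (h1 ▸ h')
    · exact Or.inr ⟨h1.trans h3, h2.trans h4⟩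

lemma CopyLE.subset {p q : Set β × ℕ} (h : CopyLE p q) : p.1 ⊆ q.1 := by
  rcases h with h | h
  · exact h.1
  · exact h.1.le

end CopyLE

section ChainPos

variable {β γ : Type*} [Fintype β]

open Classical in
/-- The position of the `k`-th copy of `H` among all the copies of the sets with the same preimage
under `f`. -/
noncomputable def chainPos (w : Set β → ℕ) (f : γ → β) (H : Set β) (k : ℕ) : ℕ :=
  k + ∑ H' with f ⁻¹' H' = f ⁻¹' H ∧ H' ⊂ H, w H'

open Classical in
lemma chainPos_lt_of_ssubset {w : Set β → ℕ} {f : γ → β} {H H' : Set β} {k : ℕ} (hk : k < w H)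
    (hf : f ⁻¹' H = f ⁻¹' H') (hH : H ⊂ H') : 
    chainPos w f H k < ∑ H'' with f ⁻¹' H'' = f ⁻¹' H' ∧ H'' ⊂ H', w H'' := by
  have h1 : insert H (Finset.univ.filter fun H'' => f ⁻¹' H'' = f ⁻¹' H ∧ H'' ⊂ H) ⊆
      Finset.univ.filter fun H'' => f ⁻¹' H'' = f ⁻¹' H' ∧ H'' ⊂ H' := by
    intro H''
    simp only [Finset.mem_insert, Finset.mem_filter, Finset.mem_univ, true_and]
    rintro (rfl | ⟨h1, h2⟩)
    · exact ⟨hf, hH⟩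
    · exact ⟨h1.trans hf, h2.trans hH⟩
  refine lt_of_lt_of_le ?_ (Finset.sum_le_sum_of_subset h1)
  rw [Finset.sum_insert (by simp), chainPos]
  omega

open Classical in
lemma chainPos_lt {w : Set β → ℕ} {f : γ → β} {H : Set β} {k : ℕ} (hk : k < w H) :
    chainPos w f H k < ∑ H' with f ⁻¹' H' = f ⁻¹' H, w H' := by
  have h1 : insert H (Finset.univ.filter fun H'' => f ⁻¹' H'' = f ⁻¹' H ∧ H'' ⊂ H) ⊆
      Finset.univ.filter fun H'' => f ⁻¹' H'' = f ⁻¹' H := by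
    intro H''
    simp only [Finset.mem_insert, Finset.mem_filter, Finset.mem_univ, true_and]
    rintro (rfl | ⟨h1, h2⟩)
    · rfl
    · exact h1
  refine lt_of_lt_of_le ?_ (Finset.sum_le_sum_of_subset h1)
  rw [Finset.sum_insert (by simp), chainPos]
  omega

lemma chainPos_le_iff {w : Set β → ℕ} {f : γ → β} {p q : Set β × ℕ} (hp : p.2 < w p.1)
    (hq : q.2 < w q.1) (hf : f ⁻¹' p.1 = f ⁻¹' q.1) (hc : p.1 ⊆ q.1 ∨ q.1 ⊆ p.1) :
    chainPos w f p.1 p.2 ≤ chainPos w f q.1 q.2 ↔ CopyLE p q := by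
  have aux : ∀ p q : Set β × ℕ, p.2 < w p.1 → f ⁻¹' p.1 = f ⁻¹' q.1 → p.1 ⊂ q.1 →
      chainPos w f p.1 p.2 < chainPos w f q.1 q.2 := fun p q hp hf h =>
    lt_of_lt_of_le (chainPos_lt_of_ssubset hp hf h) (Nat.le_add_left _ _)
  by_cases he : p.1 = q.1
  · rw [CopyLE, chainPos, chainPos, he]
    simp
  · rcases hc with hc | hc
    · have := aux p q hp hf (hc.ssubset_of_ne he)
      exact ⟨fun _ => Or.inl (hc.ssubset_of_ne he), fun _ => this.le⟩
    · have h1 := aux q p hq hf.symm (hc.ssubset_of_ne (Ne.symm he))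
      refine ⟨fun h => absurd h (by omega), ?_⟩
      rintro (h | h)
      · exact absurd hc h.not_subset
      · exact absurd h.1 he

open Classical in
/-- Every position is attained. -/
lemma exists_chainPos_eq {w : Set β → ℕ} {f : γ → β} {τ : Set γ}
    (hc : ∀ H H', w H ≠ 0 → w H' ≠ 0 → f ⁻¹' H = τ → f ⁻¹' H' = τ → H ⊆ H' ∨ H' ⊆ H) {n : ℕ}
    (hn : n < ∑ H with f ⁻¹' H = τ, w H) :
    ∃ H k, k < w H ∧ f ⁻¹' H = τ ∧ chainPos w f H k = n := by
  let T : Finset (Σ _ : Set β, ℕ) := (Finset.univ.filter fun H : Set β => f ⁻¹' H = τ).sigma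
    fun H => Finset.range (w H)
  have hT : ∀ p, p ∈ T ↔ f ⁻¹' p.1 = τ ∧ p.2 < w p.1 := by intro p; simp [T]
  have himg : T.image (fun p => chainPos w f p.1 p.2) =
      Finset.range (∑ H with f ⁻¹' H = τ, w H) := by
    apply Finset.eq_of_subset_of_card_le
    · intro m hm
      obtain ⟨p, hp, rfl⟩ := Finset.mem_image.1 hm
      rw [hT] at hp
      have := chainPos_lt (f := f) hp.2
      rw [hp.1] at this
      exact Finset.mem_range.2 this
    · rw [Finset.card_image_of_injOn, Finset.card_range, Finset.card_sigma]
      · simp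
      · intro p hp q hq hpq
        have hp := (hT p).1 hp
        have hq := (hT q).1 hq
        have hch := hc p.1 q.1 (by omega) (by omega) hp.1 hq.1
        have h1 := (chainPos_le_iff (f := f) (p := (p.1, p.2)) (q := (q.1, q.2)) hp.2 hq.2
          (hp.1.trans hq.1.symm) hch).1 hpq.le
        have h2 := (chainPos_le_iff (f := f) (p := (q.1, q.2)) (q := (p.1, p.2)) hq.2 hp.2
          (hq.1.trans hp.1.symm) hch.symm).1 hpq.ge
        have h3 := h1.antisymm h2
        simp only [Prod.mk.injEq] at h3
        exact Sigma.ext h3.1 (heq_of_eq h3.2)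
  have := (Finset.ext_iff.1 himg n).2 (Finset.mem_range.2 hn)
  obtain ⟨p, hp, h⟩ := Finset.mem_image.1 this
  rw [hT] at hp
  exact ⟨p.1, p.2, hp.2, hp.1, h⟩

open Classical in
/-- Complementation reverses positions. -/
lemma chainPos_compl {w : Set β → ℕ} {f : γ → β} (hw : ∀ H, w Hᶜ = w H)
    {H : Set β} (hc : ∀ H', w H' ≠ 0 → f ⁻¹' H' = f ⁻¹' H → H' ⊆ H ∨ H ⊆ H')
    {k : ℕ} (hk : k < w H) :
    chainPos w f Hᶜ (w H - 1 - k) + chainPos w f H k + 1 = ∑ H' with f ⁻¹' H' = f ⁻¹' H, w H' := by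
  have h1 : ∑ H' with f ⁻¹' H' = f ⁻¹' Hᶜ ∧ H' ⊂ Hᶜ, w H' =
      ∑ H' with f ⁻¹' H' = f ⁻¹' H ∧ H ⊂ H', w H' := by
    refine Finset.sum_bij' (fun H' _ => H'ᶜ) (fun H' _ => H'ᶜ) ?_ ?_ (fun _ _ => compl_compl _)
      (fun _ _ => compl_compl _) (fun H' _ => (hw H').symm)
    · intro H' h
      simp only [Finset.mem_filter, Finset.mem_univ, true_and, Set.preimage_compl] at h ⊢
      refine ⟨by rw [h.1, compl_compl], ?_⟩
      have := compl_lt_compl_iff_lt.2 h.2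
      rwa [compl_compl] at this
    · intro H' h
      simp only [Finset.mem_filter, Finset.mem_univ, true_and, Set.preimage_compl] at h ⊢
      exact ⟨by rw [h.1], compl_lt_compl_iff_lt.2 h.2⟩
  have h2 : ∑ H' with f ⁻¹' H' = f ⁻¹' H, w H' = ∑ H' with f ⁻¹' H' = f ⁻¹' H ∧ H ⊂ H', w H' +
      ∑ H' with f ⁻¹' H' = f ⁻¹' H ∧ H' ⊂ H, w H' + w H := by
    have h3 : ∀ H', f ⁻¹' H' = f ⁻¹' H → w H' ≠ 0 → H ⊂ H' ∨ H' ⊂ H ∨ H' = H := by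
      intro H' hf h0
      by_cases he : H' = H
      · exact Or.inr (Or.inr he)
      · rcases hc H' h0 hf with h | h
        · exact Or.inr (Or.inl (h.ssubset_of_ne he))
        · exact Or.inl (h.ssubset_of_ne (Ne.symm he))
    have h4 : w H = ∑ H' with H' = H, w H' := by
      rw [Finset.sum_filter, Finset.sum_ite_eq']
      simp
    rw [h4]
    simp only [Finset.sum_filter]
    rw [← Finset.sum_add_distrib, ← Finset.sum_add_distrib]
    refine Finset.sum_congr rfl fun H' _ => ?_
    by_cases hf : f ⁻¹' H' = f ⁻¹' H
    · by_cases h0 : w H' = 0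
      · simp [h0]
      · rcases h3 H' hf h0 with h | h | rfl
        · simp [hf, h, h.not_gt, h.ne']
        · simp [hf, h, h.not_gt, h.ne]
        · simp only [if_true, ssubset_irrefl, and_false, if_false, zero_add]
    · have : H' ≠ H := by rintro rfl; exact hf rfl
      simp [hf, this]
  rw [h2, chainPos, chainPos, h1]
  omega

end ChainPos

section CopyRel

variable {β γ : Type*}

/-- Two copies correspond when their traces agree and they have the same position. -/
def CopyRel [Fintype β] (w : Set β → ℕ) (f f' : γ → β) (p q : Set β × ℕ) : Prop :=
  (f ⁻¹' p.1).Nonempty ∧ f ⁻¹' p.1 ≠ Set.univ ∧ f' ⁻¹' q.1 = f ⁻¹' p.1 ∧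
    chainPos w f p.1 p.2 = chainPos w f' q.1 q.2

lemma CopyRel.symm [Fintype β] {w : Set β → ℕ} {f f' : γ → β} {p q : Set β × ℕ}
    (h : CopyRel w f f' p q) : CopyRel w f' f q p :=
  ⟨h.2.2.1 ▸ h.1, h.2.2.1 ▸ h.2.1, h.2.2.1.symm, h.2.2.2.symm⟩

lemma SetNested.comparable_of_preimage {f : γ → β} {H H' : Set β} (hn : SetNested H H')
    (h1 : (f ⁻¹' H).Nonempty) (h2 : f ⁻¹' H ≠ Set.univ) (h : f ⁻¹' H = f ⁻¹' H') :
    H ⊆ H' ∨ H' ⊆ H := by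
  obtain ⟨a, ha⟩ := h1
  obtain ⟨b, hb⟩ := (Set.ne_univ_iff_exists_notMem _).1 h2
  have ha' := ha
  have hb' := hb
  rw [h] at ha' hb'
  exact hn.comparable ha ha' hb hb'

lemma CopyRel.le [Fintype β] {w : Set β → ℕ} {f f' : γ → β}
    (hnest : ∀ H H', w H ≠ 0 → w H' ≠ 0 → SetNested H H') {p q p' q' : Set β × ℕ}
    (hp : p.2 < w p.1) (hq : q.2 < w q.1) (hp' : p'.2 < w p'.1) (hq' : q'.2 < w q'.1)
    (h : CopyRel w f f' p q) (h' : CopyRel w f f' p' q') (hle : CopyLE p p') : CopyLE q q' := by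
  have hn := hnest q.1 q'.1 (by omega) (by omega)
  by_cases he : f ⁻¹' p.1 = f ⁻¹' p'.1
  · have he' : f' ⁻¹' q.1 = f' ⁻¹' q'.1 := by rw [h.2.2.1, h'.2.2.1, he]
    have hc := hn.comparable_of_preimage h.symm.1 h.symm.2.1 he'
    rw [← chainPos_le_iff hq hq' he' hc, ← h.2.2.2, ← h'.2.2.2,
      chainPos_le_iff hp hp' he (Or.inl hle.subset)]
    exact hle
  · have hs : f ⁻¹' p.1 ⊂ f ⁻¹' p'.1 := (Set.preimage_mono hle.subset).ssubset_of_ne he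
    rw [← h.2.2.1, ← h'.2.2.1] at hs
    obtain ⟨a, ha⟩ := h.symm.1
    obtain ⟨b, hb⟩ := (Set.ne_univ_iff_exists_notMem _).1 h'.symm.2.1
    rcases hn with hn | hn | hn | hn
    · exact Or.inl (hn.ssubset_of_ne fun heq => hs.ne (by rw [heq]))
    · exact absurd (hs.1 ha) (hn ha)
    · exact absurd (hn fun hb' => hb (hs.1 hb')) hb
    · exact absurd (Set.preimage_mono (Set.compl_subset_compl.1 hn)) hs.not_subset

lemma CopyRel.compl [Fintype β] {w : Set β → ℕ} {f f' : γ → β} (hw : ∀ H, w Hᶜ = w H)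
    (hnest : ∀ H H', w H ≠ 0 → w H' ≠ 0 → SetNested H H')
    {p q : Set β × ℕ} (hp : p.2 < w p.1) (hq : q.2 < w q.1) (h : CopyRel w f f' p q)
    (hb : ∑ H with f ⁻¹' H = f ⁻¹' p.1, w H = ∑ H with f' ⁻¹' H = f ⁻¹' p.1, w H) :
    CopyRel w f f' (p.1ᶜ, w p.1 - 1 - p.2) (q.1ᶜ, w q.1 - 1 - q.2) := by
  obtain ⟨h1, h2, h3, h4⟩ := h
  refine ⟨?_, ?_, ?_, ?_⟩
  · rw [Set.preimage_compl, Set.nonempty_compl]; exact h2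
  · rw [Set.preimage_compl, Ne, Set.compl_univ_iff]; exact h1.ne_empty
  · rw [Set.preimage_compl, Set.preimage_compl, h3]
  · have c1 := chainPos_compl (f := f) hw (fun H' g e' => ?_) hp
    have c2 := chainPos_compl (f := f') hw (fun H' g e' => ?_) hq
    rw [h3] at c2
    · change chainPos w f p.1ᶜ (w p.1 - 1 - p.2) = chainPos w f' q.1ᶜ (w q.1 - 1 - q.2)
      omega
    · exact (hnest _ _ g (by omega)).comparable_of_preimage (e'.trans h3 ▸ h1)
        (e'.trans h3 ▸ h2) e'
    · exact (hnest _ _ g (by omega)).comparable_of_preimage (e' ▸ h1) (e' ▸ h2) e'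

open Classical in
lemma CopyRel.exists [Fintype β] {w : Set β → ℕ} {f f' : γ → β}
    (hnest : ∀ H H', w H ≠ 0 → w H' ≠ 0 → SetNested H H')
    {p : Set β × ℕ} (hp : p.2 < w p.1) (h1 : (f ⁻¹' p.1).Nonempty) (h2 : f ⁻¹' p.1 ≠ Set.univ)
    (hb : ∑ H with f ⁻¹' H = f ⁻¹' p.1, w H = ∑ H with f' ⁻¹' H = f ⁻¹' p.1, w H) :
    ∃ q : Set β × ℕ, q.2 < w q.1 ∧ CopyRel w f f' p q := by
  have hlt := chainPos_lt (f := f) hp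
  rw [hb] at hlt
  obtain ⟨H, k, hk, hH, hpos⟩ := exists_chainPos_eq (f := f') (τ := f ⁻¹' p.1)
    (fun H H' h h' e e' => (hnest H H' h h').comparable_of_preimage (f := f') (e ▸ h1) (e ▸ h2)
      (e.trans e'.symm)) hlt
  exact ⟨(H, k), hk, h1, h2, hH, hpos.symm⟩

lemma CopyRel.cast_eq [Fintype β] {δ : Set β → ℕ} {f f' : γ → β} {p q : Set β × ℕ}
    (h : CopyRel (fun H => 2 * δ H) f f' p q) : (p.2 : ZMod 2) = q.2 := by
  have h1 : ∀ (f : γ → β) H k, (chainPos (fun H => 2 * δ H) f H k : ZMod 2) = k := by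
    intro f H k
    rw [chainPos, ← Finset.mul_sum]
    push_cast
    rw [show (2 : ZMod 2) = 0 from rfl]
    simp
  rw [← h1 f p.1 p.2, ← h1 f' q.1 q.2, h.2.2.2]

end CopyRel

section ExistsTrack

variable {ι β K : Type*} [Group K] {x : ι → K} {e : β → K}

/-- The copies of the cuts in the support of a weight. -/
def Copies (w : Set β → ℕ) : Type _ := Σ H : Set β, Fin (w H)

/-- The copy as a pair. -/
def Copies.pair {w : Set β → ℕ} (p : Copies w) : Set β × ℕ := (p.1, p.2)

lemma Copies.pair_injective {w : Set β → ℕ} : Function.Injective (Copies.pair (w := w)) := by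
  rintro ⟨H, k⟩ ⟨H', k'⟩ h
  simp only [Copies.pair, Prod.mk.injEq] at h
  obtain ⟨rfl, h2⟩ := h
  rw [Fin.ext h2]

instance {w : Set β → ℕ} : PartialOrder (Copies w) where
  le p q := CopyLE p.pair q.pair
  le_refl p := Or.inr ⟨rfl, le_rfl⟩
  le_trans _ _ _ h h' := h.trans h'
  le_antisymm _ _ h h' := Copies.pair_injective (h.antisymm h')

lemma Copies.card [Fintype β] (w : Set β → ℕ) : Nat.card (Copies w) = windowVerts w := by
  classical
  rw [Copies, Nat.card_sigma]
  simp [windowVerts]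

instance [Finite β] {w : Set β → ℕ} : Finite (Copies w) :=
  inferInstanceAs (Finite (Σ H : Set β, Fin (w H)))

open Classical in
lemma IsWindowWeight.balance_preimage [Fintype β] {δ : Set β → ℕ} (hδ : IsWindowWeight x e δ)
    (i : ι) {τ : Set (windowPairs x e i)} (h1 : τ.Nonempty) (h2 : τ ≠ Set.univ) :
    ∑ H with (fun d : windowPairs x e i => d.1.1) ⁻¹' H = τ, 2 * δ H =
      ∑ H with (fun d : windowPairs x e i => d.1.2) ⁻¹' H = τ, 2 * δ H := by
  have h := hδ.balance i (Subtype.val '' τ) ⟨h1.image _, fun h => h2 (by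
    rw [Set.eq_univ_iff_forall]
    intro d
    obtain ⟨d', hd', h⟩ := h.ge d.2
    rwa [← Subtype.ext h])⟩
  rw [← Finset.mul_sum, ← Finset.mul_sum]
  have e1 : ∀ H, windowSrc x e i H = Subtype.val '' τ ↔
      (fun d : windowPairs x e i => d.1.1) ⁻¹' H = τ := by
    intro H
    rw [← (Set.image_injective.2 Subtype.val_injective).eq_iff]
    refine Eq.congr (Set.ext fun d => ⟨fun h => ⟨⟨d, h.1⟩, h.2, rfl⟩, ?_⟩) rfl
    rintro ⟨d, hd, rfl⟩
    exact ⟨d.2, hd⟩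
  have e2 : ∀ H, windowTgt x e i H = Subtype.val '' τ ↔
      (fun d : windowPairs x e i => d.1.2) ⁻¹' H = τ := by
    intro H
    rw [← (Set.image_injective.2 Subtype.val_injective).eq_iff]
    refine Eq.congr (Set.ext fun d => ⟨fun h => ⟨⟨d, h.1⟩, h.2, rfl⟩, ?_⟩) rfl
    rintro ⟨d, hd, rfl⟩
    exact ⟨d.2, hd⟩
  simp only [e1, e2] at h
  rw [h]

theorem exists_trackSystem [Fintype ι] [Fintype β] {δ : Set β → ℕ} (hδ : IsWindowWeight x e δ)
    (hδ0 : δ ≠ 0) (hnest : ∀ H H', δ H ≠ 0 → δ H' ≠ 0 → SetNested H H') {b₀ : β} {T : Set β}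
    (hT : ∀ s ∈ T, ∀ H, δ H ≠ 0 → (b₀ ∈ H ↔ s ∈ H))
    (hcard : windowEdges x e δ ≤ windowVerts δ) :
    ∃ τ : TrackSystem x e (Copies fun H => 2 * δ H), Nonempty (Copies fun H => 2 * δ H) ∧
      ∀ s ∈ T, ∀ p, b₀ ∈ τ.side p ↔ s ∈ τ.side p := by
  classical
  have hw : ∀ H, 2 * δ Hᶜ = 2 * δ H := fun H => by rw [hδ.compl]
  have hlt : ∀ p : Copies fun H => 2 * δ H, (p.2 : ℕ) < 2 * δ p.1 := fun p => p.2.2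
  have hpos : ∀ p : Copies fun H => 2 * δ H, δ p.1 ≠ 0 := fun p => by have := hlt p; omega
  have hnest' : ∀ H H', 2 * δ H ≠ 0 → 2 * δ H' ≠ 0 → SetNested H H' := fun H H' h h' =>
    hnest H H' (by omega) (by omega)
  let st : (Copies fun H => 2 * δ H) → (Copies fun H => 2 * δ H) := fun p =>
    ⟨p.1ᶜ, ⟨2 * δ p.1 - 1 - p.2, (by have := hlt p; omega : _ < 2 * δ p.1).trans_eq (hw p.1).symm⟩⟩
  have st_pair : ∀ p, (st p).pair = (p.1ᶜ, 2 * δ p.1 - 1 - p.2) := fun p => rfl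
  have st_st : ∀ p, st (st p) = p := by
    intro p
    apply Copies.pair_injective
    rw [st_pair]
    have := hlt p
    simp only [st, hw, compl_compl, Copies.pair, Prod.mk.injEq, true_and]
    omega
  have st_le : ∀ p q, p ≤ q → st q ≤ st p := by
    intro p q hpq
    rcases (show CopyLE p.pair q.pair from hpq) with h | ⟨h1, h2⟩
    · exact Or.inl (compl_lt_compl_iff_lt.2 h)
    · have h1 : p.1 = q.1 := h1
      have h2 : (p.2 : ℕ) ≤ q.2 := h2
      have h3 : δ p.1 = δ q.1 := congrArg δ h1
      refine Or.inr ⟨congrArg compl h1.symm, ?_⟩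
      change 2 * δ q.1 - 1 - (q.2 : ℕ) ≤ 2 * δ p.1 - 1 - p.2
      omega
  have total : ∀ p q : Copies fun H => 2 * δ H, p.1 ⊆ q.1 → p ≤ q ∨ q ≤ p := by
    intro p q h
    by_cases he : p.1 = q.1
    · rcases le_total (p.2 : ℕ) q.2 with h | h
      · exact Or.inl (Or.inr ⟨he, h⟩)
      · exact Or.inr (Or.inr ⟨he.symm, h⟩)
    · exact Or.inl (Or.inl (h.ssubset_of_ne he))
  let R : ι → (Copies fun H => 2 * δ H) → (Copies fun H => 2 * δ H) → Prop := fun i p q =>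
    CopyRel (fun H => 2 * δ H) (fun d : windowPairs x e i => d.1.1)
      (fun d : windowPairs x e i => d.1.2) p.pair q.pair
  have hne : ∀ p : Copies fun H => 2 * δ H, p.1.Nonempty := fun p => by
    rw [Set.nonempty_iff_ne_empty]
    intro h
    exact hpos p (by rw [h, hδ.empty])
  refine ⟨⟨st, st_st, st_le, ?_, ?_, fun p => p.1, fun p q h => CopyLE.subset h, fun p => rfl, hne,
    R, ?_, ?_, ?_, ?_, ?_, ?_, fun p => ((p.2 : ℕ) : ZMod 2), ?_, ?_, ?_⟩, ?_, ?_⟩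
  · intro p q
    rcases hnest p.1 q.1 (hpos p) (hpos q) with h | h | h | h
    · rcases total p q h with h | h
      · exact Or.inl h
      · exact Or.inr (Or.inr (Or.inr (st_le _ _ h)))
    · rcases total p (st q) h with h | h
      · exact Or.inr (Or.inl h)
      · exact Or.inr (Or.inr (Or.inl (by simpa [st_st] using st_le _ _ h)))
    · rcases total (st p) q h with h | h
      · exact Or.inr (Or.inr (Or.inl h))
      · exact Or.inr (Or.inl (by simpa [st_st] using st_le _ _ h))
    · rcases total (st p) (st q) h with h | h
      · exact Or.inr (Or.inr (Or.inr h))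
      · exact Or.inl (by simpa [st_st] using st_le _ _ h)
  · intro p h
    obtain ⟨b, hb⟩ := hne p
    exact absurd hb (CopyLE.subset h hb)
  · rintro i p q ⟨⟨d, hd⟩, h2, -⟩
    obtain ⟨d', hd'⟩ := (Set.ne_univ_iff_exists_notMem _).1 h2
    exact ⟨d.1, d.2, d'.1, d'.2, hd, hd'⟩
  · rintro i p q ⟨-, -, h, -⟩ d hd
    exact ((Set.ext_iff.1 h) ⟨d, hd⟩).symm
  · intro i p q p' q' h h'
    exact ⟨CopyRel.le hnest' p.2.2 q.2.2 p'.2.2 q'.2.2 h h',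
      CopyRel.le hnest' q.2.2 p.2.2 q'.2.2 p'.2.2 h.symm h'.symm⟩
  · intro i p q h
    have := CopyRel.compl hw hnest' p.2.2 q.2.2 h (hδ.balance_preimage i h.1 h.2.1)
    exact this
  · intro i p d hd d' hd' h h'
    have h1 : ((fun d : windowPairs x e i => d.1.1) ⁻¹' p.pair.1).Nonempty := ⟨⟨d, hd⟩, h⟩
    have h2 : ((fun d : windowPairs x e i => d.1.1) ⁻¹' p.pair.1) ≠ Set.univ :=
      (Set.ne_univ_iff_exists_notMem _).2 ⟨⟨d', hd'⟩, h'⟩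
    obtain ⟨q, hq, hR⟩ := CopyRel.exists hnest' p.2.2 h1 h2 (hδ.balance_preimage i h1 h2)
    exact ⟨⟨q.1, ⟨q.2, hq⟩⟩, hR⟩
  · intro i p d hd d' hd' h h'
    have h1 : ((fun d : windowPairs x e i => d.1.2) ⁻¹' p.pair.1).Nonempty := ⟨⟨d, hd⟩, h⟩
    have h2 : ((fun d : windowPairs x e i => d.1.2) ⁻¹' p.pair.1) ≠ Set.univ :=
      (Set.ne_univ_iff_exists_notMem _).2 ⟨⟨d', hd'⟩, h'⟩
    obtain ⟨q, hq, hR⟩ := CopyRel.exists hnest' p.2.2 h1 h2 (hδ.balance_preimage i h1 h2).symm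
    exact ⟨⟨q.1, ⟨q.2, hq⟩⟩, hR.symm⟩
  · intro p
    have h1 : ((2 * δ p.1 - 1 - p.2 + p.2 + 1 : ℕ) : ZMod 2) = 0 := by
      have := hlt p
      rw [show 2 * δ p.1 - 1 - p.2 + p.2 + 1 = 2 * δ p.1 by omega]
      push_cast
      rw [show (2 : ZMod 2) = 0 from rfl, zero_mul]
    push_cast at h1
    have h2 : ((2 * δ p.1 - 1 - p.2 : ℕ) : ZMod 2) = -(p.2 + 1 : ZMod 2) := by
      linear_combination h1
    change ((2 * δ p.1 - 1 - p.2 : ℕ) : ZMod 2) = _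
    rw [h2, ZMod.neg_eq_self_mod_two]
  · intro i p q h
    exact h.cast_eq
  · have h1 : Nat.card (Copies fun H => 2 * δ H) = 2 * windowVerts δ := by
      rw [Copies.card, windowVerts, windowVerts, Finset.mul_sum]
    let D := Σ i : ι, Σ H : {H : Set β // WindowCuts x e i (windowSrc x e i H)}, Fin (2 * δ H.1)
    have h2 : Nat.card D = 2 * windowEdges x e δ := by
      rw [Nat.card_eq_fintype_card, Fintype.card_sigma]
      simp only [Fintype.card_sigma, Fintype.card_fin]
      rw [windowEdges, Finset.mul_sum]
      refine Finset.sum_congr rfl fun i _ => ?_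
      rw [Finset.mul_sum]
      exact (Finset.sum_subtype _ (by simp) fun H => 2 * δ H).symm
    have hcut : ∀ i (p q : Copies fun H => 2 * δ H), R i p q →
        WindowCuts x e i (windowSrc x e i p.1) := by
      rintro i p q ⟨⟨d, hd⟩, h2, -⟩
      obtain ⟨d', hd'⟩ := (Set.ne_univ_iff_exists_notMem _).1 h2
      exact ⟨⟨d.1, d.2, hd⟩, fun h => hd' (h.ge d'.2).2⟩
    rw [h1]
    refine le_trans ?_ ((h2.trans_le (Nat.mul_le_mul_left 2 hcard)))
    refine Nat.card_le_card_of_injective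
      (fun d => (⟨d.1.1, ⟨d.1.2.1, hcut _ _ _ d.2.choose_spec⟩, d.1.2.2⟩ : D)) ?_
    rintro ⟨⟨i, p⟩, hp⟩ ⟨⟨i', p'⟩, hp'⟩ h
    simp only [Sigma.mk.injEq, D] at h
    obtain ⟨rfl, h⟩ := h
    have h := eq_of_heq h
    simp only [Sigma.mk.injEq, Subtype.mk.injEq] at h
    have : p = p' := Sigma.ext h.1 h.2
    simp [this]
  · obtain ⟨H, hH⟩ := Function.ne_iff.1 hδ0
    exact ⟨⟨H, ⟨0, Nat.mul_pos two_pos (Nat.pos_of_ne_zero hH)⟩⟩⟩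
  · intro s hs p
    exact hT s hs p.1 (hpos p)

end ExistsTrack

section HomCard

/-- The homomorphisms to the group with two elements. -/
abbrev ModTwoHom (G : Type*) [Group G] : Type _ := G →* Multiplicative (ZMod 2)

/-- Homomorphisms on a free group are arbitrary functions on the basis. -/
def FreeGroupBasis.modTwoHomEquiv {ι G : Type*} [Group G] (b : FreeGroupBasis ι G) :
    (ι → Multiplicative (ZMod 2)) ≃ ModTwoHom G :=
  b.lift

lemma FreeGroupBasis.finite_of_finite_modTwoHom {ι G : Type*} [Group G] (b : FreeGroupBasis ι G)
    [Finite (ModTwoHom G)] : Finite ι := by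
  have : Finite (ι → Multiplicative (ZMod 2)) := Finite.of_equiv _ b.modTwoHomEquiv.symm
  by_contra h
  rw [not_finite_iff_infinite] at h
  have hinf : Infinite (ι → Multiplicative (ZMod 2)) := inferInstance
  exact hinf.not_finite this

lemma FreeGroupBasis.card_modTwoHom {ι G : Type*} [Group G] (b : FreeGroupBasis ι G) [Finite ι] :
    Nat.card (ModTwoHom G) = 2 ^ Nat.card ι := by
  rw [← Nat.card_congr b.modTwoHomEquiv, Nat.card_fun]
  simp [Nat.card_eq_fintype_card]

lemma exists_zpowers_eq_top_of_card_le_two {G : Type*} [Group G] [IsFreeGroup G]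
    [Finite (ModTwoHom G)] (h : Nat.card (ModTwoHom G) ≤ 2) :
    ∃ c : G, Subgroup.zpowers c = ⊤ := by
  let b := IsFreeGroup.basis G
  have hfin := b.finite_of_finite_modTwoHom
  rw [b.card_modTwoHom] at h
  have h1 : Nat.card (IsFreeGroup.Generators G) ≤ 1 := by
    by_contra! h2
    have : 2 ^ 2 ≤ 2 ^ Nat.card (IsFreeGroup.Generators G) := Nat.pow_le_pow_right two_pos h2
    omega
  have hs : Subsingleton (IsFreeGroup.Generators G) := Finite.card_le_one_iff_subsingleton.1 h1
  rcases isEmpty_or_nonempty (IsFreeGroup.Generators G) with he | ⟨⟨i⟩⟩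
  · refine ⟨1, (Subgroup.eq_top_iff' _).2 ?_⟩
    refine b.cayley_induction (one_mem _) fun g i => he.elim i
  · refine ⟨b i, (Subgroup.eq_top_iff' _).2 ?_⟩
    refine b.cayley_induction (one_mem _) fun g j => ?_
    rw [Subsingleton.elim j i]
    exact (Subgroup.mul_mem_cancel_right _ (Subgroup.mem_zpowers _)).symm

lemma exists_eq_zpowers_of_card_le_two {G : Type*} [Group G] [IsFreeGroup G] (C : Subgroup G)
    [Finite (ModTwoHom C)] (h : Nat.card (ModTwoHom C) ≤ 2) : ∃ c : G, C = Subgroup.zpowers c := by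
  have : IsFreeGroup C := subgroupIsFreeOfIsFree C
  obtain ⟨c, hc⟩ := exists_zpowers_eq_top_of_card_le_two h
  refine ⟨c, ?_⟩
  have := congrArg (Subgroup.map C.subtype) hc
  rw [MonoidHom.map_zpowers, ← MonoidHom.range_eq_map, Subgroup.range_subtype] at this
  exact this.symm

end HomCard

section Leaf

variable {ι K O : Type*} [Group K] (x : ι → K) (rel : ι → O → O → Prop)

/-- The elementary moves along a leaf. -/
def LeafStep (a b : K × O) : Prop := ∃ i g p q, rel i p q ∧ a = (g * x i, p) ∧ b = (g, q)

/-- Two points lie on the same leaf. -/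
def SameLeaf : K × O → K × O → Prop := Relation.EqvGen (LeafStep x rel)

variable {x rel}

lemma SameLeaf.refl (a : K × O) : SameLeaf x rel a a := Relation.EqvGen.refl _
lemma SameLeaf.symm {a b : K × O} (h : SameLeaf x rel a b) : SameLeaf x rel b a :=
  Relation.EqvGen.symm _ _ h
lemma SameLeaf.trans {a b c : K × O} (h : SameLeaf x rel a b) (h' : SameLeaf x rel b c) :
    SameLeaf x rel a c := Relation.EqvGen.trans _ _ _ h h'

lemma SameLeaf.of_rel {i : ι} {p q : O} (h : rel i p q) (g : K) :
    SameLeaf x rel (g * x i, p) (g, q) :=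
  Relation.EqvGen.rel _ _ ⟨i, g, p, q, h, rfl, rfl⟩

lemma SameLeaf.induction {P : K × O → K × O → Prop} (hr : ∀ a, P a a)
    (hs : ∀ a b, P a b → P b a) (ht : ∀ a b c, P a b → P b c → P a c)
    (h1 : ∀ i g p q, rel i p q → P (g * x i, p) (g, q)) {a b : K × O} (h : SameLeaf x rel a b) :
    P a b := by
  induction h with
  | rel a b h =>
    obtain ⟨i, g, p, q, h, rfl, rfl⟩ := h
    exact h1 i g p q h
  | refl a => exact hr a
  | symm a b _ ih => exact hs a b ih
  | trans a b c _ _ ih ih' => exact ht a b c ih ih'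

lemma SameLeaf.smul {a b : K × O} (h : SameLeaf x rel a b) (k : K) :
    SameLeaf x rel (k * a.1, a.2) (k * b.1, b.2) := by
  refine SameLeaf.induction (P := fun a b => SameLeaf x rel (k * a.1, a.2) (k * b.1, b.2))
    (fun a => .refl _) (fun a b h => h.symm) (fun a b c h h' => h.trans h') ?_ h
  intro i g p q h
  rw [← mul_assoc]
  exact .of_rel h (k * g)

/-- A map that follows the partial maps on every generator is injective on sheets. -/
lemma SameLeaf.eq_of_fst_eq [Finite O] (b : FreeGroupBasis ι K)
    (hfun : ∀ i p q q', rel i p q → rel i p q' → q = q')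
    (hinj : ∀ i p p' q, rel i p q → rel i p' q → p = p') {g : K} {p q : O}
    (h : SameLeaf b rel (g, p) (g, q)) : p = q := by
  classical
  have hπ : ∀ i, ∃ π : Equiv.Perm O, ∀ p q, rel i p q → π p = q := by
    intro i
    let f : {p // ∃ q, rel i p q} ≃ {q // ∃ p, rel i p q} :=
      { toFun := fun p => ⟨p.2.choose, p.1, p.2.choose_spec⟩
        invFun := fun q => ⟨q.2.choose, q.1, q.2.choose_spec⟩
        left_inv := fun p => Subtype.ext (hinj i _ _ _ (Exists.choose_spec
          (⟨p.1, p.2.choose_spec⟩ : ∃ p', rel i p' p.2.choose)) p.2.choose_spec)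
        right_inv := fun q => Subtype.ext (hfun i _ _ _ (Exists.choose_spec
          (⟨q.1, q.2.choose_spec⟩ : ∃ q', rel i q.2.choose q')) q.2.choose_spec) }
    have := Fintype.ofFinite O
    refine ⟨f.extendSubtype, fun p q h => ?_⟩
    rw [f.extendSubtype_apply_of_mem p ⟨q, h⟩]
    exact hfun i _ _ _ (Exists.choose_spec (⟨q, h⟩ : ∃ q, rel i p q)) h
  choose π hπ using hπ
  let ρ : K →* Equiv.Perm O := b.lift π
  have key : ρ g p = ρ g q := by
    refine SameLeaf.induction (P := fun a b => ρ a.1 a.2 = ρ b.1 b.2) (fun _ => rfl)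
      (fun _ _ h => h.symm) (fun _ _ _ h h' => h.trans h') ?_ h
    intro i g p q h
    have : ρ (b i) = π i := by simp [ρ]
    simp only [map_mul, Equiv.Perm.mul_apply, this, hπ i p q h]
  exact (ρ g).injective key

variable (x rel) in
/-- The stabilizer of a leaf. -/
def leafStab (p : O) : Subgroup K where
  carrier := {g | SameLeaf x rel (g, p) (1, p)}
  one_mem' := .refl _
  mul_mem' {a b} ha hb := by
    have := hb.smul a
    simp only [mul_one] at this
    exact this.trans ha
  inv_mem' {a} ha := by
    have := ha.smul a⁻¹
    simp only [mul_one, inv_mul_cancel] at this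
    exact this.symm

/-- Two walls lie in the same component. -/
def SameComp (x : ι → K) (rel : ι → O → O → Prop) (p q : O) : Prop :=
  ∃ g, SameLeaf x rel (g, p) (1, q)

lemma SameComp.refl (p : O) : SameComp x rel p p := ⟨1, .refl _⟩

lemma SameComp.symm {p q : O} (h : SameComp x rel p q) : SameComp x rel q p := by
  obtain ⟨g, h⟩ := h
  have := (h.smul g⁻¹).symm
  exact ⟨_, by simpa using this⟩

lemma SameComp.trans {p q r : O} (h : SameComp x rel p q) (h' : SameComp x rel q r) :
    SameComp x rel p r := by
  obtain ⟨g, h⟩ := h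
  obtain ⟨g', h'⟩ := h'
  have := h.smul g'
  simp only [mul_one] at this
  exact ⟨_, this.trans h'⟩

lemma SameComp.of_rel {i : ι} {p q : O} (h : rel i p q) : SameComp x rel p q :=
  ⟨1 * x i, .of_rel h 1⟩

/-- Some component has at most as many edges as vertices. -/
lemma exists_comp_card_le [Finite ι] [Finite O] [Nonempty O]
    (hcard : Nat.card {d : ι × O // ∃ q, rel d.1 d.2 q} ≤ Nat.card O) :
    ∃ p₀, Nat.card {d : ι × O // SameComp x rel d.2 p₀ ∧ ∃ q, rel d.1 d.2 q} ≤
      Nat.card {p // SameComp x rel p p₀} := by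
  classical
  have := Fintype.ofFinite O
  have := Fintype.ofFinite ι
  let s : Setoid O := ⟨SameComp x rel, SameComp.refl, SameComp.symm, SameComp.trans⟩
  have h1 : Nat.card O = ∑ c : Quotient s, Nat.card {p // Quotient.mk s p = c} := by
    rw [← Nat.card_sigma, Nat.card_congr (Equiv.sigmaFiberEquiv (Quotient.mk s))]
  have h2 : Nat.card {d : ι × O // ∃ q, rel d.1 d.2 q} =
      ∑ c : Quotient s, Nat.card {d : {d : ι × O // ∃ q, rel d.1 d.2 q} //
        Quotient.mk s d.1.2 = c} := by
    rw [← Nat.card_sigma, Nat.card_congr (Equiv.sigmaFiberEquiv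
      (fun d : {d : ι × O // ∃ q, rel d.1 d.2 q} => Quotient.mk s d.1.2))]
  rw [h1, h2] at hcard
  obtain ⟨c, -, hc⟩ := Finset.exists_le_of_sum_le
    (⟨Quotient.mk s (Classical.arbitrary O), Finset.mem_univ _⟩) hcard
  obtain ⟨p₀, rfl⟩ := Quotient.exists_rep c
  refine ⟨p₀, le_trans (le_of_eq ?_) (hc.trans (le_of_eq ?_))⟩
  · refine Nat.card_congr
      { toFun := fun d => ⟨⟨d.1, d.2.2⟩, Quotient.sound d.2.1⟩
        invFun := fun d => ⟨d.1.1, Quotient.exact d.2, d.1.2⟩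
        left_inv := fun d => rfl
        right_inv := fun d => rfl }
  · exact Nat.card_congr (Equiv.subtypeEquivRight fun p => Quotient.eq)

/-- A leaf in a component with at most as many edges as vertices has a cyclic stabilizer. -/
lemma exists_leafStab_eq_zpowers [IsFreeGroup K] [Finite ι] [Finite O]
    (hfun : ∀ i p q q', rel i p q → rel i p q' → q = q') {p₀ : O}
    (hcard : Nat.card {d : ι × O // SameComp x rel d.2 p₀ ∧ ∃ q, rel d.1 d.2 q} ≤
      Nat.card {p // SameComp x rel p p₀}) : ∃ c, leafStab x rel p₀ = Subgroup.zpowers c := by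
  classical
  let V := {p // SameComp x rel p p₀}
  let E := {d : ι × O // SameComp x rel d.2 p₀ ∧ ∃ q, rel d.1 d.2 q}
  let C := leafStab x rel p₀
  have hg : ∀ p : V, ∃ g, SameLeaf x rel (g, p.1) (1, p₀) := fun p => p.2
  choose γ hγ using hg
  have memC : ∀ (g : K) (p : V), SameLeaf x rel (g, p.1) (1, p₀) → g * (γ p)⁻¹ ∈ C := by
    intro g p h
    have := (hγ p).smul (g * (γ p)⁻¹)
    simp only [inv_mul_cancel_right, mul_one] at this
    exact this.symm.trans h
  let X : ModTwoHom C → K → ZMod 2 := fun χ g => if h : g ∈ C then (χ ⟨g, h⟩).toAdd else 0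
  have X_mul : ∀ χ, ∀ a ∈ C, ∀ b ∈ C, X χ (a * b) = X χ a + X χ b := by
    intro χ a ha b hb
    simp only [X, ha, hb, mul_mem ha hb, dif_pos]
    rw [← toAdd_mul, ← map_mul]
    rfl
  let tgt : E → V := fun d => ⟨d.2.2.choose, (SameComp.of_rel d.2.2.choose_spec).symm.trans d.2.1⟩
  have htgt : ∀ d : E, rel d.1.1 d.1.2 (tgt d).1 := fun d => d.2.2.choose_spec
  let src : E → V := fun d => ⟨d.1.2, d.2.1⟩
  let v₀ : V := ⟨p₀, .refl _⟩
  have hedge : ∀ d : E, γ (tgt d) * x d.1.1 * (γ (src d))⁻¹ ∈ C := fun d =>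
    memC _ (src d) ((SameLeaf.of_rel (htgt d) _).trans (hγ _))
  let Θ : ModTwoHom C × (V → ZMod 2) → (E → ZMod 2) × ZMod 2 := fun a =>
    (fun d => X a.1 (γ (tgt d) * x d.1.1 * (γ (src d))⁻¹) + a.2 (src d) + a.2 (tgt d), a.2 v₀)
  have hΘ : Function.Injective Θ := by
    rintro ⟨χ, s⟩ ⟨χ', s'⟩ h
    obtain ⟨h, h₀⟩ := Prod.ext_iff.1 h
    have h := congrFun h
    simp only [Θ] at h h₀
    let Y : K → ZMod 2 := fun g => X χ g - X χ' g
    have Y_mul : ∀ a ∈ C, ∀ b ∈ C, Y (a * b) = Y a + Y b := by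
      intro a ha b hb
      simp only [Y, X_mul _ a ha b hb]
      ring
    have Y_one : Y 1 = 0 := by simpa using Y_mul 1 (one_mem _) 1 (one_mem _)
    let t : V → ZMod 2 := fun p => s p - s' p
    have ht : ∀ d, Y (γ (tgt d) * x d.1.1 * (γ (src d))⁻¹) + t (src d) + t (tgt d) = 0 := by
      intro d
      simp only [Y, t]
      linear_combination h d
    let ψ : K × O → ZMod 2 := fun a => if h : SameComp x rel a.2 p₀ then
      Y (a.1 * (γ ⟨a.2, h⟩)⁻¹) + t ⟨a.2, h⟩ else 0
    have hψ : ∀ g (p : V), ψ (g, p.1) = Y (g * (γ p)⁻¹) + t p := fun g p => dif_pos p.2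
    have key : ∀ a, SameLeaf x rel a (1, p₀) → ψ a = ψ (1, p₀) := by
      intro a ha
      refine (SameLeaf.induction (P := fun a b => SameLeaf x rel a b ∧
        (SameLeaf x rel a (1, p₀) → ψ a = ψ b)) (fun a => ⟨.refl _, fun _ => rfl⟩) ?_ ?_ ?_ ha).2 ha
      · rintro a b ⟨h, h'⟩
        exact ⟨h.symm, fun hb => (h' (h.trans hb)).symm⟩
      · rintro a b c ⟨h1, h1'⟩ ⟨h2, h2'⟩
        exact ⟨h1.trans h2, fun ha => (h1' ha).trans (h2' (h1.symm.trans ha))⟩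
      · intro i g p q hpq
        refine ⟨.of_rel hpq g, fun ha => ?_⟩
        have hb := (SameLeaf.of_rel hpq g).symm.trans ha
        have hp : SameComp x rel p p₀ := ⟨_, ha⟩
        let d : E := ⟨(i, p), hp, q, hpq⟩
        have hq : tgt d = ⟨q, _, hb⟩ := Subtype.ext (hfun i p _ _ (htgt d) hpq)
        have e1 := hψ (g * x i) (src d)
        have e2 := hψ g (tgt d)
        have e3 := ht d
        have e4 := Y_mul _ (memC g (tgt d) (by rw [hq]; exact hb)) _ (hedge d)
        have e0 : g * (γ (tgt d))⁻¹ * (γ (tgt d) * x d.1.1 * (γ (src d))⁻¹) =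
            g * x i * (γ (src d))⁻¹ := by simp [d, mul_assoc]
        rw [e0] at e4
        have e5 : ψ (g * x i, p) = ψ (g, (tgt d).1) := by
          rw [e2]
          refine e1.trans ?_
          rw [e4]
          have : t (tgt d) + t (tgt d) = 0 := CharTwo.add_self_eq_zero _
          linear_combination e3 - this
        rw [e5, hq]
    have hv₀ : γ v₀ ∈ C := hγ v₀
    have hY : ∀ g ∈ C, Y g = 0 := by
      intro g hg
      have := key (g, p₀) hg
      rw [hψ g v₀, hψ 1 v₀, Y_mul _ hg _ (inv_mem hv₀), one_mul] at this
      linear_combination this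
    have e1 : χ = χ' := by
      ext g
      have := hY g g.2
      simp only [Y, X, g.2, dif_pos, sub_eq_zero] at this
      exact this
    have e2 : s = s' := by
      funext p
      have := key (γ p, p.1) (hγ p)
      rw [hψ, hψ 1 v₀, mul_inv_cancel, Y_one, one_mul, hY _ (inv_mem hv₀)] at this
      simp only [t] at this
      linear_combination this + h₀
    rw [e1, e2]
  have hfin : Finite (ModTwoHom C × (V → ZMod 2)) := Finite.of_injective Θ hΘ
  have hfin' : Finite (ModTwoHom C) := Finite.of_injective
    (fun χ : ModTwoHom C => (χ, (0 : V → ZMod 2))) fun a b h => (Prod.ext_iff.1 h).1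
  have hle := Nat.card_le_card_of_injective Θ hΘ
  rw [Nat.card_prod, Nat.card_prod, Nat.card_fun, Nat.card_fun, Nat.card_zmod] at hle
  refine exists_eq_zpowers_of_card_le_two C ?_
  have h2 : 2 ^ Nat.card E ≤ 2 ^ Nat.card V := Nat.pow_le_pow_right two_pos hcard
  have h3 : 0 < 2 ^ Nat.card V := by positivity
  nlinarith

end Leaf

section Nodes

variable {ι β K O : Type*} [Group K] [PartialOrder O] {x : ι → K} {e : β → K}

namespace TrackSystem

variable (τ : TrackSystem x e O)

lemma rel_right_unique (i : ι) (p q q' : O) (h : τ.rel i p q) (h' : τ.rel i p q') : q = q' :=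
  le_antisymm ((τ.rel_le i p q p q' h h').1 le_rfl) ((τ.rel_le i p q' p q h' h).1 le_rfl)

lemma rel_left_unique (i : ι) (p p' q : O) (h : τ.rel i p q) (h' : τ.rel i p' q) : p = p' :=
  le_antisymm ((τ.rel_le i p q p' q h h').2 le_rfl) ((τ.rel_le i p' q p q h' h).2 le_rfl)

lemma le_star_iff {p q : O} : p ≤ τ.star q ↔ q ≤ τ.star p :=
  ⟨fun h => by simpa [τ.star_star] using τ.star_le _ _ h,
    fun h => by simpa [τ.star_star] using τ.star_le _ _ h⟩

lemma star_le_star_iff {p q : O} : τ.star p ≤ τ.star q ↔ q ≤ p := by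
  rw [le_star_iff, τ.star_star]

lemma star_lt_star_iff {p q : O} : τ.star p < τ.star q ↔ q < p := by
  rw [lt_iff_le_not_ge, lt_iff_le_not_ge, star_le_star_iff, star_le_star_iff]

/-- A node, that is a point of the window or the head of a wall, lies on the side `q`. -/
def Mem : β ⊕ O → O → Prop
  | .inl b, q => b ∈ τ.side q
  | .inr p, q => p ≤ q ∨ τ.star p < q

variable {τ}

lemma Mem.mono {n : β ⊕ O} {q q' : O} (h : τ.Mem n q) (hq : q ≤ q') : τ.Mem n q' := by
  rcases n with b | p
  · exact τ.side_mono _ _ hq h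
  · rcases h with h | h
    · exact Or.inl (h.trans hq)
    · exact Or.inr (h.trans_le hq)

lemma mem_star {n : β ⊕ O} {q : O} : τ.Mem n (τ.star q) ↔ ¬ τ.Mem n q := by
  rcases n with b | p
  · simp [Mem, τ.side_star]
  · simp only [Mem]
    rw [star_lt_star_iff, not_or]
    have hp : ¬ τ.star p ≤ p := by
      have := τ.not_le_star (τ.star p)
      rwa [τ.star_star] at this
    constructor
    · rintro (h | h)
      · refine ⟨fun h' => τ.not_le_star p (h'.trans (τ.le_star_iff.1 h)), fun h' => ?_⟩
        exact (h'.trans_le (τ.le_star_iff.1 h)).false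
      · exact ⟨fun h' => (h.trans_le h').false, fun h' => hp (h'.trans h).le⟩
    · rintro ⟨h1, h2⟩
      rcases τ.nested p q with h | h | h | h
      · exact absurd h h1
      · exact Or.inl h
      · have : τ.star p = q := by
          by_contra hne
          exact h2 (lt_of_le_of_ne h hne)
        rw [← this, τ.star_star]
        exact Or.inl le_rfl
      · refine Or.inr (lt_of_le_of_ne (τ.star_le_star_iff.1 h) ?_)
        rintro rfl
        exact h1 le_rfl

lemma mem_head_self (q : O) : τ.Mem (.inr q) q := Or.inl le_rfl

lemma mem_head_star_iff {p q : O} (h : q ≠ p) (h' : q ≠ τ.star p) :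
    τ.Mem (.inr (τ.star p)) q ↔ τ.Mem (.inr p) q := by
  simp only [Mem, τ.star_star]
  rw [le_iff_lt_or_eq, le_iff_lt_or_eq]
  constructor
  · rintro ((h1 | h1) | h1)
    · exact Or.inr h1
    · exact absurd h1.symm h'
    · exact Or.inl (Or.inl h1)
  · rintro ((h1 | h1) | h1)
    · exact Or.inr h1
    · exact absurd h1.symm h
    · exact Or.inl (Or.inl h1)

variable (τ) in
/-- The nodes `n` and `n'` correspond under the partial translation by `x i`. -/
def Match (i : ι) : β ⊕ O → β ⊕ O → Prop
  | .inl b, .inl b' => (b, b') ∈ windowPairs x e i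
  | .inr p, .inr q => τ.rel i p q
  | _, _ => False

lemma Match.mem_iff {i : ι} {n n' : β ⊕ O} (h : τ.Match i n n') {p q : O} (hpq : τ.rel i p q) :
    τ.Mem n p ↔ τ.Mem n' q := by
  rcases n with b | r <;> rcases n' with b' | r'
  · exact τ.rel_pairs i p q hpq _ h
  · exact h.elim
  · exact h.elim
  · have h1 := τ.rel_le i _ _ _ _ h hpq
    have h2 := τ.rel_le i _ _ _ _ (τ.rel_star i _ _ h) hpq
    have h3 := τ.rel_le i _ _ _ _ hpq (τ.rel_star i _ _ h)
    simp only [Mem, lt_iff_le_not_ge, h1, h2, h3]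

lemma mem_head_of_subset_side {S : Set β} {q r : O} (hS : S ⊆ τ.side q) {a a' : β} (ha : a ∈ S)
    (ha' : a' ∈ S) (har : a ∈ τ.side r) (har' : a' ∉ τ.side r) (hr : τ.star r ≠ q) :
    τ.Mem (.inr r) q := by
  rcases τ.nested r q with h | h | h | h
  · exact Or.inl h
  · have := τ.side_mono _ _ h har
    rw [τ.side_star] at this
    exact absurd (hS ha) this
  · exact Or.inr (lt_of_le_of_ne h hr)
  · have := τ.side_mono _ _ h (by rw [τ.side_star]; exact har')
    rw [τ.side_star] at this
    exact absurd (hS ha') this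

lemma mem_head_iff_of_const {S : Set β} {q r : O} (hS : ∀ a ∈ S, ∀ a' ∈ S,
    a ∈ τ.side q → a' ∈ τ.side q) {a a' : β} (ha : a ∈ S)
    (ha' : a' ∈ S) (har : a ∈ τ.side r) (har' : a' ∉ τ.side r) (hr : τ.star r ≠ q) (hr' : r ≠ q)
    {b : β} (hb : b ∈ S) : τ.Mem (.inr r) q ↔ b ∈ τ.side q := by
  by_cases hbq : b ∈ τ.side q
  · exact iff_of_true
      (mem_head_of_subset_side (fun a ha => hS b hb a ha hbq) ha ha' har har' hr) hbq
  · refine iff_of_false ?_ hbq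
    rw [← mem_star]
    refine mem_head_of_subset_side (S := S) (fun c hc => ?_) ha ha' har har' ?_
    · rw [τ.side_star]
      exact fun h => hbq (hS c hc b hb h)
    · intro h
      apply hr'
      rw [← τ.star_star r, h, τ.star_star]

lemma Match.mem_src_iff {i : ι} {n n' : β ⊕ O} (h : τ.Match i n n') {p : O}
    (hp : ¬ ∃ q, τ.rel i p q) {d : β × β} (hd : d ∈ windowPairs x e i) :
    τ.Mem n p ↔ d.1 ∈ τ.side p := by
  have hS : ∀ a ∈ Prod.fst '' windowPairs x e i, ∀ a' ∈ Prod.fst '' windowPairs x e i,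
      a ∈ τ.side p → a' ∈ τ.side p := by
    rintro _ ⟨d, hd, rfl⟩ _ ⟨d', hd', rfl⟩ h
    by_contra h'
    exact hp (τ.exists_rel_src i p d hd d' hd' h h')
  rcases n with b | r <;> rcases n' with b' | r'
  · exact ⟨hS _ ⟨_, h, rfl⟩ _ ⟨_, hd, rfl⟩, hS _ ⟨_, hd, rfl⟩ _ ⟨_, h, rfl⟩⟩
  · exact h.elim
  · exact h.elim
  · obtain ⟨d1, h1, d2, h2, h3, h4⟩ := τ.rel_src i r r' h
    refine mem_head_iff_of_const hS ⟨_, h1, rfl⟩ ⟨_, h2, rfl⟩ h3 h4 ?_ ?_ ⟨_, hd, rfl⟩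
    · rintro rfl
      exact hp ⟨_, τ.rel_star i r r' h⟩
    · rintro rfl
      exact hp ⟨_, h⟩

lemma Match.mem_tgt_iff {i : ι} {n n' : β ⊕ O} (h : τ.Match i n n') {q : O}
    (hq : ¬ ∃ p, τ.rel i p q) {d : β × β} (hd : d ∈ windowPairs x e i) :
    τ.Mem n' q ↔ d.2 ∈ τ.side q := by
  have hS : ∀ a ∈ Prod.snd '' windowPairs x e i, ∀ a' ∈ Prod.snd '' windowPairs x e i,
      a ∈ τ.side q → a' ∈ τ.side q := by
    rintro _ ⟨d, hd, rfl⟩ _ ⟨d', hd', rfl⟩ h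
    by_contra h'
    exact hq (τ.exists_rel_tgt i q d hd d' hd' h h')
  rcases n with b | r <;> rcases n' with b' | r'
  · exact ⟨hS _ ⟨_, h, rfl⟩ _ ⟨_, hd, rfl⟩, hS _ ⟨_, hd, rfl⟩ _ ⟨_, h, rfl⟩⟩
  · exact h.elim
  · exact h.elim
  · obtain ⟨d1, h1, d2, h2, h3, h4⟩ := τ.rel_src i r r' h
    rw [τ.rel_pairs i r r' h d1 h1] at h3
    rw [τ.rel_pairs i r r' h d2 h2] at h4
    refine mem_head_iff_of_const hS ⟨_, h1, rfl⟩ ⟨_, h2, rfl⟩ h3 h4 ?_ ?_ ⟨_, hd, rfl⟩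
    · rintro rfl
      exact hq ⟨_, τ.rel_star i r r' h⟩
    · rintro rfl
      exact hq ⟨_, h⟩

lemma sameLeaf_star {a b : K × O} (h : SameLeaf x τ.rel a b) :
    SameLeaf x τ.rel (a.1, τ.star a.2) (b.1, τ.star b.2) := by
  refine SameLeaf.induction
    (P := fun a b => SameLeaf x τ.rel (a.1, τ.star a.2) (b.1, τ.star b.2))
    (fun a => .refl _) (fun a b h => h.symm) (fun a b c h h' => h.trans h') ?_ h
  intro i g p q h
  exact .of_rel (τ.rel_star i p q h) g

lemma sign_eq_of_sameLeaf {a b : K × O} (h : SameLeaf x τ.rel a b) :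
    τ.sign a.2 = τ.sign b.2 :=
  SameLeaf.induction (P := fun a b => τ.sign a.2 = τ.sign b.2)
    (fun _ => rfl) (fun _ _ h => h.symm) (fun _ _ _ h h' => h.trans h')
    (fun i _ p q h => τ.sign_rel i p q h) h

lemma not_sameLeaf_star {g g' : K} {p : O} : ¬ SameLeaf x τ.rel (g, τ.star p) (g', p) := by
  intro h
  have := sign_eq_of_sameLeaf h
  simp only [τ.sign_star] at this
  exact one_ne_zero (add_eq_left.1 this)

end TrackSystem

end Nodes

section NodeSpace

variable {ι β K O : Type*} [Group K] [PartialOrder O] {x : ι → K} {e : β → K}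

namespace TrackSystem

variable (τ : TrackSystem x e O) (p₀ : O)

/-- The wall `q` or its opposite is in the component of `p₀`. -/
def InComp (q : O) : Prop := SameComp x τ.rel q p₀ ∨ SameComp x τ.rel (τ.star q) p₀

/-- Elementary identifications between nodes of different sheets: nodes of the same sheet which
are not separated by the component of `p₀`, and nodes which match under a generator. -/
def NodeStep (a b : K × (β ⊕ O)) : Prop :=
  (a.1 = b.1 ∧ ∀ q, τ.InComp p₀ q → (τ.Mem a.2 q ↔ τ.Mem b.2 q)) ∨
    ∃ i, a.1 = b.1 * x i ∧ τ.Match i a.2 b.2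

/-- The vertices of the tree dual to the component of `p₀`. -/
def NodeSpace : Type _ := Quot (τ.NodeStep p₀)

variable {τ p₀}

/-- The vertex given by a node of a sheet. -/
def nodeMk (τ : TrackSystem x e O) (p₀ : O) (g : K) (n : β ⊕ O) : τ.NodeSpace p₀ := Quot.mk _ (g, n)

lemma nodeMk_congr {g : K} {n n' : β ⊕ O} (h : ∀ q, τ.InComp p₀ q → (τ.Mem n q ↔ τ.Mem n' q)) :
    nodeMk τ p₀ g n = nodeMk τ p₀ g n' := Quot.sound (Or.inl ⟨rfl, h⟩)

lemma nodeMk_match {i : ι} {n n' : β ⊕ O} (h : τ.Match i n n') (g : K) :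
    nodeMk τ p₀ (g * x i) n = nodeMk τ p₀ g n' := Quot.sound (Or.inr ⟨i, rfl, h⟩)

/-- Left multiplication. -/
def nodeSMul (k : K) : τ.NodeSpace p₀ → τ.NodeSpace p₀ :=
  Quot.map (fun a => (k * a.1, a.2)) (by
    rintro ⟨g, n⟩ ⟨g', n'⟩ (⟨h, h'⟩ | ⟨i, h, h'⟩)
    · exact Or.inl ⟨by simpa using h, h'⟩
    · exact Or.inr ⟨i, by simpa [mul_assoc] using h, h'⟩)

@[simp] lemma nodeSMul_mk (k g : K) (n : β ⊕ O) :
    nodeSMul k (nodeMk τ p₀ g n) = nodeMk τ p₀ (k * g) n := rfl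

lemma exists_nodeMk (ω : τ.NodeSpace p₀) : ∃ g n, ω = nodeMk τ p₀ g n := by
  induction ω using Quot.ind with
  | mk a => exact ⟨a.1, a.2, rfl⟩

lemma nodeMk_of_sameLeaf {a b : K × O} (h : SameLeaf x τ.rel a b) :
    nodeMk τ p₀ a.1 (.inr a.2) = nodeMk τ p₀ b.1 (.inr b.2) :=
  SameLeaf.induction (P := fun a b => nodeMk τ p₀ a.1 (.inr a.2) = nodeMk τ p₀ b.1 (.inr b.2))
    (fun _ => rfl) (fun _ _ h => h.symm) (fun _ _ _ h h' => h.trans h')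
    (fun _ g p q h => nodeMk_match (n := .inr p) (n' := .inr q) h g) h

/-! ### The colouring -/

variable (τ p₀) in
open Classical in
/-- Whether the node is on the positive side of the lift of `p₀` in its sheet. -/
noncomputable def nodeSign (g : K) (n : β ⊕ O) : ZMod 2 :=
  if ∃ q, SameLeaf x τ.rel (g, q) (1, p₀) ∧ τ.Mem n q then 1 else 0

lemma nodeSign_congr {g g' : K} {n n' : β ⊕ O}
    (h : (∃ q, SameLeaf x τ.rel (g, q) (1, p₀) ∧ τ.Mem n q) ↔
      ∃ q, SameLeaf x τ.rel (g', q) (1, p₀) ∧ τ.Mem n' q) :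
    nodeSign τ p₀ g n = nodeSign τ p₀ g' n' := by
  unfold nodeSign
  split_ifs with h1 h2 h2
  · rfl
  · exact absurd (h.1 h1) h2
  · exact absurd (h.2 h2) h1
  · rfl

lemma inComp_of_sameLeaf {g : K} {q : O} (h : SameLeaf x τ.rel (g, q) (1, p₀)) :
    τ.InComp p₀ q := Or.inl ⟨g, h⟩

lemma nodeSign_congr_of_inComp {g : K} {n n' : β ⊕ O}
    (h : ∀ q, τ.InComp p₀ q → (τ.Mem n q ↔ τ.Mem n' q)) :
    nodeSign τ p₀ g n = nodeSign τ p₀ g n' :=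
  nodeSign_congr (exists_congr fun q => and_congr_right fun hq => h q (inComp_of_sameLeaf hq))

end TrackSystem

end NodeSpace

section Colour

variable {ι β K O : Type*} [Group K] [PartialOrder O] {x : FreeGroupBasis ι K} {e : β → K}

namespace TrackSystem

variable {τ : TrackSystem x e O} {p₀ : O}

lemma sameLeaf_unique [Finite O] {g : K} {q q' : O} (h : SameLeaf x τ.rel (g, q) (1, p₀))
    (h' : SameLeaf x τ.rel (g, q') (1, p₀)) : q = q' :=
  SameLeaf.eq_of_fst_eq x τ.rel_right_unique τ.rel_left_unique (h.trans h'.symm)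

lemma exists_mem_iff [Finite O] {g : K} {q : O} (h : SameLeaf x τ.rel (g, q) (1, p₀))
    {n : β ⊕ O} : (∃ q, SameLeaf x τ.rel (g, q) (1, p₀) ∧ τ.Mem n q) ↔ τ.Mem n q :=
  ⟨fun ⟨_, h1, h2⟩ => sameLeaf_unique h1 h ▸ h2, fun h' => ⟨q, h, h'⟩⟩

lemma nodeSign_match [Finite O] {i : ι} {n₁ n₁' n₂ n₂' : β ⊕ O} (h₁ : τ.Match i n₁ n₁')
    (h₂ : τ.Match i n₂ n₂') {d : β × β} (hd : d ∈ windowPairs x e i) (g : K) :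
    nodeSign τ p₀ (g * x i) n₁ + nodeSign τ p₀ (g * x i) n₂ =
      nodeSign τ p₀ g n₁' + nodeSign τ p₀ g n₂' := by
  by_cases hpq : ∃ p q, τ.rel i p q ∧ SameLeaf x τ.rel (g * x i, p) (1, p₀)
  · obtain ⟨p, q, hpq, hp⟩ := hpq
    have hq : SameLeaf x τ.rel (g, q) (1, p₀) := (SameLeaf.of_rel hpq g).symm.trans hp
    congr 1 <;> refine nodeSign_congr ?_
    · rw [exists_mem_iff hp, exists_mem_iff hq, h₁.mem_iff hpq]
    · rw [exists_mem_iff hp, exists_mem_iff hq, h₂.mem_iff hpq]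
  · have e1 : nodeSign τ p₀ (g * x i) n₁ = nodeSign τ p₀ (g * x i) n₂ := by
      refine nodeSign_congr (exists_congr fun p => and_congr_right fun hp => ?_)
      have hp' : ¬ ∃ q, τ.rel i p q := fun ⟨q, hq⟩ => hpq ⟨p, q, hq, hp⟩
      rw [h₁.mem_src_iff hp' hd, h₂.mem_src_iff hp' hd]
    have e2 : nodeSign τ p₀ g n₁' = nodeSign τ p₀ g n₂' := by
      refine nodeSign_congr (exists_congr fun q => and_congr_right fun hq => ?_)
      have hq' : ¬ ∃ p, τ.rel i p q :=
        fun ⟨p, hp⟩ => hpq ⟨p, q, hp, (SameLeaf.of_rel hp g).trans hq⟩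
      rw [h₁.mem_tgt_iff hq' hd, h₂.mem_tgt_iff hq' hd]
    rw [e1, e2, CharTwo.add_self_eq_zero, CharTwo.add_self_eq_zero]

/-- There is a `ZMod 2` valued function on the vertices whose differences on each sheet are
given by the sides of the lift of `p₀`. -/
lemma exists_colour [Finite O] (τ : TrackSystem x e O) (p₀ : O) (b₀ : β) (ξ : ι → β)
    (hξ : ∀ i, (b₀, ξ i) ∈ windowPairs x e i) :
    ∃ col : τ.NodeSpace p₀ → ZMod 2, ∀ g n n', col (nodeMk τ p₀ g n) + col (nodeMk τ p₀ g n') =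
      nodeSign τ p₀ g n + nodeSign τ p₀ g n' := by
  obtain ⟨c, -, hc⟩ := x.exists_cocycle
    (fun i g => nodeSign τ p₀ g (.inl b₀) + nodeSign τ p₀ g (.inl (ξ i)))
  have key : ∀ a b, τ.NodeStep p₀ a b → c a.1 + nodeSign τ p₀ a.1 (.inl b₀) + nodeSign τ p₀ a.1 a.2
      = c b.1 + nodeSign τ p₀ b.1 (.inl b₀) + nodeSign τ p₀ b.1 b.2 := by
    rintro ⟨g, n⟩ ⟨g', n'⟩ (⟨rfl, h'⟩ | ⟨i, h, h'⟩)
    · simp only [nodeSign_congr_of_inComp h']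
    · dsimp only at h h' ⊢
      subst h
      have := nodeSign_match (p₀ := p₀) (n₁ := .inl b₀) (n₁' := .inl (ξ i)) (hξ i) h' (hξ i) g'
      rw [add_assoc, this, hc]
      have h2 := CharTwo.add_self_eq_zero (nodeSign τ p₀ g' (.inl (ξ i)))
      linear_combination h2
  refine ⟨Quot.lift _ key, fun g n n' => ?_⟩
  simp only [nodeMk]
  have h2 := CharTwo.add_self_eq_zero (c g)
  have h3 := CharTwo.add_self_eq_zero (nodeSign τ p₀ g (.inl b₀))
  linear_combination h2 + h3

lemma nodeSign_head_add [Finite O] (g : K) :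
    (g ∈ leafStab x τ.rel p₀ → nodeSign τ p₀ g (.inr p₀) + nodeSign τ p₀ g (.inr (τ.star p₀)) = 1) ∧
    (g ∉ leafStab x τ.rel p₀ →
      nodeSign τ p₀ g (.inr p₀) + nodeSign τ p₀ g (.inr (τ.star p₀)) = 0) := by
  constructor
  · intro hg
    have h1 : τ.Mem (.inr p₀) p₀ := mem_head_self p₀
    have h2 : ¬ τ.Mem (.inr (τ.star p₀)) p₀ := by
      rw [← mem_star]; exact mem_head_self _
    have e1 : nodeSign τ p₀ g (.inr p₀) = 1 := if_pos ((exists_mem_iff hg).2 h1)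
    have e2 : nodeSign τ p₀ g (.inr (τ.star p₀)) = 0 :=
      if_neg (fun h => h2 ((exists_mem_iff hg).1 h))
    rw [e1, e2, add_zero]
  · intro hg
    have : nodeSign τ p₀ g (.inr (τ.star p₀)) = nodeSign τ p₀ g (.inr p₀) := by
      refine nodeSign_congr (exists_congr fun q => and_congr_right fun hq => ?_)
      refine mem_head_star_iff ?_ ?_
      · rintro rfl; exact hg hq
      · rintro rfl; exact not_sameLeaf_star hq
    rw [this, CharTwo.add_self_eq_zero]

lemma nodeSMul_head_of_mem {g : K} (hg : g ∈ leafStab x τ.rel p₀) :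
    nodeMk τ p₀ g (.inr p₀) = nodeMk τ p₀ 1 (.inr p₀) ∧
    nodeMk τ p₀ g (.inr (τ.star p₀)) = nodeMk τ p₀ 1 (.inr (τ.star p₀)) :=
  ⟨nodeMk_of_sameLeaf hg, nodeMk_of_sameLeaf (sameLeaf_star hg)⟩

/-! ### Connectivity -/

variable (τ p₀) in
/-- Joined by a chain of translates of the edge of `p₀`. -/
def Joined : τ.NodeSpace p₀ → τ.NodeSpace p₀ → Prop :=
  Relation.EqvGen fun a b => ∃ k, a = nodeMk τ p₀ k (.inr (τ.star p₀)) ∧ b = nodeMk τ p₀ k (.inr p₀)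

lemma joined_head {q : O} (hq : τ.InComp p₀ q) (g : K) :
    Joined τ p₀ (nodeMk τ p₀ g (.inr (τ.star q))) (nodeMk τ p₀ g (.inr q)) := by
  rcases hq with ⟨k, hk⟩ | ⟨k, hk⟩
  · have hk' : SameLeaf x τ.rel (g, q) (g * k⁻¹, p₀) := by simpa using hk.smul (g * k⁻¹)
    have e1 := nodeMk_of_sameLeaf (p₀ := p₀) hk'
    have e2 := nodeMk_of_sameLeaf (p₀ := p₀) (sameLeaf_star hk')
    exact .rel _ _ ⟨_, e2, e1⟩
  · have hk' : SameLeaf x τ.rel (g, τ.star q) (g * k⁻¹, p₀) := by simpa using hk.smul (g * k⁻¹)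
    have e1 := nodeMk_of_sameLeaf (p₀ := p₀) hk'
    have e2 := nodeMk_of_sameLeaf (p₀ := p₀) (sameLeaf_star hk')
    simp only [τ.star_star] at e2
    exact .symm _ _ (.rel _ _ ⟨_, e2, e1⟩)

lemma InComp.star {q : O} (h : τ.InComp p₀ q) : τ.InComp p₀ (τ.star q) := by
  rcases h with h | h
  · exact Or.inr (by rwa [τ.star_star])
  · exact Or.inl h

lemma joined_sheet [Finite O] (g : K) (n n' : β ⊕ O) :
    Joined τ p₀ (nodeMk τ p₀ g n) (nodeMk τ p₀ g n') := by
  classical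
  generalize hN : {q | τ.InComp p₀ q ∧ ¬ τ.Mem n q ∧ τ.Mem n' q}.ncard = N
  induction N using Nat.strong_induction_on generalizing n with
  | _ N ih =>
  set D := {q | τ.InComp p₀ q ∧ ¬ τ.Mem n q ∧ τ.Mem n' q} with hD
  rcases D.eq_empty_or_nonempty with h0 | h0
  · have : nodeMk τ p₀ g n = nodeMk τ p₀ g n' := by
      refine nodeMk_congr fun q hq => ?_
      constructor
      · intro h
        by_contra h'
        have : τ.star q ∈ D := ⟨hq.star, by rwa [mem_star, not_not], by rwa [mem_star]⟩
        rw [h0] at this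
        exact this
      · intro h
        by_contra h'
        have : q ∈ D := ⟨hq, h', h⟩
        rw [h0] at this
        exact this
    rw [this]; exact Relation.EqvGen.refl _
  obtain ⟨q, hq, hmax⟩ := (Set.toFinite D).exists_maximalFor id D h0
  obtain ⟨hq1, hq2, hq3⟩ := hq
  have key : ∀ r, τ.InComp p₀ r → τ.Mem (.inr (τ.star q)) r → τ.Mem n r := by
    intro r hr h
    have hsq : τ.Mem n (τ.star q) := by rwa [mem_star]
    rcases h with h | h
    · exact hsq.mono h
    · rw [τ.star_star] at h
      by_contra hn
      exact h.not_ge (hmax (j := r) ⟨hr, hn, hq3.mono h.le⟩ h.le)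
  have e1 : nodeMk τ p₀ g n = nodeMk τ p₀ g (.inr (τ.star q)) := by
    refine nodeMk_congr fun r hr => ⟨fun h => ?_, key r hr⟩
    by_contra h'
    rw [← mem_star] at h'
    have := key _ hr.star h'
    rw [mem_star] at this
    exact this h
  rw [e1]
  refine .trans _ _ _ (joined_head hq1 g) (ih _ ?_ _ rfl)
  rw [← hN]
  refine Set.ncard_lt_ncard ⟨?_, ?_⟩ (Set.toFinite _)
  · rintro r ⟨hr1, hr2, hr3⟩
    refine ⟨hr1, fun h => hr2 ?_, hr3⟩
    by_cases hrq : r = q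
    · subst hrq; exact mem_head_self _
    by_cases hrq' : r = τ.star q
    · subst hrq'
      rw [mem_star] at hr3
      exact absurd hq3 hr3
    rw [← mem_head_star_iff hrq hrq']
    by_contra h'
    rw [← mem_star] at h'
    have := key _ hr1.star h'
    rw [mem_star] at this
    exact this h
  · intro hsub
    exact (hsub ⟨hq1, hq2, hq3⟩).2.1 (mem_head_self _)

lemma joined [Finite O] (b₀ : β) (ξ : ι → β) (hξ : ∀ i, (b₀, ξ i) ∈ windowPairs x e i)
    (ω ω' : τ.NodeSpace p₀) : Joined τ p₀ ω ω' := by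
  have key : ∀ g, Joined τ p₀ (nodeMk τ p₀ 1 (.inl b₀)) (nodeMk τ p₀ g (.inl b₀)) := by
    refine x.cayley_induction (.refl _) fun g i => ?_
    have h : Joined τ p₀ (nodeMk τ p₀ g (.inl b₀)) (nodeMk τ p₀ (g * x i) (.inl b₀)) := by
      rw [nodeMk_match (n := .inl b₀) (n' := .inl (ξ i)) (hξ i) g]
      exact joined_sheet g _ _
    exact ⟨fun h' => .trans _ _ _ h' h, fun h' => .trans _ _ _ h' (.symm _ _ h)⟩
  have key2 : ∀ ω, Joined τ p₀ (nodeMk τ p₀ 1 (.inl b₀)) ω := by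
    intro ω
    obtain ⟨g, n, rfl⟩ := exists_nodeMk ω
    exact .trans _ _ _ (key g) (joined_sheet g _ _)
  exact .trans _ _ _ (.symm _ _ (key2 ω)) (key2 ω')

end TrackSystem

end Colour

section NodeWall

variable {F ι β O : Type*} [Group F] {M : Subgroup F} [PartialOrder O] {x : FreeGroupBasis ι M}
  {e : β → M}

namespace TrackSystem

open Classical in
/-- The action by left multiplication. -/
noncomputable def nodeAction (τ : TrackSystem x e O) (p₀ : O) :
    PartialAction M (τ.NodeSpace p₀) where
  act g ω := if h : g ∈ M then nodeSMul ⟨g, h⟩ ω else ω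
  one ω := by
    obtain ⟨g, n, rfl⟩ := exists_nodeMk ω
    rw [dif_pos M.one_mem, nodeSMul_mk]
    congr 1
    exact one_mul g
  mul g hg h hh ω := by
    obtain ⟨k, n, rfl⟩ := exists_nodeMk ω
    rw [dif_pos hg, dif_pos hh, dif_pos (M.mul_mem hg hh), nodeSMul_mk, nodeSMul_mk, nodeSMul_mk,
      ← mul_assoc]
    rfl

variable {τ : TrackSystem x e O} {p₀ : O}

lemma nodeAction_mk (k g : M) (n : β ⊕ O) :
    (τ.nodeAction p₀).act k (nodeMk τ p₀ g n) = nodeMk τ p₀ (k * g) n := by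
  simp only [nodeAction, dif_pos k.2, nodeSMul_mk]

lemma nodeAction_isWall [Finite O] (b₀ : β) (ξ : ι → β)
    (hξ : ∀ i, (b₀, ξ i) ∈ windowPairs x e i) {col : τ.NodeSpace p₀ → ZMod 2}
    (hcol : ∀ g n n', col (nodeMk τ p₀ g n) + col (nodeMk τ p₀ g n') =
      nodeSign τ p₀ g n + nodeSign τ p₀ g n') :
    (τ.nodeAction p₀).IsWall (nodeMk τ p₀ 1 (.inr (τ.star p₀))) (nodeMk τ p₀ 1 (.inr p₀))
      {ω | col ω = col (nodeMk τ p₀ 1 (.inr p₀))} where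
  hu := by
    intro h
    have h1 := (nodeSign_head_add (τ := τ) (p₀ := p₀) 1).1 (one_mem _)
    rw [← hcol, show col _ = _ from h, CharTwo.add_self_eq_zero] at h1
    exact zero_ne_one h1
  hv := rfl
  cross := by
    intro g hg hne
    lift g to M using hg
    rw [nodeAction_mk, nodeAction_mk, mul_one] at hne ⊢
    by_cases hgC : g ∈ leafStab x τ.rel p₀
    · exact absurd (nodeSMul_head_of_mem hgC).symm hne
    · have h1 := (nodeSign_head_add (τ := τ) (p₀ := p₀) g).2 hgC
      rw [← hcol, CharTwo.add_eq_zero] at h1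
      simp only [Set.mem_ofPred_eq, h1]
  conn := by
    intro ω
    refine Relation.EqvGen.mono ?_ _ _ (joined b₀ ξ hξ _ ω)
    rintro a b ⟨k, rfl, rfl⟩
    exact ⟨k, k.2, by rw [nodeAction_mk, mul_one], by rw [nodeAction_mk, mul_one]⟩

lemma nodeAction_stab_inf_stab [Finite O] {col : τ.NodeSpace p₀ → ZMod 2}
    (hcol : ∀ g n n', col (nodeMk τ p₀ g n) + col (nodeMk τ p₀ g n') =
      nodeSign τ p₀ g n + nodeSign τ p₀ g n') {c : M}
    (hc : leafStab x τ.rel p₀ = Subgroup.zpowers c) :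
    (τ.nodeAction p₀).stab (nodeMk τ p₀ 1 (.inr (τ.star p₀))) ⊓
      (τ.nodeAction p₀).stab (nodeMk τ p₀ 1 (.inr p₀)) = Subgroup.zpowers (c : F) := by
  have hz : Subgroup.zpowers (c : F) = (leafStab x τ.rel p₀).map M.subtype := by
    rw [hc, MonoidHom.map_zpowers]; rfl
  ext g
  rw [hz, Subgroup.mem_inf, PartialAction.mem_stab, PartialAction.mem_stab]
  constructor
  · rintro ⟨⟨hg, h1⟩, -, h2⟩
    lift g to M using hg
    rw [nodeAction_mk, mul_one] at h1 h2
    refine ⟨g, ?_, rfl⟩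
    by_contra hgC
    have e1 := (nodeSign_head_add (τ := τ) (p₀ := p₀) g).2 hgC
    have e2 := (nodeSign_head_add (τ := τ) (p₀ := p₀) 1).1 (one_mem _)
    rw [← hcol, h1, h2] at e1
    rw [← hcol] at e2
    exact zero_ne_one (e1.symm.trans e2)
  · rintro ⟨g, hg, rfl⟩
    obtain ⟨h1, h2⟩ := nodeSMul_head_of_mem hg
    refine ⟨⟨g.2, ?_⟩, g.2, ?_⟩
    · exact (nodeAction_mk g 1 _).trans (by rw [mul_one, h2])
    · exact (nodeAction_mk g 1 _).trans (by rw [mul_one, h1])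

lemma nodeMk_window {b₀ : β} (hb : e b₀ = 1)
    (hconn : ∀ b, Relation.EqvGen (fun b b' => ∃ i, (b, b') ∈ windowPairs x e i) b₀ b) (b : β) :
    nodeMk τ p₀ (e b) (.inl b₀) = nodeMk τ p₀ 1 (.inl b) := by
  have key : ∀ b b', Relation.EqvGen (fun b b' => ∃ i, (b, b') ∈ windowPairs x e i) b b' →
      nodeMk τ p₀ (e b)⁻¹ (.inl b) = nodeMk τ p₀ (e b')⁻¹ (.inl b') := by
    intro b b' h
    induction h with
    | rel b b' h =>
      obtain ⟨i, hi⟩ := h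
      have := nodeMk_match (τ := τ) (p₀ := p₀) (n := .inl b) (n' := .inl b') hi (e b')⁻¹
      rw [← this]
      congr 1
      have h2 : e b' = x i * e b := hi
      rw [h2]; group
    | refl => rfl
    | symm _ _ _ ih => exact ih.symm
    | trans _ _ _ _ _ ih1 ih2 => exact ih1.trans ih2
  have := congrArg (nodeSMul (e b)) (key _ _ (hconn b))
  simpa [hb] using this

end TrackSystem

lemma PartialAction.IsWall.exists_eq {Ω : Type*} {α : PartialAction M Ω} {u v : Ω} {X : Set Ω}
    (h : α.IsWall u v X) (o : Ω) : ∃ k ∈ M, o = α.act k u ∨ o = α.act k v := by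
  have key : ∀ a b, Relation.EqvGen (fun a b => ∃ g ∈ M, a = α.act g u ∧ b = α.act g v) a b →
      ((∃ k ∈ M, a = α.act k u ∨ a = α.act k v) ↔ ∃ k ∈ M, b = α.act k u ∨ b = α.act k v) := by
    intro a b hab
    induction hab with
    | rel a b hab =>
      obtain ⟨g, hg, h1, h2⟩ := hab
      exact iff_of_true ⟨g, hg, Or.inl h1⟩ ⟨g, hg, Or.inr h2⟩
    | refl => rfl
    | symm _ _ _ ih => exact ih.symm
    | trans _ _ _ _ _ ih1 ih2 => exact ih1.trans ih2
  exact (key _ _ (h.conn o)).1 ⟨1, M.one_mem, Or.inl (α.one _).symm⟩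

/-- A track system with a leaf having cyclic stabilizer yields a splitting over a cyclic
subgroup. -/
theorem TrackSystem.exists_constructStep [Finite O] (τ : TrackSystem x e O) (p₀ : O) {c : M}
    (hc : leafStab x τ.rel p₀ = Subgroup.zpowers c) {b₀ : β} (hb : e b₀ = 1) (ξ : ι → β)
    (hξ : ∀ i, e (ξ i) = x i)
    (hconn : ∀ b, Relation.EqvGen (fun b b' => ∃ i, (b, b') ∈ windowPairs x e i) b₀ b)
    {T : Set β} (hT : ∀ s ∈ T, ∀ p, b₀ ∈ τ.side p ↔ s ∈ τ.side p) :
    ∃ M₁ : Subgroup F, ConstructStep M₁ M ∧ M₁ ≤ M ∧ (∀ s ∈ T, (e s : F) ∈ M₁) ∧ M₁ ≠ M := by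
  have hξ' : ∀ i, (b₀, ξ i) ∈ windowPairs x e i := fun i => by
    simp [windowPairs, hb, hξ]
  obtain ⟨col, hcol⟩ := τ.exists_colour p₀ b₀ ξ hξ'
  have hw := nodeAction_isWall b₀ ξ hξ' hcol
  set o := nodeMk τ p₀ 1 (.inl b₀) with ho
  obtain ⟨k, hk, hko⟩ := hw.exists_eq o
  have hwin := nodeMk_window (τ := τ) (p₀ := p₀) hb hconn
  refine ⟨(τ.nodeAction p₀).stab o, constructStep_iff.2
      ⟨_, hw.splitsOver_of_base (nodeAction_stab_inf_stab hcol hc) hk hko⟩,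
    fun g hg => hg.1, fun s hs => ⟨(e s).2, ?_⟩, fun h => ?_⟩
  · rw [ho, nodeAction_mk, mul_one, hwin]
    refine nodeMk_congr fun q _ => ?_
    exact (hT s hs q).symm
  · have hall : ∀ b, nodeMk τ p₀ 1 (.inl b) = o := by
      intro b
      have : ((e b : M) : F) ∈ (τ.nodeAction p₀).stab o := by rw [h]; exact (e b).2
      have := this.2
      rwa [ho, nodeAction_mk, mul_one, hwin] at this
    obtain ⟨b, hb1⟩ := τ.side_nonempty p₀
    obtain ⟨b', hb2⟩ := τ.side_nonempty (τ.star p₀)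
    rw [τ.side_star] at hb2
    have h1 := hcol 1 (.inl b) (.inl b')
    have e1 : nodeSign τ p₀ 1 (.inl b) = 1 := if_pos ⟨p₀, .refl _, hb1⟩
    have e2 : nodeSign τ p₀ 1 (.inl b') = 0 :=
      if_neg (fun h => hb2 ((exists_mem_iff (n := .inl b') (SameLeaf.refl (1, p₀))).1 h))
    rw [hall, hall, CharTwo.add_self_eq_zero, e1, e2, add_zero] at h1
    exact zero_ne_one h1

end NodeWall

section Windows

variable {ι K : Type*} [Group K]

/-- A set containing `1` which is connected under left multiplication by the generators. -/
def IsWindow (x : ι → K) (D : Set K) : Prop :=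
  ∃ h : 1 ∈ D, ∀ d : D, Relation.EqvGen (fun a b : D => ∃ i, (b : K) = x i * a) ⟨1, h⟩ d

lemma eqvGen_inclusion {x : ι → K} {D D' : Set K} (h : D ⊆ D') {a b : D}
    (hab : Relation.EqvGen (fun a b : D => ∃ i, (b : K) = x i * a) a b) :
    Relation.EqvGen (fun a b : D' => ∃ i, (b : K) = x i * a)
      (Set.inclusion h a) (Set.inclusion h b) := by
  induction hab with
  | rel a b hab => exact .rel _ _ hab
  | refl => exact .refl _
  | symm _ _ _ ih => exact .symm _ _ ih
  | trans _ _ _ _ _ ih1 ih2 => exact .trans _ _ _ ih1 ih2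

lemma IsWindow.insert {x : ι → K} {D : Set K} (hD : IsWindow x D) {a b : K} (ha : a ∈ D)
    (h : ∃ i, b = x i * a ∨ a = x i * b) : IsWindow x (insert b D) := by
  obtain ⟨h1, hD⟩ := hD
  have hsub : D ⊆ Insert.insert b D := Set.subset_insert b D
  refine ⟨hsub h1, ?_⟩
  rintro ⟨d, rfl | hd⟩
  · refine .trans _ _ _ (eqvGen_inclusion hsub (hD ⟨a, ha⟩)) ?_
    obtain ⟨i, h | h⟩ := h
    · exact .rel _ _ ⟨i, h⟩
    · exact .symm _ _ (.rel _ _ ⟨i, h⟩)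
  · exact eqvGen_inclusion hsub (hD ⟨d, hd⟩)

lemma IsWindow.biUnion {x : ι → K} {S : Set K} (hS : S.Nonempty) {D : K → Set K}
    (hD : ∀ g ∈ S, IsWindow x (D g)) : IsWindow x (⋃ g ∈ S, D g) := by
  obtain ⟨g₀, hg₀⟩ := hS
  refine ⟨Set.mem_biUnion hg₀ (hD g₀ hg₀).1, ?_⟩
  rintro ⟨d, hd⟩
  obtain ⟨g, hg, hd⟩ := Set.mem_iUnion₂.1 hd
  exact eqvGen_inclusion (Set.subset_biUnion_of_mem (u := D) hg) ((hD g hg).2 ⟨d, hd⟩)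

lemma FreeGroupBasis.exists_isWindow_mem (x : FreeGroupBasis ι K) (g : K) :
    ∃ D : Set K, D.Finite ∧ IsWindow x D ∧ g ∈ D := by
  suffices h : ∀ g : K, ∃ D : Set K, D.Finite ∧ IsWindow x D ∧ g⁻¹ ∈ D by simpa using h g⁻¹
  refine x.cayley_induction ⟨{1}, Set.finite_singleton _, ⟨rfl, ?_⟩, by simp⟩ ?_
  · rintro ⟨d, rfl⟩
    exact .refl _
  · intro g i
    constructor
    · rintro ⟨D, hf, hD, hg⟩
      exact ⟨_, hf.insert _, hD.insert hg ⟨i, Or.inr (by group)⟩, Set.mem_insert _ _⟩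
    · rintro ⟨D, hf, hD, hg⟩
      exact ⟨_, hf.insert _, hD.insert hg ⟨i, Or.inl (by group)⟩, Set.mem_insert _ _⟩

/-- A finite set is contained in a finite window. -/
lemma FreeGroupBasis.exists_isWindow (x : FreeGroupBasis ι K) {S : Set K} (hS : S.Finite) :
    ∃ D : Set K, D.Finite ∧ IsWindow x D ∧ S ⊆ D := by
  choose D hf hD hg using x.exists_isWindow_mem
  refine ⟨⋃ g ∈ insert 1 S, D g, (hS.insert 1).biUnion fun g _ => hf g,
    IsWindow.biUnion (Set.insert_nonempty _ _) fun g _ => hD g, fun s hs => ?_⟩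
  exact Set.mem_biUnion (Set.mem_insert_of_mem _ hs) (hg s)

end Windows

lemma finite_monoidHom_of_forall_mem {ι K F : Type*} [Group K] [Group F] [Finite ι]
    (x : FreeGroupBasis ι K) {B : Set F} (hB : B.Finite) :
    {h : K →* F | ∀ i, h (x i) ∈ B}.Finite := by
  have : {f : ι → F | ∀ i, f i ∈ B}.Finite := Set.Finite.pi' fun _ => hB
  refine Set.Finite.of_finite_image (f := fun h i => h (x i)) (this.subset ?_) ?_
  · rintro _ ⟨h, hh, rfl⟩ i
    exact hh i
  · intro h _ h' _ e
    exact x.ext_hom _ _ fun i => congrFun e i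

/-- A sequence of pairwise distinct homomorphisms with trivial stable kernel that is constant on a
finite set gives a proper subgroup containing this set, from which the group is obtained by one
amalgamated product or HNN extension over a cyclic subgroup. -/
theorem exists_constructStep_of_seq {F κ ι : Type*} [Group F] (y : FreeGroupBasis κ F) [Finite κ]
    {M : Subgroup F} [IsFreeGroup M] (x : FreeGroupBasis ι M) [Finite ι] {S : Set M}
    (hS : S.Finite) (h : ℕ → M →* F) (hinj : Function.Injective h)
    (hker : ∀ z, z ≠ 1 → ∀ᶠ n in atTop, h n z ≠ 1) (hfix : ∀ s ∈ S, ∀ n, h n s = h 0 s) :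
    ∃ M₁ : Subgroup F, ConstructStep M₁ M ∧ M₁ ≤ M ∧ (∀ s ∈ S, (s : F) ∈ M₁) ∧ M₁ ≠ M := by
  classical
  obtain ⟨𝓗, h𝓗⟩ := y.exists_isHalfTreeSystem
  obtain ⟨D, hDf, ⟨h1, hD⟩, hSD⟩ := x.exists_isWindow (hS.union (Set.finite_range x))
  have := Fintype.ofFinite ι
  have := hDf.fintype
  let e : D → M := Subtype.val
  let b₀ : D := ⟨1, h1⟩
  have hb : e b₀ = 1 := rfl
  let ξ : ι → D := fun i => ⟨x i, hSD (Or.inr ⟨i, rfl⟩)⟩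
  have hS' : ∀ s ∈ S, s ∈ D := fun s hs => hSD (Or.inl hs)
  let T : Set D := {d | e d ∈ S}
  have hunb : ∀ k, ∃ᶠ n in atTop, k ≤ windowVerts (traceWeight e 𝓗 (h n)) := by
    intro k hk
    have hfin : (h '' {n | ¬ k ≤ windowVerts (traceWeight e 𝓗 (h n))}).Finite := by
      refine (finite_monoidHom_of_forall_mem x (h𝓗.proper k)).subset ?_
      rintro _ ⟨n, hn, rfl⟩ i
      exact (ncard_sep_le_windowVerts h𝓗 hb (ξ i)).trans (not_le.1 hn).le
    have hfin' := hfin.of_finite_image hinj.injOn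
    obtain ⟨N, hN⟩ := eventually_atTop.1 hk
    exact (Set.Ici_infinite N) (hfin'.subset fun n hn => hN n hn)
  obtain ⟨δ, h1, h2, h3, h4, h5⟩ := exists_windowWeight (x := x) (e := e)
    (fun n => traceWeight e 𝓗 (h n)) (fun n => isWindowWeight_traceWeight x e h𝓗 (h n))
    (fun n H H' => traceWeight_nested e h𝓗 (h n)) hunb (by
      intro c hc
      obtain ⟨Z, hZ1, hZ⟩ := exists_finset_windowEdges_le x e h𝓗 c hc
      have : ∀ᶠ n in atTop, ∀ z ∈ Z, h n z ≠ 1 :=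
        (eventually_all_finset Z).2 fun z hz => hker z (fun e => hZ1 (e ▸ hz))
      exact this.mono fun n hn => hZ _ hn) b₀ T (by
      intro s hs n
      rw [sum_traceWeight_sep h𝓗 hb, sum_traceWeight_sep h𝓗 hb, hfix _ hs])
  obtain ⟨τ, hne, hτ⟩ := exists_trackSystem h1 h2 h3 h4 h5
  obtain ⟨p₀, hp₀⟩ := exists_comp_card_le (x := x) τ.card_le
  obtain ⟨c, hc⟩ := exists_leafStab_eq_zpowers τ.rel_right_unique hp₀
  obtain ⟨M₁, h6, h7, h8, h9⟩ := τ.exists_constructStep p₀ hc hb ξ (fun _ => rfl) hD hτ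
  exact ⟨M₁, h6, h7, fun s hs => h8 ⟨s, hS' s hs⟩ hs, h9⟩

section Extend

variable {F Z : Type*} [Group F] [Group Z] {P B C Q : Subgroup F}

lemma IsAmalgamOf.exists_extend {hP : C ≤ P} {hB : C ≤ B} (h : IsAmalgamOf P B C hP hB Q)
    (hPQ : P ≤ Q) (hBQ : B ≤ Q) (α : P →* Z) (β : B →* Z)
    (hαβ : ∀ c : C, α (Subgroup.inclusion hP c) = β (Subgroup.inclusion hB c)) :
    ∃ γ : Q →* Z, (∀ p, γ (Subgroup.inclusion hPQ p) = α p) ∧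
      ∀ p, γ (Subgroup.inclusion hBQ p) = β p := by
  obtain ⟨ℓ, h1, h2, rfl⟩ := h
  let f : ∀ i : Bool, (cond i P B : Subgroup F) →* Z := fun i => match i with
    | true => α
    | false => β
  let L := Monoid.PushoutI.lift (φ := fun i : Bool =>
    (Subgroup.inclusion (show C ≤ cond i P B by cases i <;> assumption) : C →* _)) f
    (α.comp (Subgroup.inclusion hP)) (by
      rintro (_ | _)
      · ext c; exact (hαβ c).symm
      · rfl)
  let E := MonoidHom.ofInjective h2
  have key : ∀ (i : Bool) (p : (cond i P B : Subgroup F)) (hp : (p : F) ∈ ℓ.range),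
      E.symm ⟨p, hp⟩ = Monoid.PushoutI.of i p := by
    intro i p hp
    rw [MulEquiv.symm_apply_eq]
    ext
    exact (DFunLike.congr_fun (h1 i) p).symm
  refine ⟨L.comp E.symm.toMonoidHom, fun p => ?_, fun p => ?_⟩
  · exact (congrArg L (key true p _)).trans (Monoid.PushoutI.lift_of _ _ _ _)
  · exact (congrArg L (key false p _)).trans (Monoid.PushoutI.lift_of _ _ _ _)

lemma IsHNNOf.le {C D : Subgroup P} {φ : C ≃* D} (h : IsHNNOf P φ Q) : P ≤ Q := by
  obtain ⟨ℓ, h1, h2, rfl⟩ := h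
  exact fun p hp => ⟨HNNExtension.of ⟨p, hp⟩, DFunLike.congr_fun h1 ⟨p, hp⟩⟩

lemma IsHNNOf.exists_extend {C D : Subgroup P} {φ : C ≃* D} (h : IsHNNOf P φ Q) :
    ∃ t : Q, ∀ (α : P →* Z) (z : Z), (∀ a : C, z * α a = α (φ a : P) * z) →
      ∃ γ : Q →* Z, (∀ p, γ (Subgroup.inclusion h.le p) = α p) ∧ γ t = z := by
  have hle := h.le
  obtain ⟨ℓ, h1, h2, rfl⟩ := h
  let E := MonoidHom.ofInjective h2
  refine ⟨E HNNExtension.t, fun α z hz => ?_⟩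
  let L := HNNExtension.lift α z hz
  have key : ∀ (p : P) (hp : (p : F) ∈ ℓ.range), E.symm ⟨p, hp⟩ = HNNExtension.of p := by
    intro p hp
    rw [MulEquiv.symm_apply_eq]
    ext
    exact (DFunLike.congr_fun h1 p).symm
  refine ⟨L.comp E.symm.toMonoidHom, fun p => ?_, ?_⟩
  · exact (congrArg L (key p _)).trans (HNNExtension.lift_of _ _ _ _)
  · exact (congrArg L (E.symm_apply_apply _)).trans (HNNExtension.lift_t _ _ _)

end Extend

section Count

lemma multiplicative_zmod_two_mul {a b : Multiplicative (ZMod 2)} (ha : a ≠ 1) (hb : b ≠ 1) :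
    a * b = 1 := by
  revert a b; decide

lemma card_le_of_two_extensions {A H : Type*} [CommGroup A] [Finite H] (r : H → A)
    (D : A →* Multiplicative (ZMod 2))
    (hs : ∀ α, D α = 1 → ∃ γ γ', r γ = α ∧ r γ' = α ∧ γ ≠ γ') :
    Finite A ∧ Nat.card A ≤ Nat.card H := by
  classical
  suffices h : ∃ f : A → H, Function.Injective f by
    obtain ⟨f, hf⟩ := h
    exact ⟨Finite.of_injective f hf, Nat.card_le_card_of_injective f hf⟩
  have : Nonempty H := ⟨(hs 1 (map_one D)).choose⟩
  choose! γ γ' h1 h2 h3 using hs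
  by_cases h0 : ∃ α₀, D α₀ ≠ 1
  · obtain ⟨α₀, h0⟩ := h0
    have hD : ∀ α, D α ≠ 1 → D (α * α₀) = 1 := fun α hα => by
      rw [map_mul, multiplicative_zmod_two_mul hα h0]
    have key : ∀ α α', D α = 1 → D α' ≠ 1 → γ α ≠ γ' (α' * α₀) := by
      intro α α' hα hα' e
      have := congrArg r e
      rw [h1 _ hα, h2 _ (hD _ hα')] at this
      rw [← this] at e
      exact h3 _ hα e
    refine ⟨fun α => if D α = 1 then γ α else γ' (α * α₀), fun α α' e => ?_⟩
    dsimp only at e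
    split_ifs at e with ha hb hb
    · rw [← h1 _ ha, e, h1 _ hb]
    · exact absurd e (key _ _ ha hb)
    · exact absurd e.symm (key _ _ hb ha)
    · have := congrArg r e
      rw [h2 _ (hD _ ha), h2 _ (hD _ hb)] at this
      exact mul_right_cancel this
  · push Not at h0
    exact ⟨γ, fun α α' e => by rw [← h1 _ (h0 α), e, h1 _ (h0 α')]⟩

lemma card_lt_of_two_extensions {A H : Type*} [Nonempty A] [Finite H] (r : H → A)
    (hs : ∀ α, ∃ γ γ', r γ = α ∧ r γ' = α ∧ γ ≠ γ') : Nat.card A < Nat.card H := by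
  choose γ γ' h1 h2 h3 using hs
  have hinj : Function.Injective γ := fun α α' e => by rw [← h1 α, e, h1 α']
  have := Fintype.ofFinite H
  have := Fintype.ofInjective γ hinj
  rw [Nat.card_eq_fintype_card, Nat.card_eq_fintype_card]
  obtain ⟨α⟩ := ‹Nonempty A›
  refine Fintype.card_lt_of_injective_of_notMem γ hinj (b := γ' α) ?_
  rintro ⟨α', e⟩
  have := congrArg r e
  rw [h1, h2] at this
  subst this
  exact h3 _ e

variable {F : Type*} [Group F] {P Q : Subgroup F}

lemma exists_modTwoHom_ne_one {G : Type*} [Group G] [IsFreeGroup G] [Nontrivial G] :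
    ∃ β : ModTwoHom G, β ≠ 1 := by
  let b := IsFreeGroup.basis G
  by_contra! h
  have : ∀ i : IsFreeGroup.Generators G, False := by
    intro i
    have h1 := h (b.lift fun _ => Multiplicative.ofAdd 1)
    have h2 := DFunLike.congr_fun h1 (b i)
    simp at h2
  have : IsEmpty (IsFreeGroup.Generators G) := ⟨this⟩
  have := (IsFreeGroup.toFreeGroup G).injective.subsingleton
  exact not_subsingleton G this

theorem SplitsOver.card_modTwoHom_le [IsFreeGroup F] {c : F} (h : SplitsOver c P Q)
    [Finite (ModTwoHom Q)] :
    Finite (ModTwoHom P) ∧ Nat.card (ModTwoHom P) ≤ Nat.card (ModTwoHom Q) := by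
  rcases h with ⟨B, hP, hB, hBQ, hPQ, h⟩ | ⟨hc, d, φ, h⟩
  · by_cases hs : ∀ α : ModTwoHom P, ∃ β : ModTwoHom B, α ⟨c, hP (Subgroup.mem_zpowers c)⟩ =
        β ⟨c, hB (Subgroup.mem_zpowers c)⟩
    · have hsurj : Function.Surjective
          fun γ : ModTwoHom Q => γ.comp (Subgroup.inclusion hPQ) := by
        intro α
        obtain ⟨β, hβ⟩ := hs α
        obtain ⟨γ, hγ, -⟩ := h.exists_extend hPQ hBQ α β (by
          rintro ⟨_, n, rfl⟩
          have := congrArg (· ^ n) hβ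
          simp only [← map_zpow] at this
          exact this)
        exact ⟨γ, MonoidHom.ext hγ⟩
      exact ⟨Finite.of_surjective _ hsurj, Nat.card_le_card_of_surjective _ hsurj⟩
    · push Not at hs
      obtain ⟨α₀, hα₀⟩ := hs
      have h1 : ∀ β : ModTwoHom B, β ⟨c, hB (Subgroup.mem_zpowers c)⟩ = 1 := by
        intro β
        by_contra hβ
        have h2 := hα₀ β
        have h3 := hα₀ 1
        rw [MonoidHom.one_apply] at h3
        generalize α₀ _ = a at h2 h3
        generalize β _ = b at h2 hβ
        revert a b; decide
      have hBn : Nontrivial B := by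
        refine ⟨⟨⟨c, hB (Subgroup.mem_zpowers c)⟩, 1, fun e => ?_⟩⟩
        have hc1 : c = 1 := congrArg Subtype.val e
        subst hc1
        exact hα₀ 1 (by rw [MonoidHom.one_apply]; exact map_one α₀)
      have : IsFreeGroup B := subgroupIsFreeOfIsFree B
      obtain ⟨β₀, hβ₀⟩ := exists_modTwoHom_ne_one (G := B)
      refine card_le_of_two_extensions (fun γ : ModTwoHom Q => γ.comp (Subgroup.inclusion hPQ))
        (MonoidHom.eval ⟨c, hP (Subgroup.mem_zpowers c)⟩) fun α hα => ?_
      have hext : ∀ β : ModTwoHom B, ∃ γ : Q →* Multiplicative (ZMod 2),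
          (∀ p, γ (Subgroup.inclusion hPQ p) = α p) ∧
          ∀ p, γ (Subgroup.inclusion hBQ p) = β p := fun β =>
        h.exists_extend hPQ hBQ α β (by
          rintro ⟨_, n, rfl⟩
          have := congrArg (· ^ n) ((show α _ = 1 from hα).trans (h1 β).symm)
          simp only [← map_zpow] at this
          exact this)
      obtain ⟨γ, hγ1, hγ2⟩ := hext 1
      obtain ⟨γ', hγ1', hγ2'⟩ := hext β₀
      refine ⟨γ, γ', MonoidHom.ext hγ1, MonoidHom.ext hγ1', ?_⟩
      rintro rfl
      exact hβ₀ (MonoidHom.ext fun p => (hγ2' p).symm.trans (hγ2 p))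
  · obtain ⟨t, ht⟩ := h.exists_extend (Z := Multiplicative (ZMod 2))
    refine card_le_of_two_extensions (fun γ : ModTwoHom Q => γ.comp (Subgroup.inclusion h.le))
      (MonoidHom.eval (⟨c, hc⟩ * (φ ⟨⟨c, hc⟩, Subgroup.mem_zpowers _⟩ : P))) fun α hα => ?_
    have hα' : α ⟨c, hc⟩ = α (φ ⟨⟨c, hc⟩, Subgroup.mem_zpowers _⟩ : P) := by
      rw [MonoidHom.eval_apply_apply, map_mul] at hα
      generalize α _ = a at hα ⊢
      generalize α _ = b at hα ⊢
      revert a b; decide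
    have hz : ∀ (z : Multiplicative (ZMod 2)) (a : Subgroup.zpowers (⟨c, hc⟩ : P)),
        z * α a = α (φ a : P) * z := by
      rintro z ⟨_, n, rfl⟩
      have e : φ ⟨(⟨c, hc⟩ : P) ^ n, n, rfl⟩ = φ ⟨⟨c, hc⟩, Subgroup.mem_zpowers _⟩ ^ n := by
        rw [← map_zpow]; rfl
      have e2 : α (φ ⟨(⟨c, hc⟩ : P) ^ n, n, rfl⟩ : P) = α ((⟨c, hc⟩ : P) ^ n) := by
        rw [e, Subgroup.coe_zpow, map_zpow, map_zpow, hα']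
      rw [mul_comm]
      exact congrArg (· * z) e2.symm
    obtain ⟨γ, hγ1, hγ2⟩ := ht α 1 (hz 1)
    obtain ⟨γ', hγ1', hγ2'⟩ := ht α (Multiplicative.ofAdd 1) (hz _)
    refine ⟨γ, γ', MonoidHom.ext hγ1, MonoidHom.ext hγ1', ?_⟩
    rintro rfl
    rw [hγ2] at hγ2'
    exact absurd hγ2' (by decide)

theorem SplitsOver.card_modTwoHom_lt [IsFreeGroup F] (h : SplitsOver 1 P Q) (hne : P ≠ Q)
    [Finite (ModTwoHom Q)] : Nat.card (ModTwoHom P) < Nat.card (ModTwoHom Q) := by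
  rcases h with ⟨B, hP, hB, hBQ, hPQ, h⟩ | ⟨hc, d, φ, h⟩
  · have hBn : Nontrivial B := by
      rw [Subgroup.nontrivial_iff_ne_bot]
      rintro rfl
      refine hne (le_antisymm hPQ ?_)
      obtain ⟨ℓ, h1, h2, rfl⟩ := h
      rintro _ ⟨w, rfl⟩
      induction w using Monoid.PushoutI.induction_on with
      | of i g =>
        have := DFunLike.congr_fun (h1 i) g
        rw [show ℓ (Monoid.PushoutI.of i g) = _ from this]
        cases i
        · have h3 : (g : F) = 1 := Subgroup.mem_bot.1 g.2
          rw [Subgroup.subtype_apply, h3]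
          exact P.one_mem
        · exact g.2
      | base g =>
        rw [← Monoid.PushoutI.of_apply_eq_base _ true g]
        have := DFunLike.congr_fun (h1 true)
        exact (this _) ▸ hP g.2
      | mul x y hx hy => rw [map_mul]; exact P.mul_mem hx hy
    have : IsFreeGroup B := subgroupIsFreeOfIsFree B
    obtain ⟨β₀, hβ₀⟩ := exists_modTwoHom_ne_one (G := B)
    refine card_lt_of_two_extensions (fun γ : ModTwoHom Q => γ.comp (Subgroup.inclusion hPQ))
      fun α => ?_
    have hext : ∀ β : ModTwoHom B, ∃ γ : Q →* Multiplicative (ZMod 2),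
        (∀ p, γ (Subgroup.inclusion hPQ p) = α p) ∧
        ∀ p, γ (Subgroup.inclusion hBQ p) = β p := fun β =>
      h.exists_extend hPQ hBQ α β (by
        rintro ⟨g, hg⟩
        obtain rfl : g = 1 := by simpa using hg
        exact (map_one α).trans (map_one β).symm)
    obtain ⟨γ, hγ1, hγ2⟩ := hext 1
    obtain ⟨γ', hγ1', hγ2'⟩ := hext β₀
    refine ⟨γ, γ', MonoidHom.ext hγ1, MonoidHom.ext hγ1', ?_⟩
    rintro rfl
    exact hβ₀ (MonoidHom.ext fun p => (hγ2' p).symm.trans (hγ2 p))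
  · obtain ⟨t, ht⟩ := h.exists_extend (Z := Multiplicative (ZMod 2))
    refine card_lt_of_two_extensions (fun γ : ModTwoHom Q => γ.comp (Subgroup.inclusion h.le))
      fun α => ?_
    have hz : ∀ (z : Multiplicative (ZMod 2)) (a : Subgroup.zpowers (⟨1, hc⟩ : P)),
        z * α a = α (φ a : P) * z := by
      rintro z ⟨g, hg⟩
      obtain rfl : g = 1 := by
        obtain ⟨n, hn⟩ := hg
        rw [← hn]
        exact one_zpow n
      have : φ ⟨1, hg⟩ = 1 := map_one φ
      rw [this, Subgroup.coe_one, mul_comm]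
    obtain ⟨γ, hγ1, hγ2⟩ := ht α 1 (hz 1)
    obtain ⟨γ', hγ1', hγ2'⟩ := ht α (Multiplicative.ofAdd 1) (hz _)
    refine ⟨γ, γ', MonoidHom.ext hγ1, MonoidHom.ext hγ1', ?_⟩
    rintro rfl
    rw [hγ2] at hγ2'
    exact absurd hγ2' (by decide)

end Count

section EdgeWall

variable {F κ : Type*} [Group F]

/-- Two group elements are joined by an edge of `E` in the Cayley graph. -/
def EdgeRel (y : κ → F) (E : Set (F × κ)) (f f' : F) : Prop := ∃ i, (f, i) ∈ E ∧ f' = f * y i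

/-- The Cayley graph, with the complement of the edge orbit `M • (f₀, a₀)` collapsed. -/
abbrev EdgeSpace (y : κ → F) (M : Subgroup F) (f₀ : F) (a₀ : κ) : Type _ :=
  Quot (EdgeRel y {e | ¬ ∃ k ∈ M, e = (k * f₀, a₀)})

/-- Left multiplication by an element of `M`. -/
def edgeSMul {y : κ → F} {M : Subgroup F} {f₀ : F} {a₀ : κ} (g : M) :
    EdgeSpace y M f₀ a₀ → EdgeSpace y M f₀ a₀ :=
  Quot.map ((g : F) * ·) (by
    rintro f f' ⟨i, hi, rfl⟩
    refine ⟨i, fun ⟨k, hk, he⟩ => hi ⟨(g : F)⁻¹ * k, M.mul_mem (M.inv_mem g.2) hk, ?_⟩,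
      (mul_assoc _ _ _).symm⟩
    rw [Prod.mk.injEq] at he ⊢
    exact ⟨by rw [mul_assoc, ← he.1, inv_mul_cancel_left], he.2⟩)

open Classical in
/-- The action by left multiplication. -/
noncomputable def edgeAction (y : κ → F) (M : Subgroup F) (f₀ : F) (a₀ : κ) :
    PartialAction M (EdgeSpace y M f₀ a₀) where
  act g ω := if h : g ∈ M then edgeSMul ⟨g, h⟩ ω else ω
  one ω := by
    induction ω using Quot.ind with
    | mk f =>
      rw [dif_pos M.one_mem]
      exact congrArg (Quot.mk _) (one_mul f)
  mul g hg h hh ω := by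
    induction ω using Quot.ind with
    | mk f =>
      rw [dif_pos hg, dif_pos hh, dif_pos (M.mul_mem hg hh)]
      exact congrArg (Quot.mk _) (mul_assoc g h f)

variable {y : κ → F} {M : Subgroup F} {f₀ : F} {a₀ : κ}

lemma edgeAction_mk {g : F} (hg : g ∈ M) (f : F) :
    (edgeAction y M f₀ a₀).act g (Quot.mk _ f) = Quot.mk _ (g * f) := by
  simp only [edgeAction, dif_pos hg]
  rfl

/-- If some half-space of a free group is crossed only by the edge `(f₀, a₀)`, then collapsing all
other edge orbits splits `M` freely. -/
lemma exists_splitsOver_one (y : FreeGroupBasis κ F) (M : Subgroup F) {P : Set F}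
    (h0 : f₀ ∉ P) (h1 : f₀ * y a₀ ∈ P)
    (hP : ∀ f i, ¬ (f = f₀ ∧ i = a₀) → (f ∈ P ↔ f * y i ∈ P)) :
    ∃ M₁ : Subgroup F, SplitsOver 1 M₁ M ∧ M₁ ≤ M ∧
      (∀ m ∈ M, Relation.EqvGen (EdgeRel y {e | ¬ ∃ k ∈ M, e = (k * f₀, a₀)}) 1 m → m ∈ M₁) ∧
      ∀ m ∈ M₁, (1 ∈ P ↔ m ∈ P) := by
  let X : Set (EdgeSpace y M f₀ a₀) := Quot.lift (· ∈ P) (by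
    rintro f f' ⟨i, hi, rfl⟩
    refine propext (hP f i ?_)
    rintro ⟨rfl, rfl⟩
    exact hi ⟨1, M.one_mem, by rw [one_mul]⟩)
  have hX : ∀ f, (Quot.mk _ f : EdgeSpace y M f₀ a₀) ∈ X ↔ f ∈ P := fun f => Iff.rfl
  set α := edgeAction y M f₀ a₀
  have hα : ∀ {g : F} (_ : g ∈ M) (f : F), α.act g (Quot.mk _ f) = Quot.mk _ (g * f) :=
    fun hg f => edgeAction_mk hg f
  have hside : ∀ g ∈ M, g ≠ 1 → (g * f₀ ∈ P ↔ g * (f₀ * y a₀) ∈ P) := by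
    intro g _ hg
    rw [← mul_assoc]
    exact hP _ _ (fun h => hg (mul_eq_right.1 h.1))
  have hW : α.IsWall (Quot.mk _ f₀) (Quot.mk _ (f₀ * y a₀)) X := by
    refine ⟨h0, h1, ?_, ?_⟩
    · intro g hg hne
      rw [hα hg, hα hg, hX, hX]
      refine hside g hg ?_
      rintro rfl
      exact hne ⟨α.one _, α.one _⟩
    · have hconn : ∀ f, Relation.EqvGen (fun a b => ∃ g ∈ M, a = α.act g (Quot.mk _ f₀) ∧
          b = α.act g (Quot.mk _ (f₀ * y a₀))) (Quot.mk _ 1) (Quot.mk _ f) := by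
        refine y.cayley_induction (Relation.EqvGen.refl _) ?_
        intro g i
        have hstep : Relation.EqvGen (fun a b => ∃ g ∈ M, a = α.act g (Quot.mk _ f₀) ∧
            b = α.act g (Quot.mk _ (f₀ * y a₀))) (Quot.mk _ g) (Quot.mk _ (g * y i)) := by
          by_cases h : ∃ k ∈ M, (g, i) = (k * f₀, a₀)
          · obtain ⟨k, hk, he⟩ := h
            rw [Prod.mk.injEq] at he
            obtain ⟨rfl, rfl⟩ := he
            exact .rel _ _ ⟨k, hk, (hα hk _).symm, by rw [hα hk, mul_assoc]⟩
          · have : (Quot.mk _ g : EdgeSpace y M f₀ a₀) = Quot.mk _ (g * y i) :=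
              Quot.sound ⟨i, h, rfl⟩
            rw [this]
            exact .refl _
        exact ⟨fun h => h.trans _ _ _ hstep, fun h => h.trans _ _ _ (hstep.symm _ _)⟩
      intro ω
      induction ω using Quot.ind with
      | mk f => exact ((hconn f₀).symm _ _).trans _ _ _ (hconn f)
  have hC : α.stab (Quot.mk _ f₀) ⊓ α.stab (Quot.mk _ (f₀ * y a₀)) = Subgroup.zpowers 1 := by
    rw [Subgroup.zpowers_one_eq_bot, eq_bot_iff]
    rintro g ⟨⟨hg, h2⟩, -, h3⟩
    rw [Subgroup.mem_bot]
    by_contra hne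
    rw [hα hg] at h2 h3
    have := hside g hg hne
    rw [← hX, ← hX, h2, h3, hX, hX] at this
    exact h0 (this.2 h1)
  obtain ⟨k, hk, ho⟩ := hW.exists_eq (Quot.mk _ 1)
  have hs := hW.splitsOver_of_base hC hk ho
  rw [mul_one, mul_inv_cancel] at hs
  refine ⟨_, hs, fun g hg => hg.1, ?_, ?_⟩
  · intro m hm h
    refine ⟨hm, ?_⟩
    rw [hα hm, mul_one]
    exact (Quot.eqvGen_sound h).symm
  · rintro m ⟨hm, h⟩
    rw [hα hm, mul_one] at h
    rw [← hX, ← hX, h]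

end EdgeWall

section Takahasi

variable {F κ : Type*} [Group F]

/-- If `S ⊆ M` lies in the connected set `U`, then either `M` is generated by `M ∩ U U⁻¹`, or some
free splitting of `M` has a proper vertex group containing `S`. -/
lemma exists_splitsOver_one_of_ne_closure (y : FreeGroupBasis κ F) {M : Subgroup F} {U : Set F}
    (h1 : 1 ∈ U)
    (hU : ∀ s ∈ U, Relation.EqvGen (EdgeRel y {e | e.1 ∈ U ∧ e.1 * y e.2 ∈ U}) 1 s)
    (hM : Subgroup.closure {g | g ∈ M ∧ ∃ u ∈ U, ∃ v ∈ U, g = u * v⁻¹} ≠ M) :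
    ∃ M₁, SplitsOver 1 M₁ M ∧ M₁ ≤ M ∧ (∀ s ∈ U, s ∈ M → s ∈ M₁) ∧ M₁ ≠ M := by
  set N := Subgroup.closure {g | g ∈ M ∧ ∃ u ∈ U, ∃ v ∈ U, g = u * v⁻¹}
  have hNM : N ≤ M := (Subgroup.closure_le _).2 fun g hg => hg.1
  obtain ⟨m, hm, hmN⟩ : ∃ m ∈ M, m ∉ N := by
    by_contra! h
    exact hM (le_antisymm hNM h)
  set E : Set (F × κ) := {e | ∃ k ∈ M, k⁻¹ * e.1 ∈ U ∧ k⁻¹ * (e.1 * y e.2) ∈ U}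
  have hmem : ∀ k ∈ M, ∀ u ∈ U, ∀ n ∈ N, ∀ u' ∈ U, n * u = k * u' → k ∈ N := by
    intro k hk u hu n hn u' hu' h
    have h2 : n⁻¹ * k = u * u'⁻¹ := by
      rw [eq_mul_inv_iff_mul_eq, mul_assoc, ← h, inv_mul_cancel_left]
    have h3 : n⁻¹ * k ∈ N :=
      Subgroup.subset_closure ⟨M.mul_mem (M.inv_mem (hNM hn)) hk, u, hu, u', hu', h2⟩
    simpa using N.mul_mem hn h3
  have hinv : ∀ a b, Relation.EqvGen (EdgeRel y E) a b →
      ((∃ n ∈ N, n⁻¹ * a ∈ U) ↔ ∃ n ∈ N, n⁻¹ * b ∈ U) := by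
    intro a b h
    induction h with
    | rel a b h =>
      obtain ⟨i, ⟨k, hk, h1, h2⟩, rfl⟩ := h
      constructor
      · rintro ⟨n, hn, hna⟩
        exact ⟨k, hmem k hk _ hna n hn _ h1 (by simp), h2⟩
      · rintro ⟨n, hn, hna⟩
        exact ⟨k, hmem k hk _ hna n hn _ h2 (by simp), h1⟩
    | refl => exact Iff.rfl
    | symm _ _ _ ih => exact ih.symm
    | trans _ _ _ _ _ ih1 ih2 => exact ih1.trans ih2
  have hm1 : ¬ Relation.EqvGen (EdgeRel y E) 1 m := by
    intro h
    obtain ⟨n, hn, hnm⟩ := (hinv _ _ h).1 ⟨1, N.one_mem, by simpa using h1⟩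
    exact hmN (hmem m hm _ hnm n hn 1 h1 (by simp))
  obtain ⟨P, hP0, hP, -⟩ := y.exists_halfTrees
  have hPT : ∀ f a, (f, a) ∉ E → ∀ g g', Relation.EqvGen (EdgeRel y E) g g' →
      (g ∈ P f a ↔ g' ∈ P f a) := by
    intro f a hfa g g' h
    induction h with
    | rel g g' h =>
      obtain ⟨i, hi, rfl⟩ := h
      refine hP _ _ _ _ ?_
      rintro ⟨rfl, rfl⟩
      exact hfa hi
    | refl => exact Iff.rfl
    | symm _ _ _ ih => exact ih.symm
    | trans _ _ _ _ _ ih1 ih2 => exact ih1.trans ih2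
  have hsep : ∀ g, Relation.EqvGen (EdgeRel y E) 1 g ∨
      ∃ f a, (f, a) ∉ E ∧ (Relation.EqvGen (EdgeRel y E) 1 f ∨
        Relation.EqvGen (EdgeRel y E) 1 (f * y a)) ∧ ¬ (1 ∈ P f a ↔ g ∈ P f a) := by
    refine y.cayley_induction (.inl (.refl _)) ?_
    intro g i
    by_cases hgi : (g, i) ∈ E
    · have hst : Relation.EqvGen (EdgeRel y E) g (g * y i) := .rel _ _ ⟨i, hgi, rfl⟩
      refine or_congr ⟨fun h => h.trans _ _ _ hst, fun h => h.trans _ _ _ (hst.symm _ _)⟩ ?_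
      refine exists_congr fun f => exists_congr fun a => and_congr_right fun hfa => ?_
      rw [hPT f a hfa _ _ hst]
    constructor
    · rintro (h | ⟨f, a, hfa, hT, hs⟩)
      · refine .inr ⟨g, i, hgi, .inl h, ?_⟩
        rw [hPT _ _ hgi _ _ h]
        exact fun h' => (hP0 g i).1 (h'.2 (hP0 g i).2)
      · by_cases he : g = f ∧ i = a
        · obtain ⟨rfl, rfl⟩ := he
          left
          refine hT.resolve_left fun h => hs ?_
          rw [hPT _ _ hgi _ _ h]
        · exact .inr ⟨f, a, hfa, hT, by rwa [← hP f a g i he]⟩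
    · rintro (h | ⟨f, a, hfa, hT, hs⟩)
      · refine .inr ⟨g, i, hgi, .inr h, ?_⟩
        rw [hPT _ _ hgi _ _ h]
        exact fun h' => (hP0 g i).1 (h'.1 (hP0 g i).2)
      · by_cases he : g = f ∧ i = a
        · obtain ⟨rfl, rfl⟩ := he
          left
          refine hT.resolve_right fun h => hs ?_
          rw [hPT _ _ hgi _ _ h]
        · exact .inr ⟨f, a, hfa, hT, by rwa [hP f a g i he]⟩
  obtain ⟨f₀, a₀, hE, -, hs⟩ := (hsep m).resolve_left hm1
  obtain ⟨M₁, hM₁, hle, hst, hside⟩ :=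
    exists_splitsOver_one y M (hP0 f₀ a₀).1 (hP0 f₀ a₀).2 (hP f₀ a₀)
  refine ⟨M₁, hM₁, hle, ?_, ?_⟩
  · intro s hsU hsM
    refine hst s hsM ((hU s hsU).mono ?_)
    rintro f f' ⟨i, ⟨hf, hf'⟩, rfl⟩
    refine ⟨i, ?_, rfl⟩
    rintro ⟨k, hk, he⟩
    rw [Prod.mk.injEq] at he
    obtain ⟨rfl, rfl⟩ := he
    refine hE ⟨k⁻¹, M.inv_mem hk, ?_, ?_⟩
    · rwa [inv_inv]
    · rwa [inv_inv, ← mul_assoc]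
  · rintro rfl
    exact hs (hside m hm)

/-- Every finite set lies in a finite connected set. -/
lemma FreeGroupBasis.exists_finite_connected (y : FreeGroupBasis κ F) {S : Set F} (hS : S.Finite) :
    ∃ U : Set F, U.Finite ∧ 1 ∈ U ∧ S ⊆ U ∧
      ∀ s ∈ U, Relation.EqvGen (EdgeRel y {e | e.1 ∈ U ∧ e.1 * y e.2 ∈ U}) 1 s := by
  obtain ⟨D, hD, ⟨h1, hconn⟩, hSD⟩ := y.exists_isWindow hS.inv
  refine ⟨D⁻¹, hD.inv, by simpa using h1, fun s hs => hSD (Set.inv_mem_inv.2 hs), ?_⟩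
  have key : ∀ a b : D, Relation.EqvGen (fun a b : D => ∃ i, (b : F) = y i * a) a b →
      Relation.EqvGen (EdgeRel y {e | e.1 ∈ D⁻¹ ∧ e.1 * y e.2 ∈ D⁻¹}) (a : F)⁻¹ (b : F)⁻¹ := by
    intro a b h
    induction h with
    | rel a b h =>
      obtain ⟨i, hi⟩ := h
      have hab : (b : F)⁻¹ * y i = (a : F)⁻¹ := by rw [hi]; group
      refine .symm _ _ (.rel _ _ ⟨i, ⟨?_, ?_⟩, hab.symm⟩)
      · simp
      · simp [hab]
    | refl => exact .refl _
    | symm _ _ _ ih => exact .symm _ _ ih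
    | trans _ _ _ _ _ ih1 ih2 => exact .trans _ _ _ ih1 ih2
  intro s hs
  simpa using key _ _ (hconn ⟨s⁻¹, hs⟩)

end Takahasi

section Preservation

variable {F α : Type*} [Group F]

open FirstOrder.Language

/-- Homomorphisms commute with the evaluation of terms; only finitely many variables matter. -/
lemma term_realize_map {n : ℕ} (t : grpLang.Term (α ⊕ Fin n)) :
    ∃ V : Set α, V.Finite ∧ ∀ (v v' : α → F) (xs : Fin n → F) (h : F →* F),
      (∀ a ∈ V, v' a = h (v a)) →
      t.realize (Sum.elim v' (h ∘ xs)) = h (t.realize (Sum.elim v xs)) := by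
  induction t with
  | var a =>
    cases a with
    | inl a => exact ⟨{a}, Set.finite_singleton a, fun v v' xs h hv => hv a rfl⟩
    | inr i => exact ⟨∅, Set.finite_empty, fun v v' xs h hv => rfl⟩
  | func f ts ih =>
    choose V hV hts using ih
    refine ⟨⋃ i, V i, Set.finite_iUnion hV, fun v v' xs h hv => ?_⟩
    have hi := fun i => hts i v v' xs h fun a ha => hv a (Set.mem_iUnion.2 ⟨i, ha⟩)
    rw [Term.realize_func, Term.realize_func, funext hi]
    cases f with
    | one => exact (map_one h).symm
    | inv => exact (map_inv h _).symm
    | mul => exact (map_mul h _ _).symm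

/-- A quantifier-free formula is preserved by the homomorphisms which do not kill some finite set
of nontrivial elements. -/
lemma isQF_realize_map {n : ℕ} {ψ : grpLang.BoundedFormula α n} (hψ : ψ.IsQF) (v : α → F)
    (xs : Fin n → F) :
    ∃ (V : Set α) (W : Set F), V.Finite ∧ W.Finite ∧ 1 ∉ W ∧ ∀ (v' : α → F) (h : F →* F),
      (∀ a ∈ V, v' a = h (v a)) → (∀ w ∈ W, h w ≠ 1) →
      (ψ.Realize v' (h ∘ xs) ↔ ψ.Realize v xs) := by
  classical
  induction hψ with
  | falsum =>
    exact ⟨∅, ∅, Set.finite_empty, Set.finite_empty, Set.notMem_empty _, fun _ _ _ _ => Iff.rfl⟩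
  | of_isAtomic hψ =>
    cases hψ with
    | equal t₁ t₂ =>
      obtain ⟨V₁, hV₁, h₁⟩ := term_realize_map (F := F) t₁
      obtain ⟨V₂, hV₂, h₂⟩ := term_realize_map (F := F) t₂
      refine ⟨V₁ ∪ V₂,
        {w | w = t₁.realize (Sum.elim v xs) * (t₂.realize (Sum.elim v xs))⁻¹ ∧ w ≠ 1}, hV₁.union hV₂, (Set.finite_singleton _).subset fun w hw => hw.1, fun h => h.2 rfl, ?_⟩
      intro v' h hv hw
      rw [BoundedFormula.realize_bdEqual, BoundedFormula.realize_bdEqual,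
        h₁ v v' xs h fun a ha => hv a (.inl ha), h₂ v v' xs h fun a ha => hv a (.inr ha)]
      refine ⟨fun he => ?_, fun he => by rw [he]⟩
      by_contra hne
      refine hw _ ⟨rfl, mul_inv_eq_one.not.2 hne⟩ ?_
      rw [map_mul, map_inv, he, mul_inv_cancel]
    | rel R ts => exact Empty.elim R
  | imp _ _ ih₁ ih₂ =>
    obtain ⟨V₁, W₁, hV₁, hW₁, h1₁, h₁⟩ := ih₁
    obtain ⟨V₂, W₂, hV₂, hW₂, h1₂, h₂⟩ := ih₂
    refine ⟨V₁ ∪ V₂, W₁ ∪ W₂, hV₁.union hV₂, hW₁.union hW₂, fun h => h.elim h1₁ h1₂, ?_⟩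
    intro v' h hv hw
    rw [BoundedFormula.realize_imp, BoundedFormula.realize_imp,
      h₁ v' h (fun a ha => hv a (.inl ha)) fun w hw' => hw w (.inl hw'),
      h₂ v' h (fun a ha => hv a (.inr ha)) fun w hw' => hw w (.inr hw')]

end Preservation

section Definability

variable {F : Type*} [Group F]

/-- The endomorphisms fixing `A₀` pointwise and not killing any element of `W`. -/
def homsFixing (A₀ W : Set F) : Set (F →* F) :=
  {h | (∀ a ∈ A₀, h a = a) ∧ ∀ w ∈ W, h w ≠ 1}

lemma homsFixing_anti {A₀ A₁ W₀ W₁ : Set F} (hA : A₀ ⊆ A₁) (hW : W₀ ⊆ W₁) :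
    homsFixing A₁ W₁ ⊆ homsFixing A₀ W₀ :=
  fun _ h => ⟨fun a ha => h.1 a (hA ha), fun w hw => h.2 w (hW hw)⟩

lemma exists_finite_image_of_mem_aclE {A : Set F} {s : F} (hs : s ∈ aclE A) :
    ∃ A₀ W : Set F, A₀ ⊆ A ∧ A₀.Finite ∧ W.Finite ∧ 1 ∉ W ∧
      ((fun h : F →* F => h s) '' homsFixing A₀ W).Finite := by
  obtain ⟨_, ⟨n, ψ, hψ, rfl⟩, hfin, hs⟩ := hs
  obtain ⟨xs, hxs⟩ := Language.BoundedFormula.realize_exs.1 hs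
  obtain ⟨V, W, hV, hW, h1, h⟩ := isQF_realize_map hψ _ xs
  refine ⟨Subtype.val '' {a : A | Sum.inl a ∈ V}, W, ?_, ?_, hW, h1, hfin.subset ?_⟩
  · rintro _ ⟨a, -, rfl⟩
    exact a.2
  · exact (hV.preimage Sum.inl_injective.injOn).image _
  · rintro _ ⟨f, hf, rfl⟩
    refine Language.BoundedFormula.realize_exs.2 ⟨f ∘ xs, (h _ f ?_ hf.2).2 hxs⟩
    rintro (a | i) ha
    · exact (hf.1 _ ⟨a, ha, rfl⟩).symm
    · rfl

open FirstOrder.Language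

lemma exists_term_realize_lift {α : Type*} {n : ℕ} (w : FreeGroup (Fin n)) :
    ∃ t : grpLang.Term (α ⊕ Fin n), ∀ (v : α → F) (xs : Fin n → F),
      t.realize (Sum.elim v xs) = FreeGroup.lift xs w := by
  induction w using FreeGroup.induction_on with
  | C1 => exact ⟨.func GrpFunc.one Fin.elim0, fun v xs => (map_one _).symm⟩
  | of i => exact ⟨.var (.inr i), fun v xs => (FreeGroup.lift_apply_of).symm⟩
  | inv_of i _ =>
    refine ⟨.func GrpFunc.inv fun _ => .var (.inr i), fun v xs => ?_⟩
    rw [map_inv, FreeGroup.lift_apply_of]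
    rfl
  | mul a b ha hb =>
    obtain ⟨t₁, h₁⟩ := ha
    obtain ⟨t₂, h₂⟩ := hb
    refine ⟨.func GrpFunc.mul fun i => if i = 0 then t₁ else t₂, fun v xs => ?_⟩
    rw [map_mul, ← h₁ v, ← h₂ v]
    rfl

/-- Relations defined by a quantifier-free formula. -/
def QFDefinable {α : Type*} {n : ℕ} (R : (α → F) → (Fin n → F) → Prop) : Prop :=
  ∃ ψ : grpLang.BoundedFormula α n, ψ.IsQF ∧ ∀ v xs, ψ.Realize v xs ↔ R v xs

lemma QFDefinable.and {α : Type*} {n : ℕ} {R R' : (α → F) → (Fin n → F) → Prop}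
    (h : QFDefinable R) (h' : QFDefinable R') : QFDefinable fun v xs => R v xs ∧ R' v xs := by
  obtain ⟨ψ, hψ, hR⟩ := h
  obtain ⟨ψ', hψ', hR'⟩ := h'
  exact ⟨ψ ⊓ ψ', hψ.inf hψ', fun v xs => by rw [BoundedFormula.realize_inf, hR, hR']⟩

lemma QFDefinable.forall_mem {α β : Type*} {n : ℕ} {R : β → (α → F) → (Fin n → F) → Prop}
    {T : Set β} (hT : T.Finite) (h : ∀ t ∈ T, QFDefinable (R t)) :
    QFDefinable fun v xs => ∀ t ∈ T, R t v xs := by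
  induction T, hT using Set.Finite.induction_on with
  | empty => exact ⟨⊤, BoundedFormula.IsQF.top, fun v xs => by simp⟩
  | insert _ _ ih =>
    obtain ⟨ψ, hψ, hR⟩ := (h _ (Set.mem_insert _ _)).and
      (ih fun t ht => h t (Set.mem_insert_of_mem _ ht))
    exact ⟨ψ, hψ, fun v xs => (hR v xs).trans (by simp)⟩

lemma qfDefinable_var_eq {α : Type*} {n : ℕ} (a : α) (w : FreeGroup (Fin n)) :
    QFDefinable (F := F) fun (v : α → F) xs => v a = FreeGroup.lift xs w := by
  obtain ⟨t, ht⟩ := exists_term_realize_lift (F := F) (α := α) w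
  refine ⟨Term.bdEqual (.var (.inl a)) t, (BoundedFormula.IsAtomic.equal _ _).isQF, fun v xs => ?_⟩
  rw [BoundedFormula.realize_bdEqual, ht]
  rfl

lemma qfDefinable_ne_one {α : Type*} {n : ℕ} (w : FreeGroup (Fin n)) :
    QFDefinable (F := F) fun (_ : α → F) xs => FreeGroup.lift xs w ≠ 1 := by
  obtain ⟨t, ht⟩ := exists_term_realize_lift (F := F) (α := α) w
  obtain ⟨t', ht'⟩ := exists_term_realize_lift (F := F) (α := α) (1 : FreeGroup (Fin n))
  refine ⟨∼(Term.bdEqual t t'), (BoundedFormula.IsAtomic.equal _ _).isQF.not, fun v xs => ?_⟩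
  rw [BoundedFormula.realize_not, BoundedFormula.realize_bdEqual, ht, ht', map_one]

lemma infinite_image_of_notMem_aclE (hF : IsFreeOfFiniteRank F) {A A₀ W : Set F} {b : F}
    (hb : b ∉ aclE A) (hA₀ : A₀ ⊆ A) (hA₀fin : A₀.Finite) (hW : W.Finite) (h1 : 1 ∉ W) :
    ((fun h : F →* F => h b) '' homsFixing A₀ W).Infinite := by
  obtain ⟨n, ⟨e⟩⟩ := hF
  intro hfin
  apply hb
  have hA₁ : {a : A | (a : F) ∈ A₀}.Finite := hA₀fin.preimage Subtype.val_injective.injOn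
  obtain ⟨ψ, hψ, hR⟩ : QFDefinable (F := F) fun (v : A ⊕ Fin 1 → F) (xs : Fin n → F) =>
      v (.inr 0) = FreeGroup.lift xs (e b) ∧
      (∀ a ∈ {a : A | (a : F) ∈ A₀}, v (.inl a) = FreeGroup.lift xs (e a)) ∧
      ∀ w ∈ W, FreeGroup.lift xs (e w) ≠ 1 :=
    (qfDefinable_var_eq _ _).and ((QFDefinable.forall_mem hA₁ fun a _ => qfDefinable_var_eq _ _).and
      (QFDefinable.forall_mem hW fun w _ => qfDefinable_ne_one _))
  have hφ : ∀ c : F, ψ.exs.Realize (Sum.elim Subtype.val fun _ => c) ↔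
      c ∈ (fun h : F →* F => h b) '' homsFixing A₀ W := by
    intro c
    rw [BoundedFormula.realize_exs]
    constructor
    · rintro ⟨xs, hxs⟩
      obtain ⟨hc, hA, hW⟩ := (hR _ _).1 hxs
      exact ⟨(FreeGroup.lift xs).comp e.toMonoidHom,
        ⟨fun a ha => (hA ⟨a, hA₀ ha⟩ ha).symm, hW⟩, hc.symm⟩
    · rintro ⟨h, ⟨hA, hW⟩, rfl⟩
      have hl : FreeGroup.lift (fun i => h (e.symm (.of i))) = h.comp e.symm.toMonoidHom := by
        ext i
        simp
      refine ⟨fun i => h (e.symm (.of i)), (hR _ _).2 ⟨?_, fun a ha => ?_, fun w hw => ?_⟩⟩ <;>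
        rw [hl]
      · simp
      · simpa using (hA a ha).symm
      · simpa using hW w hw
  refine ⟨ψ.exs, ⟨n, ψ, hψ, rfl⟩, ?_, (hφ b).2 ⟨MonoidHom.id F, ⟨fun _ _ => rfl, ?_⟩, rfl⟩⟩
  · exact hfin.subset fun c hc => (hφ c).1 hc
  · rintro w hw rfl
    exact h1 hw

end Definability

section Sequence

variable {F : Type*} [Group F]

lemma IsFreeOfFiniteRank.countable (hF : IsFreeOfFiniteRank F) : Countable F := by
  obtain ⟨n, ⟨e⟩⟩ := hF
  have : Countable (FreeGroup (Fin n)) := Quot.mk_surjective.countable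
  exact e.injective.countable

/-- If `b` is not algebraic over `A`, there are homomorphisms with trivial stable kernel moving `b`
and fixed on a given finite set of algebraic elements. -/
lemma exists_seq_of_notMem_aclE (hF : IsFreeOfFiniteRank F) {A S : Set F} {b : F}
    (hb : b ∉ aclE A) (hS : S.Finite) (hSA : S ⊆ aclE A) :
    ∃ h : ℕ → F →* F, (Function.Injective fun n => h n b) ∧
      (∀ z, z ≠ 1 → ∀ᶠ n in atTop, h n z ≠ 1) ∧ ∀ s ∈ S, ∀ n, h n s = h 0 s := by
  have := hF.countable
  obtain ⟨e, he⟩ := exists_surjective_nat F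
  choose! A₀ W hA₀ hA₀fin hW h1 hfin using
    fun s hs => exists_finite_image_of_mem_aclE (hSA (show s ∈ S from hs))
  set A₁ : Set F := ⋃ s ∈ S, A₀ s
  set W₁ : ℕ → Set F := fun n => (⋃ s ∈ S, W s) ∪ {w | (∃ i ≤ n, e i = w) ∧ w ≠ 1}
  have hA₁ : A₁.Finite := hS.biUnion hA₀fin
  have hW₁ : ∀ n, (W₁ n).Finite := by
    intro n
    refine (hS.biUnion hW).union (((Set.finite_Iic n).image e).subset ?_)
    rintro w ⟨⟨i, hi, rfl⟩, -⟩
    exact ⟨i, hi, rfl⟩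
  have h1W : ∀ n, 1 ∉ W₁ n := by
    rintro n (h | h)
    · obtain ⟨s, hs, h⟩ := Set.mem_iUnion₂.1 h
      exact h1 s hs h
    · exact h.2 rfl
  obtain ⟨f, hf, hlt⟩ := exists_seq_of_forall_finset_exists
    (fun p : ℕ × (F →* F) => p.2 ∈ homsFixing A₁ (W₁ p.1))
    (fun p q => p.1 < q.1 ∧ p.2 b ≠ q.2 b) (by
      intro T _
      set n := T.sup Prod.fst + 1
      obtain ⟨_, ⟨h, hh, rfl⟩, hT⟩ := ((infinite_image_of_notMem_aclE hF hb
        (Set.iUnion₂_subset hA₀) hA₁ (hW₁ n) (h1W n)).sdiff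
        (T.finite_toSet.image fun p => p.2 b)).nonempty
      refine ⟨(n, h), hh, fun p hp => ⟨Nat.lt_succ_of_le (Finset.le_sup (f := Prod.fst) hp), ?_⟩⟩
      exact fun hpb => hT ⟨p, hp, hpb⟩)
  have hval : ∀ n, (fun s : S => (f n).2 s) ∈
      Set.pi Set.univ fun s : S => (fun h : F →* F => h s) '' homsFixing (A₀ s) (W s) := by
    intro n s _
    exact ⟨(f n).2, homsFixing_anti (Set.subset_biUnion_of_mem (u := A₀) s.2)
      ((Set.subset_biUnion_of_mem (u := W) s.2).trans Set.subset_union_left) (hf n), rfl⟩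
  have := hS.to_subtype
  have hpi := Set.Finite.pi' fun s : S => hfin s s.2
  obtain ⟨φ, hφ⟩ : ∃ φ : S → F, {n | (fun s : S => (f n).2 s) = φ}.Infinite := by
    by_contra! hcon
    refine Set.infinite_univ (α := ℕ) ((hpi.biUnion fun φ _ => hcon φ).subset ?_)
    intro n _
    exact Set.mem_iUnion₂.2 ⟨_, fun s => hval n s trivial, rfl⟩
  have := hφ.to_subtype
  classical
  let g := Nat.orderEmbeddingOfSet {n | (fun s : S => (f n).2 s) = φ}
  have hg : ∀ n, (fun s : S => (f (g n)).2 s) = φ := fun n =>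
    (Nat.orderEmbeddingOfSet_range {n | (fun s : S => (f n).2 s) = φ}).subset
      (Set.mem_range_self n)
  have hmono : StrictMono fun n => (f n).1 := fun m n hmn => (hlt m n hmn).1
  refine ⟨fun n => (f (g n)).2, ?_, ?_, ?_⟩
  · intro m n hmn
    by_contra hne
    rcases lt_or_gt_of_ne hne with h | h
    · exact (hlt _ _ (g.strictMono h)).2 hmn
    · exact (hlt _ _ (g.strictMono h)).2 hmn.symm
  · intro z hz
    obtain ⟨i, rfl⟩ := he z
    filter_upwards [eventually_ge_atTop i] with n hn
    refine (hf (g n)).2 _ (.inr ⟨⟨i, ?_, rfl⟩, hz⟩)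
    exact hn.trans (g.strictMono.le_apply.trans hmono.le_apply)
  · intro s hs n
    exact congrFun ((hg n).trans (hg 0).symm) ⟨s, hs⟩

end Sequence

section Recursion

variable {F : Type*} [Group F]

/-- A finitely generated subgroup containing a non-algebraic element splits over a cyclic subgroup,
with a proper vertex group containing a given finite set of algebraic elements. -/
lemma exists_constructStep_of_notMem_aclE (hF : IsFreeOfFiniteRank F) {A S : Set F} (hS : S.Finite)
    (hSA : S ⊆ aclE A) {M : Subgroup F} [Finite (ModTwoHom M)] (hSM : S ⊆ M) {b : F} (hbM : b ∈ M)
    (hb : b ∉ aclE A) :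
    ∃ M₁, ConstructStep M₁ M ∧ M₁ ≤ M ∧ S ⊆ M₁ ∧ M₁ ≠ M := by
  obtain ⟨h, hinj, hker, hfix⟩ := exists_seq_of_notMem_aclE hF hb hS hSA
  obtain ⟨n, ⟨e⟩⟩ := hF
  let y : FreeGroupBasis (Fin n) F := ⟨e⟩
  have : IsFreeGroup F := y.isFreeGroup
  have : IsFreeGroup M := subgroupIsFreeOfIsFree M
  have := (IsFreeGroup.basis M).finite_of_finite_modTwoHom
  obtain ⟨M₁, hM₁, hle, hS₁, hne⟩ := exists_constructStep_of_seq y (IsFreeGroup.basis M)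
    (S := {s : M | (s : F) ∈ S}) (hS.preimage Subtype.val_injective.injOn)
    (fun n => (h n).comp M.subtype)
    (fun m n hmn => hinj (DFunLike.congr_fun hmn ⟨b, hbM⟩))
    (fun z hz => hker z fun h => hz (Subtype.ext h)) fun s hs n => hfix s hs n
  exact ⟨M₁, hM₁, hle, fun s hs => hS₁ ⟨s, hSM hs⟩ hs, hne⟩

/-- Finitely many algebraic elements of `M` lie in a subgroup of algebraic elements from which `M`
is constructible, and whose rank is at most that of `M`. -/
lemma exists_constructibleFrom (hF : IsFreeOfFiniteRank F) {A S : Set F} (hS : S.Finite)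
    (hSA : S ⊆ aclE A) {M : Subgroup F} [Finite (ModTwoHom M)] (hSM : S ⊆ M) :
    ∃ M' : Subgroup F, (M' : Set F) ⊆ aclE A ∧ S ⊆ M' ∧ ConstructibleFrom M' M ∧
      Finite (ModTwoHom M') ∧ Nat.card (ModTwoHom M') ≤ Nat.card (ModTwoHom M) := by
  obtain ⟨n, ⟨e⟩⟩ := id hF
  let y : FreeGroupBasis (Fin n) F := ⟨e⟩
  have : IsFreeGroup F := y.isFreeGroup
  obtain ⟨U, hU, h1U, hSU, hconn⟩ := y.exists_finite_connected hS
  let V : Set F := {g | ∃ u ∈ U, ∃ v ∈ U, g = u * v⁻¹}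
  have hV : V.Finite := by
    refine (hU.image2 (fun u v => u * v⁻¹) hU).subset ?_
    rintro _ ⟨u, hu, v, hv, rfl⟩
    exact ⟨u, hu, v, hv, rfl⟩
  let Q : Set (Subgroup F) := Subgroup.closure '' 𝒫 V
  have hQ : Q.Finite := hV.finite_subsets.image _
  have key : ∀ c k (M : Subgroup F), Finite (ModTwoHom M) → S ⊆ M →
      Nat.card (ModTwoHom M) = c → (Q ∩ Set.Iic M).ncard = k →
      ∃ M' : Subgroup F, (M' : Set F) ⊆ aclE A ∧ S ⊆ M' ∧ ConstructibleFrom M' M ∧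
      Finite (ModTwoHom M') ∧ Nat.card (ModTwoHom M') ≤ Nat.card (ModTwoHom M) := by
    intro c
    induction c using Nat.strong_induction_on with
    | _ c ihc =>
    intro k
    induction k using Nat.strong_induction_on with
    | _ k ihk =>
    rintro M hfin hSM rfl rfl
    have extend : ∀ M₁, ConstructStep M₁ M →
        Nat.card (ModTwoHom M₁) ≤ Nat.card (ModTwoHom M) →
        (∃ M' : Subgroup F, (M' : Set F) ⊆ aclE A ∧ S ⊆ M' ∧ ConstructibleFrom M' M₁ ∧
          Finite (ModTwoHom M') ∧ Nat.card (ModTwoHom M') ≤ Nat.card (ModTwoHom M₁)) →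
        ∃ M' : Subgroup F, (M' : Set F) ⊆ aclE A ∧ S ⊆ M' ∧ ConstructibleFrom M' M ∧
          Finite (ModTwoHom M') ∧ Nat.card (ModTwoHom M') ≤ Nat.card (ModTwoHom M) := by
      rintro M₁ hst hcard ⟨M', h1, h2, h3, h4, h5⟩
      exact ⟨M', h1, h2, h3.tail hst, h4, h5.trans hcard⟩
    by_cases hM : (M : Set F) ⊆ aclE A
    · exact ⟨M, hM, hSM, .refl, hfin, le_rfl⟩
    obtain ⟨b, hbM, hb⟩ := Set.not_subset.1 hM
    by_cases hshort : Subgroup.closure {g | g ∈ M ∧ g ∈ V} = M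
    · obtain ⟨M₁, hst, hle, hS₁, hne⟩ := exists_constructStep_of_notMem_aclE hF hS hSA hSM hbM hb
      obtain ⟨d, hd⟩ := constructStep_iff.1 hst
      obtain ⟨hfin₁, hcard⟩ := hd.card_modTwoHom_le
      refine extend M₁ hst hcard ?_
      rcases hcard.lt_or_eq with hlt | heq
      · exact ihc _ hlt _ M₁ hfin₁ hS₁ rfl rfl
      · refine ihk _ ?_ M₁ hfin₁ hS₁ heq rfl
        refine Set.ncard_lt_ncard ⟨fun P hP => ⟨hP.1, hP.2.trans hle⟩, fun hsub => hne ?_⟩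
          (hQ.subset Set.inter_subset_left)
        have hMQ : M ∈ Q ∩ Set.Iic M := ⟨⟨_, fun g hg => hg.2, hshort⟩, Set.self_mem_Iic⟩
        exact le_antisymm hle (hsub hMQ).2
    · obtain ⟨M₁, hd, hle, hS₁, hne⟩ := exists_splitsOver_one_of_ne_closure y h1U hconn hshort
      have hlt := hd.card_modTwoHom_lt hne
      exact extend M₁ (constructStep_iff.2 ⟨1, hd⟩) hlt.le (ihc _ hlt _ M₁ hd.card_modTwoHom_le.1
        (fun s hs => hS₁ s (hSU hs) (hSM hs)) rfl rfl)
  exact key _ _ M ‹_› hSM rfl rfl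

lemma finite_modTwoHom_of_fg {G : Type*} [Group G] (hG : Group.FG G) : Finite (ModTwoHom G) := by
  obtain ⟨T, hT⟩ := hG.out
  refine Finite.of_injective (fun (f : ModTwoHom G) (t : T) => f t) fun f g hfg => ?_
  exact MonoidHom.eq_of_eqOn_dense hT fun t ht => congrFun hfg ⟨t, ht⟩

/-- A subgroup of a free group containing finitely many elements of a basis has at least as many
homomorphisms to `ℤ/2`. -/
lemma FreeGroupBasis.two_pow_le_card_modTwoHom {ι : Type*} {E M : Subgroup F}
    (x : FreeGroupBasis ι E) (J : Finset ι) (hME : M ≤ E) (hJ : ∀ i ∈ J, (x i : F) ∈ M)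
    [Finite (ModTwoHom M)] : 2 ^ J.card ≤ Nat.card (ModTwoHom M) := by
  classical
  have hc : Nat.card (J → Multiplicative (ZMod 2)) = 2 ^ J.card := by simp
  rw [← hc]
  let φ : (J → Multiplicative (ZMod 2)) → ModTwoHom M := fun f =>
    (x.lift fun i => if h : i ∈ J then f ⟨i, h⟩ else 1).comp (Subgroup.inclusion hME)
  refine Nat.card_le_card_of_injective φ fun f g hfg => funext fun i => ?_
  have hφ : ∀ f, φ f ⟨x i, hJ i i.2⟩ = f i := by
    intro f
    exact (congrFun (x.lift.symm_apply_apply _) i).trans (dif_pos i.2)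
  rw [← hφ f, ← hφ g, hfg]

end Recursion

/-- Let `F` be a free group of finite rank and `A` a nonabelian
subgroup of `F`. Let `K` be a finitely generated subgroup of `F` containing `acl^∃(A)`.
Then `K` is constructible from `acl^∃(A)` over cyclic subgroups. -/
theorem constructible_from_aclE {F : Type*} [Group F] (hF : IsFreeOfFiniteRank F)
    (A : Subgroup F) (hA : Nonabelian (A : Set F))
    (K : Subgroup F) (hK : K.FG) (hsub : aclE (A : Set F) ⊆ (K : Set F)) :
    ConstructibleFrom (Subgroup.closure (aclE (A : Set F))) K := by
  have : IsFreeGroup F := by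
    obtain ⟨n, ⟨e⟩⟩ := hF
    exact FreeGroupBasis.isFreeGroup ⟨e⟩
  have : Finite (ModTwoHom K) := finite_modTwoHom_of_fg ((Group.fg_iff_subgroup_fg K).2 hK)
  have hex := fun (S : Set F) (hS : S.Finite) (hSA : S ⊆ aclE (A : Set F)) =>
    exists_constructibleFrom hF hS hSA (hSA.trans hsub)
  set E := Subgroup.closure (aclE (A : Set F))
  have hE : ∀ g ∈ E, g ∈ aclE (A : Set F) := by
    intro g hg
    obtain ⟨S, hS, hSA, hgS⟩ : ∃ S : Set F, S.Finite ∧ S ⊆ aclE (A : Set F) ∧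
        g ∈ Subgroup.closure S := by
      induction hg using Subgroup.closure_induction with
      | mem g hg =>
        exact ⟨{g}, Set.finite_singleton g, Set.singleton_subset_iff.2 hg,
          Subgroup.subset_closure rfl⟩
      | one => exact ⟨∅, Set.finite_empty, Set.empty_subset _, one_mem _⟩
      | mul _ _ _ _ ih₁ ih₂ =>
        obtain ⟨S, hS, hSA, h⟩ := ih₁
        obtain ⟨S', hS', hSA', h'⟩ := ih₂
        exact ⟨S ∪ S', hS.union hS', Set.union_subset hSA hSA',
          mul_mem (Subgroup.closure_mono Set.subset_union_left h)
            (Subgroup.closure_mono Set.subset_union_right h')⟩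
      | inv _ _ ih =>
        obtain ⟨S, hS, hSA, h⟩ := ih
        exact ⟨S, hS, hSA, inv_mem h⟩
    obtain ⟨M, hM, hSM, -⟩ := hex S hS hSA
    exact hM ((Subgroup.closure_le M).2 hSM hgS)
  have : IsFreeGroup E := subgroupIsFreeOfIsFree E
  let x := IsFreeGroup.basis E
  have hfin : Finite (IsFreeGroup.Generators E) := by
    by_contra hinf
    rw [not_finite_iff_infinite] at hinf
    obtain ⟨J, hJ⟩ := Infinite.exists_subset_card_eq (IsFreeGroup.Generators E)
      (Nat.card (ModTwoHom K))
    obtain ⟨M, hM, hSM, -, _, hcard⟩ := hex ((fun i => (x i : F)) '' J) (J.finite_toSet.image _)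
      (by rintro _ ⟨i, -, rfl⟩; exact hE _ (x i).2)
    have := x.two_pow_le_card_modTwoHom J (hM.trans Subgroup.subset_closure)
      fun i hi => hSM ⟨i, hi, rfl⟩
    rw [hJ] at this
    exact (this.trans hcard).not_gt Nat.lt_two_pow_self
  obtain ⟨M, hM, hSM, hMK, -⟩ := hex (Set.range fun i => (x i : F)) (Set.finite_range _)
    (by rintro _ ⟨i, rfl⟩; exact hE _ (x i).2)
  have hEM : E = M := by
    refine le_antisymm (fun g hg => ?_) (hM.trans Subgroup.subset_closure)
    refine x.cayley_induction (P := fun g => (g : F) ∈ M) (one_mem M) (fun g i => ?_) ⟨g, hg⟩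
    exact (M.mul_mem_cancel_right (hSM ⟨i, rfl⟩)).symm
  rwa [hEM]
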